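/- For m ≥ −1, the only pairs (x,y) ∈ ℤ² with F_m(x,y) = m²+3m+9 are: (2,1), (1,−3), (−3,2) for m = −1; (−5,−2), (−2,7), (7,−5) for m = 1; (3,0), (0,−3), (−3,3) for m = 3; (−1,−2), (−2,3), (3,−1), (−4,−1), (−1,5), (5,−4), (19,3), (3,−22), (−22,19) for m = 5; (−4,−1), (−1,5), (5,−4) for m = 12; (−5,−2), (−2,7), (7,−5) for m = 66; (−3,−19), (−19,22), (22,−3) for m = 1259; and there are no solutions for any other value of m ≥ −1. -/

import Mathlib

/-- The cubic form `F_m(X,Y) = X³ − mX²Y − (m+3)XY² − Y³`. -/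
def F (m x y : ℤ) : ℤ := x ^ 3 - m * x ^ 2 * y - (m + 3) * x * y ^ 2 - y ^ 3

section
theorem tl_pigeon {ι : Type} [Fintype ι] (T : ℕ) (hT : 1 ≤ T) (c : Fin T → ι → ℝ) (B : ℝ)
    (hB0 : 0 < B) (hB : ∀ j i, |c j i| ≤ B) (H : ℕ) (hH : 1 ≤ H) (h4 : 4 * T ≤ Fintype.card ι) :
    ∃ p : ι → ℤ, p ≠ 0 ∧ (∀ i, |p i| ≤ (H : ℤ)) ∧
      ∀ j, |∑ i, (p i : ℝ) * c j i| ≤ 2 * Fintype.card ι * B / (H : ℝ) ^ 3 := by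
  classical
  set N := Fintype.card ι with hN
  have hNpos : 0 < N := by omega
  have hHr : (1 : ℝ) ≤ H := by exact_mod_cast hH
  have hNr : (0 : ℝ) < N := by exact_mod_cast hNpos
  set Q : ℝ := N * H * B with hQ
  have hQpos : 0 < Q := by positivity
  let s : (ι → Fin (H + 1)) → Fin T → ℝ := fun f j => ∑ i, ((f i : ℕ) : ℝ) * c j i
  have hs : ∀ f j, |s f j| ≤ Q := by
    intro f j
    calc |s f j| ≤ ∑ i, |((f i : ℕ) : ℝ) * c j i| := Finset.abs_sum_le_sum_abs _ _
      _ ≤ ∑ i : ι, (H : ℝ) * B := by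
        apply Finset.sum_le_sum
        intro i _
        rw [abs_mul]
        apply mul_le_mul _ (hB j i) (abs_nonneg _) (by positivity)
        rw [abs_of_nonneg (by positivity)]
        exact_mod_cast Nat.lt_succ_iff.mp (f i).2
      _ = Q := by simp [hQ, hN]; ring
  let v : (ι → Fin (H + 1)) → Fin T → ℝ := fun f j => (s f j + Q) / (2 * Q) * (H : ℝ) ^ 4
  have hv0 : ∀ f j, 0 ≤ v f j := by
    intro f j
    have := (abs_le.mp (hs f j)).1
    apply mul_nonneg (div_nonneg (by linarith) (by linarith)) (by positivity)
  have hv1 : ∀ f j, v f j ≤ (H : ℝ) ^ 4 := by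
    intro f j
    have := (abs_le.mp (hs f j)).2
    have h1 : (s f j + Q) / (2 * Q) ≤ 1 := by
      rw [div_le_one (by positivity)]; linarith
    calc v f j ≤ 1 * (H : ℝ) ^ 4 := mul_le_mul_of_nonneg_right h1 (by positivity)
      _ = _ := one_mul _
  let g : (ι → Fin (H + 1)) → (Fin T → Fin (H ^ 4 + 1)) := fun f j =>
    ⟨⌊v f j⌋₊, by
      have : (⌊v f j⌋₊ : ℝ) ≤ (H : ℝ) ^ 4 := (Nat.floor_le (hv0 f j)).trans (hv1 f j)
      have : ⌊v f j⌋₊ ≤ H ^ 4 := by exact_mod_cast this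
      omega⟩
  have hcard : Fintype.card (Fin T → Fin (H ^ 4 + 1)) < Fintype.card (ι → Fin (H + 1)) := by
    simp only [Fintype.card_fun, Fintype.card_fin]
    rw [← hN]
    calc (H ^ 4 + 1) ^ T < ((H + 1) ^ 4) ^ T := by
          apply Nat.pow_lt_pow_left _ (by omega)
          have : (H + 1) ^ 4 = H ^ 4 + 1 + (4 * H ^ 3 + 6 * H ^ 2 + 4 * H) := by ring
          omega
      _ = (H + 1) ^ (4 * T) := by rw [pow_mul]
      _ ≤ (H + 1) ^ N := Nat.pow_le_pow_right (by omega) h4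
  obtain ⟨f1, f2, hne, heq⟩ := Fintype.exists_ne_map_eq_of_card_lt g hcard
  refine ⟨fun i => ((f1 i : ℕ) : ℤ) - ((f2 i : ℕ) : ℤ), ?_, ?_, ?_⟩
  · intro h0
    apply hne
    funext i
    have := congrFun h0 i
    simp only [Pi.zero_apply] at this
    apply Fin.ext
    omega
  · intro i
    have h1 := (f1 i).2
    have h2 := (f2 i).2
    show |((f1 i : ℕ) : ℤ) - ((f2 i : ℕ) : ℤ)| ≤ (H : ℤ)
    rw [abs_le]
    constructor <;> omega
  · intro j
    have h1 : ⌊v f1 j⌋₊ = ⌊v f2 j⌋₊ := by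
      have := congrFun heq j
      simpa [g] using congrArg Fin.val this
    have hd : |v f1 j - v f2 j| ≤ 1 := by
      have a1 := Nat.floor_le (hv0 f1 j)
      have a2 := Nat.lt_floor_add_one (v f1 j)
      have b1 := Nat.floor_le (hv0 f2 j)
      have b2 := Nat.lt_floor_add_one (v f2 j)
      rw [h1] at a1 a2
      rw [abs_le]; constructor <;> linarith
    have e1 : ∑ i, (((((f1 i : ℕ) : ℤ) - ((f2 i : ℕ) : ℤ) : ℤ)) : ℝ) * c j i = s f1 j - s f2 j := by
      simp only [s]
      rw [← Finset.sum_sub_distrib]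
      apply Finset.sum_congr rfl
      intro i _
      push_cast
      ring
    rw [e1]
    have e2 : s f1 j - s f2 j = (v f1 j - v f2 j) * (2 * N * B / (H : ℝ) ^ 3) := by
      simp only [v]
      have : (H : ℝ) ≠ 0 := by positivity
      rw [hQ]
      field_simp
      ring
    rw [e2, abs_mul]
    have h3 : 0 ≤ 2 * N * B / (H : ℝ) ^ 3 := by positivity
    rw [abs_of_nonneg h3]
    calc |v f1 j - v f2 j| * (2 * N * B / (H : ℝ) ^ 3) ≤ 1 * (2 * N * B / (H : ℝ) ^ 3) :=
          mul_le_mul_of_nonneg_right hd h3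
      _ = _ := one_mul _

open Polynomial in
theorem tl_coeff_prod {ι : Type} (s : Finset ι) (f : ι → ℝ[X]) (d : ι → ℕ)
    (h : ∀ i ∈ s, (f i).natDegree ≤ d i) :
    (∏ i ∈ s, f i).coeff (∑ i ∈ s, d i) = ∏ i ∈ s, (f i).coeff (d i) := by
  classical
  induction s using Finset.induction_on with
  | empty => simp
  | insert a s ha ih =>
    rw [Finset.prod_insert ha, Finset.sum_insert ha, Finset.prod_insert ha,
      coeff_mul_add_eq_of_natDegree_le (h a (Finset.mem_insert_self _ _)),
      ih fun i hi => h i (Finset.mem_insert_of_mem hi)]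
    refine (natDegree_prod_le _ _).trans (Finset.sum_le_sum fun i hi => h i (Finset.mem_insert_of_mem hi))

open Polynomial in
theorem tl_zero_est (K L : ℕ) (p : Fin K → Fin L → ℤ) (hp : p ≠ 0) (α : ℝ) (hα : 1 < α)
    (b : ℤ) (S : Finset ℤ) (hcard : K * L ≤ S.card) (y : ℤ → ℝ) 
    (hv : ∀ X ∈ S, ∀ j : ℕ, j < L →
      ∑ k : Fin K, ∑ l : Fin L, (p k l : ℝ) * ((X : ℝ) + j * b) ^ (k : ℕ) * (y X * α ^ j) ^ (l : ℕ) = 0)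
    (hy : ∀ X ∈ S, 0 < y X) : False := by
  classical
  -- column polynomials
  let Q : Fin L → ℝ[X] := fun l => ∑ k : Fin K, C (p k l : ℝ) * X ^ (k : ℕ)
  have hQcoeff : ∀ l (k : Fin K), (Q l).coeff k = p k l := by
    intro l k
    simp only [Q, finsetSum_coeff, coeff_C_mul, coeff_X_pow]
    rw [Finset.sum_eq_single k]
    · simp
    · intro i _ hi
      have : (k : ℕ) ≠ i := fun h => hi (Fin.ext h.symm)
      simp [this]
    · simp
  let J := {l : Fin L // Q l ≠ 0}
  have hJne : Nonempty J := by
    by_contra hcon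
    apply hp
    funext k l
    have : Q l = 0 := by
      by_contra h
      exact hcon ⟨⟨l, h⟩⟩
    have h2 := hQcoeff l k
    rw [this] at h2
    simp only [coeff_zero] at h2
    exact_mod_cast h2.symm
  have hKpos : 0 < K := by
    rcases Nat.eq_zero_or_pos K with h | h
    · exfalso; apply hp; funext k; exact absurd k.2 (by omega)
    · exact h
  let n := Fintype.card J
  have hnL : n ≤ L := by
    have := Fintype.card_subtype_le (fun l : Fin L => Q l ≠ 0)
    simp [n, J] at this ⊢
  have hnpos : 0 < n := Fintype.card_pos
  let e : Fin n ≃ J := (Fintype.equivFin J).symm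
  -- the matrix of polynomials
  let M : Matrix (Fin n) (Fin n) ℝ[X] := fun j i =>
    C (α ^ ((j : ℕ) * ((e i).1 : ℕ))) * (Q (e i).1).comp (X + C ((j : ℝ) * b))
  let d : Fin n → ℕ := fun i => (Q (e i).1).natDegree
  have hdK : ∀ i, d i + 1 ≤ K := by
    intro i
    have : (Q (e i).1).natDegree ≤ K - 1 := by
      apply natDegree_sum_le_of_forall_le
      intro k _
      calc _ ≤ (k : ℕ) := natDegree_C_mul_X_pow_le _ _
        _ ≤ K - 1 := by have := k.2; omega
    simp only [d]; omega
  have hMdeg : ∀ j i, (M j i).natDegree ≤ d i := by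
    intro j i
    refine (natDegree_C_mul_le _ _).trans ?_
    refine natDegree_comp_le.trans ?_
    rw [natDegree_X_add_C, mul_one]
  have hMcoeff : ∀ j i, (M j i).coeff (d i) = α ^ ((j : ℕ) * ((e i).1 : ℕ)) * (Q (e i).1).leadingCoeff := by
    intro j i
    simp only [M, coeff_C_mul]
    congr 1
    have h1 : ((Q (e i).1).comp (X + C ((j : ℝ) * b))).natDegree = d i := by
      rw [natDegree_comp, natDegree_X_add_C, mul_one]
    rw [← h1, coeff_natDegree, leadingCoeff_comp (by rw [natDegree_X_add_C]; exact one_ne_zero), leadingCoeff_X_add_C, one_pow, mul_one]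
  have hdetcoeff : M.det.coeff (∑ i, d i) =
      Matrix.det (Matrix.of fun j i : Fin n => α ^ ((j : ℕ) * ((e i).1 : ℕ)) * (Q (e i).1).leadingCoeff) := by
    rw [Matrix.det_apply, Matrix.det_apply, finsetSum_coeff]
    apply Finset.sum_congr rfl
    intro σ _
    rw [coeff_smul]
    congr 1
    rw [tl_coeff_prod] 
    · apply Finset.prod_congr rfl
      intro i _
      rw [hMcoeff]; rfl
    · intro i _
      exact hMdeg _ _
  have hdetne : Matrix.det (Matrix.of fun j i : Fin n => α ^ ((j : ℕ) * ((e i).1 : ℕ)) * (Q (e i).1).leadingCoeff) ≠ 0 := by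
    have h1 : (Matrix.of fun j i : Fin n => α ^ ((j : ℕ) * ((e i).1 : ℕ)) * (Q (e i).1).leadingCoeff)
      = Matrix.of fun j i : Fin n => (Q (e i).1).leadingCoeff *
          (Matrix.vandermonde fun i : Fin n => α ^ ((e i).1 : ℕ)).transpose j i := by
      ext j i
      simp only [Matrix.of_apply, Matrix.transpose_apply, Matrix.vandermonde_apply]
      rw [← pow_mul, mul_comm ((e i).1 : ℕ)]; ring
    rw [h1, Matrix.det_mul_row]
    apply mul_ne_zero
    · rw [Finset.prod_ne_zero_iff]
      intro i _
      exact leadingCoeff_ne_zero.mpr (e i).2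
    · rw [Matrix.det_transpose, Matrix.det_vandermonde_ne_zero_iff]
      intro i i' h
      have h2 : ((e i).1 : ℕ) = (e i').1 := by
        exact (pow_right_injective₀ (by linarith) (by linarith : α ≠ 1)) h
      apply e.injective
      apply Subtype.ext
      exact Fin.ext h2
  have hMne : M.det ≠ 0 := by
    intro h
    rw [h] at hdetcoeff
    exact hdetne (by simpa using hdetcoeff.symm)
  have hdegdet : M.det.natDegree < K * L := by
    have h1 : M.det.natDegree ≤ ∑ i, d i := by
      rw [Matrix.det_apply]
      apply natDegree_sum_le_of_forall_le
      intro σ _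
      refine (natDegree_smul_le _ _).trans ?_
      refine (natDegree_prod_le _ _).trans ?_
      apply Finset.sum_le_sum
      intro i _
      exact hMdeg _ _
    have h2 : ∑ i, d i + n ≤ n * K := by
      calc ∑ i, d i + n = ∑ i, (d i + 1) := by simp [Finset.sum_add_distrib]
        _ ≤ ∑ i : Fin n, K := Finset.sum_le_sum fun i _ => hdK i
        _ = n * K := by simp
    have h3 : n * K ≤ K * L := by rw [mul_comm]; exact Nat.mul_le_mul_left _ hnL
    omega
  -- every element of S is a root
  have hroot : ∀ x ∈ S, M.det.eval (x : ℝ) = 0 := by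
    intro x hx
    have h1 : M.det.eval (x : ℝ) = (M.map (eval (x : ℝ))).det := by
      have := RingHom.map_det (evalRingHom (x : ℝ)) M
      simpa [RingHom.mapMatrix_apply] using this
    rw [h1]
    apply Matrix.exists_mulVec_eq_zero_iff.mp
    refine ⟨fun i => y x ^ ((e i).1 : ℕ), ?_, ?_⟩
    · intro h0
      have := congrFun h0 ⟨0, hnpos⟩
      simp only [Pi.zero_apply] at this
      exact absurd this (pow_pos (hy x hx) _).ne'
    · funext j
      have hj := hv x hx j (lt_of_lt_of_le j.2 hnL)
      simp only [Matrix.mulVec, dotProduct, Pi.zero_apply, Matrix.map_apply]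
      rw [Finset.sum_comm] at hj
      have h2 : ∀ l : Fin L, ∑ k : Fin K, (p k l : ℝ) * ((x : ℝ) + (j : ℕ) * b) ^ (k : ℕ) * (y x * α ^ (j : ℕ)) ^ (l : ℕ)
          = (Q l).eval ((x : ℝ) + (j : ℕ) * b) * (α ^ ((j : ℕ) * l) * y x ^ (l : ℕ)) := by
        intro l
        simp only [Q, eval_finsetSum, eval_mul, eval_C, eval_pow, eval_X]
        rw [Finset.sum_mul]
        apply Finset.sum_congr rfl
        intro k _
        rw [mul_pow, pow_mul]; ring
      rw [Finset.sum_congr rfl (fun l _ => h2 l)] at hj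
      have h3 : ∑ i : Fin n, eval (x : ℝ) (M j i) * y x ^ ((e i).1 : ℕ)
         = ∑ i : J, (Q i.1).eval ((x : ℝ) + (j : ℕ) * b) * (α ^ ((j : ℕ) * i.1) * y x ^ (i.1 : ℕ)) := by
        rw [← e.sum_comp]
        apply Finset.sum_congr rfl
        intro i _
        simp only [M, eval_mul, eval_C, eval_comp, eval_add, eval_X]
        ring
      rw [h3, ← hj]
      have h4 := Finset.sum_subtype_of_mem (s := Finset.univ.filter fun l : Fin L => Q l ≠ 0) (p := fun l => Q l ≠ 0)
        (fun l : Fin L => (Q l).eval ((x : ℝ) + (j : ℕ) * b) * (α ^ ((j : ℕ) * l) * y x ^ (l : ℕ))) (by simp)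
      have h5 : (Finset.subtype (fun l => Q l ≠ 0) (Finset.univ.filter fun l : Fin L => Q l ≠ 0)) = Finset.univ := by
        ext a; simp [a.2]
      rw [h5] at h4
      rw [h4, Finset.sum_filter]
      apply Finset.sum_congr rfl
      intro l _
      by_cases h : Q l = 0 <;> simp [h]
  have : M.det = 0 := by
    apply eq_zero_of_natDegree_lt_card_of_eval_eq_zero' M.det (S.image (fun x : ℤ => (x : ℝ)))
    · intro r hr
      obtain ⟨x, hx, rfl⟩ := Finset.mem_image.mp hr
      exact hroot x hx
    · rw [Finset.card_image_of_injective _ Int.cast_injective]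
      omega
  exact hMne this
end

section
open Nat in
theorem tl_exp_rem (x : ℝ) (hx : 0 ≤ x) (n : ℕ) :
    |Real.exp x - ∑ i ∈ Finset.range n, x ^ i / i !| ≤ Real.exp (16 * x) / 16 ^ n := by
  have h1 : HasSum (fun n : ℕ => x ^ n / n !) (Real.exp x) := by
    have := NormedSpace.expSeries_div_hasSum_exp (𝔸 := ℝ) x
    rwa [← Real.exp_eq_exp_ℝ] at this
  have h2 : HasSum (fun n : ℕ => (16 * x) ^ n / n !) (Real.exp (16 * x)) := by
    have := NormedSpace.expSeries_div_hasSum_exp (𝔸 := ℝ) (16 * x)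
    rwa [← Real.exp_eq_exp_ℝ] at this
  have h1' := (hasSum_nat_add_iff' n).mpr h1
  have h2' := (hasSum_nat_add_iff' n).mpr h2
  have h0 : 0 ≤ Real.exp x - ∑ i ∈ Finset.range n, x ^ i / i ! :=
    h1'.nonneg fun i => by positivity
  rw [abs_of_nonneg h0, le_div_iff₀ (by positivity), mul_comm]
  have h3 := h1'.mul_left ((16 : ℝ) ^ n)
  have h4 := hasSum_le (fun i => by
    show (16 : ℝ) ^ n * (x ^ (i + n) / ((i + n)! : ℝ)) ≤ (16 * x) ^ (i + n) / ((i + n)! : ℝ)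
    rw [mul_pow, pow_add 16 i n, ← mul_div_assoc]
    apply div_le_div_of_nonneg_right _ (by positivity)
    have : (1 : ℝ) ≤ 16 ^ i := one_le_pow₀ (by norm_num)
    have h5 : 0 ≤ (16 : ℝ) ^ n * x ^ (i + n) := by positivity
    nlinarith) h3 h2'
  have h6 : 0 ≤ ∑ i ∈ Finset.range n, (16 * x) ^ i / (i ! : ℝ) :=
    Finset.sum_nonneg fun i _ => by positivity
  linarith

open Nat in
theorem tl_aux (K L T : ℕ) (hKT : K ≤ T) (hT : 1 ≤ T) (h4 : 4 * T ≤ K * L) (Xm Z B : ℝ)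
    (hX : 1 ≤ Xm) (hZ : 0 ≤ Z) (hB : Xm ^ K * Real.exp (L * Z) ≤ B) (H : ℕ) (hH : 1 ≤ H) :
    ∃ p : Fin K → Fin L → ℤ, p ≠ 0 ∧ (∀ k l, |p k l| ≤ (H : ℤ)) ∧ ∀ t : ℝ, 0 ≤ t → t ≤ 1 →
      |∑ k : Fin K, ∑ l : Fin L, (p k l : ℝ) * (Xm * t) ^ (k : ℕ) * Real.exp (l * (Z * t))| ≤
        T * (2 * (K * L) * B / (H : ℝ) ^ 3) +
        K * L * (H * Xm ^ K * (Real.exp (16 * (L * Z)) / 16 ^ (T - K))) := by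
  classical
  have hB0 : 0 < B := lt_of_lt_of_le (by positivity) hB
  let c : Fin T → (Fin K × Fin L) → ℝ := fun j kl =>
    if (kl.1 : ℕ) ≤ j then Xm ^ (kl.1 : ℕ) * ((kl.2 * Z) ^ ((j : ℕ) - kl.1) / (((j : ℕ) - kl.1)! : ℕ)) else 0
  have hXk : ∀ k : Fin K, Xm ^ (k : ℕ) ≤ Xm ^ K := fun k =>
    pow_le_pow_right₀ hX (le_of_lt k.2)
  have hlZ : ∀ l : Fin L, (l : ℝ) * Z ≤ L * Z := fun l => by
    apply mul_le_mul_of_nonneg_right _ hZ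
    exact_mod_cast le_of_lt l.2
  have hc : ∀ j kl, |c j kl| ≤ B := by
    intro j kl
    simp only [c]
    split_ifs with h
    · have hnn : 0 ≤ (kl.2 : ℝ) * Z := by positivity
      rw [abs_of_nonneg (by positivity)]
      refine le_trans ?_ hB
      apply mul_le_mul (hXk _) _ (by positivity) (by positivity)
      exact (Real.pow_div_factorial_le_exp _ hnn _).trans (Real.exp_le_exp.mpr (hlZ _))
    · simpa using hB0.le
  obtain ⟨p, hp0, hpH, hpc⟩ := tl_pigeon T hT c B hB0 hc H hH (by simpa using h4)
  refine ⟨fun k l => p (k, l), ?_, fun k l => hpH _, ?_⟩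
  · intro h
    apply hp0
    funext ⟨k, l⟩
    exact congrFun (congrFun h k) l
  intro t ht0 ht1
  -- split
  have hsplit : ∑ k : Fin K, ∑ l : Fin L, (p (k, l) : ℝ) * (Xm * t) ^ (k : ℕ) * Real.exp (l * (Z * t))
      = (∑ j : Fin T, t ^ (j : ℕ) * ∑ i, (p i : ℝ) * c j i)
        + ∑ k : Fin K, ∑ l : Fin L, (p (k, l) : ℝ) * (Xm * t) ^ (k : ℕ) *
          (Real.exp (l * (Z * t)) - ∑ i ∈ Finset.range (T - k), (l * (Z * t)) ^ i / (i ! : ℝ)) := by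
    have h1 : ∑ j : Fin T, t ^ (j : ℕ) * ∑ i, (p i : ℝ) * c j i =
       ∑ k : Fin K, ∑ l : Fin L, (p (k, l) : ℝ) * (Xm * t) ^ (k : ℕ) *
         ∑ i ∈ Finset.range (T - k), (l * (Z * t)) ^ i / (i ! : ℝ) := by
      simp_rw [Finset.mul_sum]
      rw [Finset.sum_comm, Fintype.sum_prod_type]
      apply Finset.sum_congr rfl
      intro k _
      apply Finset.sum_congr rfl
      intro l _
      rw [Fin.sum_univ_eq_sum_range (fun j => t ^ j * ((p (k, l) : ℝ) *
        (if (k : ℕ) ≤ j then Xm ^ (k : ℕ) * ((l * Z) ^ (j - k) / ((j - k)! : ℕ)) else 0))) T]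
      have hk : T = k + (T - k) := by have := k.2; omega
      conv_lhs => rw [hk, Finset.sum_range_add]
      rw [Finset.sum_eq_zero, zero_add]
      · apply Finset.sum_congr rfl
        intro i _
        rw [if_pos (by omega), Nat.add_sub_cancel_left, pow_add, mul_pow, mul_pow, mul_pow, mul_pow]
        ring
      · intro j hj
        rw [if_neg (by have := Finset.mem_range.mp hj; omega)]
        ring
    rw [h1, ← Finset.sum_add_distrib]
    apply Finset.sum_congr rfl
    intro k _
    rw [← Finset.sum_add_distrib]
    apply Finset.sum_congr rfl
    intro l _
    ring
  show |∑ k : Fin K, ∑ l : Fin L, (p (k, l) : ℝ) * (Xm * t) ^ (k : ℕ) * Real.exp (l * (Z * t))| ≤ _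
  rw [hsplit]
  refine (abs_add_le _ _).trans (add_le_add ?_ ?_)
  · refine (Finset.abs_sum_le_sum_abs _ _).trans ?_
    calc ∑ j : Fin T, |t ^ (j : ℕ) * ∑ i, (p i : ℝ) * c j i|
        ≤ ∑ j : Fin T, (2 * (K * L) * B / (H : ℝ) ^ 3) := by
          apply Finset.sum_le_sum
          intro j _
          rw [abs_mul, abs_of_nonneg (by positivity)]
          have h1 : t ^ (j : ℕ) ≤ 1 := pow_le_one₀ ht0 ht1
          have h2 := hpc j
          simp only [Fintype.card_prod, Fintype.card_fin, Nat.cast_mul] at h2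
          calc _ ≤ 1 * |∑ i, (p i : ℝ) * c j i| := mul_le_mul_of_nonneg_right h1 (abs_nonneg _)
            _ ≤ _ := by rw [one_mul]; exact h2
      _ = _ := by simp
  · refine (Finset.abs_sum_le_sum_abs _ _).trans ?_
    calc _ ≤ ∑ k : Fin K, (L * (H * Xm ^ K * (Real.exp (16 * (L * Z)) / 16 ^ (T - K)))) := by
          apply Finset.sum_le_sum
          intro k _
          refine (Finset.abs_sum_le_sum_abs _ _).trans ?_
          calc _ ≤ ∑ l : Fin L, (H * Xm ^ K * (Real.exp (16 * (L * Z)) / 16 ^ (T - K))) := by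
                apply Finset.sum_le_sum
                intro l _
                rw [abs_mul, abs_mul]
                have hlt : 0 ≤ (l : ℝ) * (Z * t) := by positivity
                have hlt2 : (l : ℝ) * (Z * t) ≤ L * Z := by
                  have h1 := hlZ l
                  have h2 : 0 ≤ (l : ℝ) * Z := by positivity
                  nlinarith
                have hrem := tl_exp_rem _ hlt (T - k)
                apply mul_le_mul (mul_le_mul _ _ (abs_nonneg _) (by positivity)) (hrem.trans _) (abs_nonneg _) (by positivity)
                · exact_mod_cast hpH (k, l)
                · rw [abs_of_nonneg (by positivity), mul_pow]
                  have h1 : t ^ (k : ℕ) ≤ 1 := pow_le_one₀ ht0 ht1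
                  calc _ ≤ Xm ^ (k : ℕ) * 1 := mul_le_mul_of_nonneg_left h1 (by positivity)
                    _ ≤ _ := by rw [mul_one]; exact hXk k
                · apply div_le_div₀ (by positivity) (Real.exp_le_exp.mpr (by linarith)) (by positivity)
                  apply pow_le_pow_right₀ (by norm_num)
                  have := k.2; omega
            _ = _ := by simp
      _ = _ := by simp; ring
end

section
theorem tl_inj (a b M s s' r r' : ℕ) (hc : Nat.Coprime a b) (hM : M ≤ max a b)
    (hs : s < M) (hs' : s' < M) (hr : r < M) (hr' : r' < M) (h : s * b + r * a = s' * b + r' * a)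
    (ha : 0 < a) (hb : 0 < b) :
    s = s' ∧ r = r' := by
  have hz : ((s : ℤ) - s') * b = (r' - r) * a := by
    have : (s : ℤ) * b + r * a = s' * b + r' * a := by exact_mod_cast h
    linarith
  have hcz : IsCoprime (a : ℤ) b := Nat.isCoprime_iff_coprime.mpr hc
  have haz : (0 : ℤ) < a := by exact_mod_cast ha
  have hbz : (0 : ℤ) < b := by exact_mod_cast hb
  rcases le_max_iff.mp hM with h1 | h1
  · have hd : (a : ℤ) ∣ (s : ℤ) - s' :=
      hcz.dvd_of_dvd_mul_right ⟨r' - r, by rw [hz]; ring⟩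
    have h0 : (s : ℤ) - s' = 0 := by
      apply Int.eq_zero_of_abs_lt_dvd hd
      rw [abs_lt]; constructor <;> omega
    rw [h0, zero_mul] at hz
    have : (r' : ℤ) - r = 0 := by
      rcases mul_eq_zero.mp hz.symm with h | h
      · exact h
      · omega
    constructor <;> omega
  · have hd : (b : ℤ) ∣ (r' : ℤ) - r :=
      hcz.symm.dvd_of_dvd_mul_right ⟨s - s', by rw [← hz]; ring⟩
    have h0 : (r' : ℤ) - r = 0 := by
      apply Int.eq_zero_of_abs_lt_dvd hd
      rw [abs_lt]; constructor <;> omega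
    rw [h0, zero_mul] at hz
    have : (s : ℤ) - s' = 0 := by
      rcases mul_eq_zero.mp hz with h | h
      · exact h
      · omega
    constructor <;> omega

theorem tl_size (l L A : ℕ) (hl : 80 ≤ l) (hL : L = 1000 * l) (hA : A < 2 ^ l) :
    (100000000 * L * L) * (30000 * L * A) ^ (100000000 * L) * 2 ^ (450000 * L ^ 2)
      ≤ 2 ^ (750000 * L ^ 2) := by
  have h1 : 100000000 * L * L ≤ 2 ^ (100000 * L ^ 2) := by
    have h2 : 100000 * L ^ 2 < 2 ^ (100000 * L ^ 2) := Nat.lt_two_pow_self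
    have h3 : L * L < 2 ^ (L * L) := Nat.lt_two_pow_self
    have h4 : 100000000 ≤ 2 ^ 27 := by norm_num
    calc 100000000 * L * L = 100000000 * (L * L) := by ring
      _ ≤ 2 ^ 27 * 2 ^ (L * L) := Nat.mul_le_mul h4 h3.le
      _ = 2 ^ (27 + L * L) := by rw [pow_add]
      _ ≤ _ := by
        apply Nat.pow_le_pow_right (by norm_num)
        nlinarith
  have h5 : 30000000 * l ≤ 2 ^ l := by
    have : ∀ n, 80 ≤ n → 30000000 * n ≤ 2 ^ n := by
      intro n hn
      induction n, hn using Nat.le_induction with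
      | base => norm_num
      | succ n hn ih => rw [pow_succ]; omega
    exact this l hl
  have h6 : 30000 * L * A ≤ 2 ^ (2 * l) := by
    calc 30000 * L * A = (30000000 * l) * A := by rw [hL]; ring
      _ ≤ 2 ^ l * 2 ^ l := Nat.mul_le_mul h5 hA.le
      _ = _ := by rw [← pow_add]; congr 1; ring
  have h7 : (30000 * L * A) ^ (100000000 * L) ≤ 2 ^ (200000 * L ^ 2) := by
    calc _ ≤ (2 ^ (2 * l)) ^ (100000000 * L) := Nat.pow_le_pow_left h6 _
      _ = _ := by rw [← pow_mul]; congr 1; rw [hL]; ring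
  calc _ ≤ 2 ^ (100000 * L ^ 2) * 2 ^ (200000 * L ^ 2) * 2 ^ (450000 * L ^ 2) :=
        Nat.mul_le_mul (Nat.mul_le_mul h1 h7) le_rfl
    _ = _ := by rw [← pow_add, ← pow_add]; congr 1; ring

set_option maxHeartbeats 4000000 in
theorem two_logs (α β : ℝ) (hα : 1 < α) (hβ : 1 < β) (hα9 : Real.log α ≤ 9) (hβ9 : Real.log β ≤ 9)
    (hLi : ∀ (H K L X Y s r : ℕ) (p : Fin K → Fin L → ℤ), (∀ k l, |p k l| ≤ (H : ℤ)) → X ≤ Y → 1 ≤ Y →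
      (∑ k : Fin K, ∑ l : Fin L, (p k l : ℝ) * (X : ℝ) ^ (k : ℕ) * (α ^ s * β ^ r) ^ (l : ℕ) = 0 ∨
      1 ≤ |∑ k : Fin K, ∑ l : Fin L, (p k l : ℝ) * (X : ℝ) ^ (k : ℕ) * (α ^ s * β ^ r) ^ (l : ℕ)| *
        ((K : ℝ) * L * H * Y ^ K * 2 ^ (13 * L * (s + r))) ^ 2))
    (a b l L : ℕ) (ha : 0 < a) (hb : 0 < b) (hc : Nat.Coprime a b) (hl : 80 ≤ l)
    (hL : L = 1000 * l) (hA2 : max a b < 2 ^ l) (hA1 : 10000 * L ≤ max a b) :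
    1 / ((2 : ℝ) ^ (1000000 * L ^ 2)) ^ 21 < |a * Real.log α - b * Real.log β| := by
  by_contra hcon
  push Not at hcon
  set A := max a b with hA
  set Ω : ℝ := (2 : ℝ) ^ (1000000 * L ^ 2) with hΩ
  set ε : ℝ := 1 / Ω ^ 21 with hε
  have hLpos : 80000 ≤ L := by omega
  have hΩpos : 0 < Ω := by positivity
  have hLL : 1 ≤ L ^ 2 := Nat.one_le_pow _ _ (by omega)
  have hΩbig : 4 ≤ Ω := by
    calc (4 : ℝ) = 2 ^ 2 := by norm_num
      _ ≤ _ := pow_le_pow_right₀ (by norm_num) (by omega)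
  have hεpos : 0 < ε := by positivity
  have hbr : (0 : ℝ) < b := by exact_mod_cast hb
  have hb1 : (1 : ℝ) ≤ b := by exact_mod_cast hb
  have har : (0 : ℝ) < a := by exact_mod_cast ha
  have hlα : 0 < Real.log α := Real.log_pos hα
  have hlβ : 0 < Real.log β := Real.log_pos hβ
  set g : ℝ := Real.log α / b with hg
  have hgpos : 0 < g := by positivity
  set e : ℝ := Real.log β - a * g with he
  have heε : |e| ≤ ε := by
    have : e = -(a * Real.log α - b * Real.log β) / b := by
      rw [he, hg]; field_simp; ring
    rw [this, abs_div, abs_neg, abs_of_pos hbr]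
    exact (div_le_self (abs_nonneg _) hb1).trans hcon
  have hε1 : ε ≤ 1 := by
    rw [hε, div_le_one (by positivity)]
    exact one_le_pow₀ (by linarith)
  set Xm : ℕ := 30000 * L * A with hXm
  have hApos : 0 < A := lt_of_lt_of_le ha (le_max_left _ _)
  have hXm1 : 1 ≤ Xm := Nat.mul_pos (by omega) hApos
  set Z : ℝ := g * Xm with hZ
  have hgA : g * A ≤ 10 := by
    rcases le_total a b with h | h
    · rw [hA, max_eq_right h, hg, div_mul_cancel₀ _ hbr.ne']; linarith
    · rw [hA, max_eq_left h]
      have : a * g = Real.log β - e := by rw [he]; ring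
      have h2 := (abs_le.mp heε).1
      rw [mul_comm]; linarith
  have hZ0 : 0 ≤ Z := by positivity
  have hLZ : (L : ℝ) * Z ≤ 300000 * (L : ℝ) ^ 2 := by
    rw [hZ, hXm]; push_cast
    have : (0 : ℝ) ≤ 30000 * (L : ℝ) ^ 2 := by positivity
    nlinarith
  have hexp2 : Real.exp (L * Z) ≤ 2 ^ (450000 * L ^ 2) := by
    have h1 : Real.exp 2 ≤ 2 ^ 3 := by
      have := Real.exp_one_lt_d9
      have h2 : Real.exp 2 = Real.exp 1 ^ 2 := by rw [← Real.exp_nat_mul]; norm_num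
      rw [h2]
      have := Real.exp_pos 1
      nlinarith
    calc Real.exp (L * Z) ≤ Real.exp ((150000 * L ^ 2 : ℕ) * 2) := by
          apply Real.exp_le_exp.mpr; push_cast; linarith
      _ = Real.exp 2 ^ (150000 * L ^ 2) := by rw [Real.exp_nat_mul]
      _ ≤ (2 ^ 3) ^ (150000 * L ^ 2) := pow_le_pow_left₀ (Real.exp_pos _).le h1 _
      _ = _ := by rw [← pow_mul]; congr 1; ring
  set K : ℕ := 100000000 * L with hK
  set T : ℕ := 25000000 * L ^ 2 with hT
  have hsize : ((K : ℝ) * L) * (Xm : ℝ) ^ K * 2 ^ (450000 * L ^ 2) ≤ 2 ^ (750000 * L ^ 2) := by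
    have := tl_size l L A hl hL hA2
    rw [← hK, ← hXm] at this
    exact_mod_cast this
  have hsizeΩ : ((K : ℝ) * L) * (Xm : ℝ) ^ K * 2 ^ (450000 * L ^ 2) ≤ Ω :=
    hsize.trans (pow_le_pow_right₀ (by norm_num) (by omega))
  have hKL : (K : ℝ) * L ≤ Ω := by
    refine le_trans ?_ hsizeΩ
    have h1 : (1 : ℝ) ≤ (Xm : ℝ) ^ K := one_le_pow₀ (by exact_mod_cast hXm1)
    have h2 : (1 : ℝ) ≤ 2 ^ (450000 * L ^ 2) := one_le_pow₀ (by norm_num)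
    have h3 : 0 ≤ (K : ℝ) * L := by positivity
    calc (K : ℝ) * L = K * L * 1 * 1 := by ring
      _ ≤ _ := by gcongr
  set H : ℕ := (2 ^ (1000000 * L ^ 2)) ^ 5 with hH
  have hHr : (H : ℝ) = Ω ^ 5 := by rw [hH, hΩ]; push_cast; rfl
  have hH1 : 1 ≤ H := Nat.one_le_pow _ _ (by positivity)
  have h4T : 4 * T ≤ K * L := by rw [hT, hK]; apply le_of_eq; ring
  have hTK : 20000000 * L ^ 2 ≤ T - K := by
    have : 20000000 * L ^ 2 + K ≤ T := by rw [hT, hK]; nlinarith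
    omega
  have hKT : K ≤ T := by
    have : 20000000 * L ^ 2 + K ≤ T := by rw [hT, hK]; nlinarith
    omega
  obtain ⟨p, hp0, hpH, hpt⟩ := tl_aux K L T hKT (by omega) h4T Xm Z (Xm ^ K * Real.exp (L * Z))
    (by exact_mod_cast hXm1) hZ0 le_rfl H hH1
  have hNB : (K : ℝ) * L * (Xm ^ K * Real.exp (L * Z)) ≤ Ω := by
    refine le_trans ?_ hsizeΩ
    rw [← mul_assoc]
    exact mul_le_mul_of_nonneg_left hexp2 (by positivity)
  have hNX : (K : ℝ) * L * Xm ^ K ≤ Ω := by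
    refine le_trans ?_ hsizeΩ
    apply le_mul_of_one_le_right (by positivity)
    exact one_le_pow₀ (by norm_num)
  -- first two terms
  have hbound : ∀ t : ℝ, 0 ≤ t → t ≤ 1 →
      |∑ k : Fin K, ∑ l : Fin L, (p k l : ℝ) * (Xm * t) ^ (k : ℕ) * Real.exp (l * (Z * t))| ≤
        1 / Ω ^ 13 + 1 / Ω ^ 13 := by
    intro t h0 h1
    refine (hpt t h0 h1).trans (add_le_add ?_ ?_)
    · rw [hHr]
      have h2 : (2 : ℝ) * T ≤ Ω := by
        have : (4 : ℝ) * T ≤ K * L := by exact_mod_cast h4T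
        have : (0 : ℝ) ≤ T := by positivity
        linarith
      calc (T : ℝ) * (2 * (K * L) * (Xm ^ K * Real.exp (L * Z)) / (Ω ^ 5) ^ 3)
          = (2 * T) * (K * L * (Xm ^ K * Real.exp (L * Z))) / Ω ^ 15 := by ring
        _ ≤ Ω * Ω / Ω ^ 15 := by
          apply div_le_div_of_nonneg_right _ (by positivity)
          exact mul_le_mul h2 hNB (by positivity) hΩpos.le
        _ = 1 / Ω ^ 13 := by field_simp
    · rw [hHr]
      have h2 : Real.exp (16 * (L * Z)) / 16 ^ (T - K) ≤ 1 / Ω ^ 40 := by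
        have h3 : Real.exp (16 * (L * Z)) ≤ 4 ^ (T - K) := by
          have h5 : (20000000 : ℝ) * L ^ 2 ≤ ((T - K : ℕ) : ℝ) := by exact_mod_cast hTK
          calc Real.exp (16 * (L * Z)) ≤ Real.exp (((T - K : ℕ) : ℝ) * 1) := by
                apply Real.exp_le_exp.mpr
                have : (0 : ℝ) ≤ (L : ℝ) ^ 2 := by positivity
                linarith
            _ = Real.exp 1 ^ (T - K) := by rw [Real.exp_nat_mul]
            _ ≤ 4 ^ (T - K) := by
              apply pow_le_pow_left₀ (Real.exp_pos _).le
              have := Real.exp_one_lt_d9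
              linarith
        have h6 : Ω ^ 40 ≤ 4 ^ (T - K) := by
          calc Ω ^ 40 = 2 ^ (40000000 * L ^ 2) := by rw [hΩ, ← pow_mul]; congr 1; ring
            _ = (2 ^ 2) ^ (20000000 * L ^ 2) := by rw [← pow_mul]; congr 1; ring
            _ = 4 ^ (20000000 * L ^ 2) := by norm_num
            _ ≤ _ := pow_le_pow_right₀ (by norm_num) hTK
        have h7 : (16 : ℝ) ^ (T - K) = 4 ^ (T - K) * 4 ^ (T - K) := by
          rw [← mul_pow]; norm_num
        rw [div_le_div_iff₀ (by positivity) (by positivity), h7, one_mul]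
        exact mul_le_mul h3 h6 (by positivity) (by positivity)
      calc (K : ℝ) * L * (Ω ^ 5 * Xm ^ K * (Real.exp (16 * (L * Z)) / 16 ^ (T - K)))
          = (K * L * Xm ^ K) * Ω ^ 5 * (Real.exp (16 * (L * Z)) / 16 ^ (T - K)) := by ring
        _ ≤ Ω * Ω ^ 5 * (1 / Ω ^ 40) := by
          apply mul_le_mul (mul_le_mul_of_nonneg_right hNX (by positivity)) h2 (by positivity) (by positivity)
        _ = 1 / Ω ^ 34 := by field_simp
        _ ≤ _ := one_div_le_one_div_of_le (by positivity) (pow_le_pow_right₀ (by linarith) (by norm_num))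
  -- values vanish
  have hvan : ∀ s r : ℕ, s < 20000 * L → r < 10000 * L →
      ∑ k : Fin K, ∑ l : Fin L, (p k l : ℝ) * ((s * b + r * a : ℕ) : ℝ) ^ (k : ℕ) * (α ^ s * β ^ r) ^ (l : ℕ) = 0 := by
    intro s r hs hr
    set X : ℕ := s * b + r * a with hX
    have hXle : X ≤ Xm := by
      have h1 : s * b ≤ (20000 * L) * A := Nat.mul_le_mul hs.le (le_max_right _ _)
      have h2 : r * a ≤ (10000 * L) * A := Nat.mul_le_mul hr.le (le_max_left _ _)
      calc X ≤ (20000 * L) * A + (10000 * L) * A := by omega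
        _ = Xm := by rw [hXm]; ring
    rcases hLi H K L X Xm s r p hpH hXle hXm1 with h | h
    · exact h
    exfalso
    set V := ∑ k : Fin K, ∑ l : Fin L, (p k l : ℝ) * (X : ℝ) ^ (k : ℕ) * (α ^ s * β ^ r) ^ (l : ℕ) with hV
    have hXmr : (0 : ℝ) < Xm := by exact_mod_cast hXm1
    have hXr : (X : ℝ) ≤ Xm := by exact_mod_cast hXle
    have hb1 := hbound (X / Xm) (by positivity) (by rw [div_le_one hXmr]; exact hXr)
    have hW : ∑ k : Fin K, ∑ l : Fin L, (p k l : ℝ) * (Xm * ((X : ℝ) / Xm)) ^ (k : ℕ) * Real.exp (l * (Z * (X / Xm)))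
        = ∑ k : Fin K, ∑ l : Fin L, (p k l : ℝ) * (X : ℝ) ^ (k : ℕ) * Real.exp (l * (g * X)) := by
      have h1 : Xm * ((X : ℝ) / Xm) = X := by field_simp
      have h2 : Z * ((X : ℝ) / Xm) = g * X := by rw [hZ]; field_simp
      rw [h1, h2]
    rw [hW] at hb1
    set W := ∑ k : Fin K, ∑ l : Fin L, (p k l : ℝ) * (X : ℝ) ^ (k : ℕ) * Real.exp (l * (g * X)) with hWdef
    have hLR : 2 * ((L : ℝ) * (10000 * L)) ≤ Ω := by
      refine le_trans ?_ hKL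
      rw [hK]; push_cast
      have : 0 ≤ (L : ℝ) * L := by positivity
      nlinarith
    have hLRε : (L : ℝ) * (10000 * L) * ε ≤ 1 := by
      have h1 : (L : ℝ) * (10000 * L) ≤ Ω ^ 21 := by
        calc (L : ℝ) * (10000 * L) ≤ Ω := by
              have : 0 ≤ (L : ℝ) * (10000 * L) := by positivity
              linarith
          _ = Ω ^ 1 := (pow_one _).symm
          _ ≤ _ := pow_le_pow_right₀ (by linarith) (by norm_num)
      rw [hε, mul_one_div, div_le_one (by positivity)]
      exact h1
    have hVW : |V - W| ≤ 1 / Ω ^ 13 := by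
      have h1 : V - W = ∑ k : Fin K, ∑ l : Fin L, (p k l : ℝ) * (X : ℝ) ^ (k : ℕ) *
          ((α ^ s * β ^ r) ^ (l : ℕ) - Real.exp (l * (g * X))) := by
        rw [hV, hWdef, ← Finset.sum_sub_distrib]
        apply Finset.sum_congr rfl; intro k _
        rw [← Finset.sum_sub_distrib]
        apply Finset.sum_congr rfl; intro l _
        ring
      have h2 : ∀ l : Fin L, |(α ^ s * β ^ r) ^ (l : ℕ) - Real.exp (l * (g * X))| ≤
          Real.exp (L * Z) * (2 * (L * (10000 * L)) * ε) := by
        intro l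
        have h3 : (α ^ s * β ^ r) ^ (l : ℕ) = Real.exp (l * (g * X)) * Real.exp (l * (r * e)) := by
          rw [← Real.exp_add]
          have hα' : α = Real.exp (Real.log α) := (Real.exp_log (by linarith)).symm
          have hβ' : β = Real.exp (Real.log β) := (Real.exp_log (by linarith)).symm
          conv_lhs => rw [hα', hβ']
          rw [← Real.exp_nat_mul, ← Real.exp_nat_mul, ← Real.exp_add, ← Real.exp_nat_mul]
          congr 1
          rw [hX, he]; push_cast
          have : Real.log α = g * b := by rw [hg]; field_simp
          rw [this]; ring
        rw [h3, ← mul_sub_one, abs_mul, abs_of_pos (Real.exp_pos _)]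
        have hlL : (l : ℝ) ≤ L := by exact_mod_cast l.2.le
        have h4 : |(l : ℝ) * (r * e)| ≤ L * (10000 * L) * ε := by
          rw [abs_mul, abs_mul, abs_of_nonneg (by positivity : (0 : ℝ) ≤ (l : ℝ)), abs_of_nonneg (by positivity : (0 : ℝ) ≤ (r : ℝ)), mul_assoc]
          have hr' : (r : ℝ) ≤ 10000 * L := by exact_mod_cast hr.le
          gcongr
        apply mul_le_mul _ _ (abs_nonneg _) (Real.exp_pos _).le
        · apply Real.exp_le_exp.mpr
          have h5 : g * X ≤ Z := by rw [hZ]; exact mul_le_mul_of_nonneg_left hXr hgpos.le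
          exact mul_le_mul hlL h5 (by positivity) (by positivity)
        · refine (Real.abs_exp_sub_one_le (h4.trans hLRε)).trans ?_
          linarith
      rw [h1]
      refine (Finset.abs_sum_le_sum_abs _ _).trans ?_
      calc _ ≤ ∑ k : Fin K, (L * (H * Xm ^ K * (Real.exp (L * Z) * (2 * (L * (10000 * L)) * ε)))) := by
            apply Finset.sum_le_sum
            intro k _
            refine (Finset.abs_sum_le_sum_abs _ _).trans ?_
            calc _ ≤ ∑ l : Fin L, ((H : ℝ) * Xm ^ K * (Real.exp (L * Z) * (2 * (L * (10000 * L)) * ε))) := by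
                  apply Finset.sum_le_sum
                  intro l _
                  rw [abs_mul, abs_mul]
                  apply mul_le_mul (mul_le_mul _ _ (abs_nonneg _) (by positivity)) (h2 l) (abs_nonneg _) (by positivity)
                  · exact_mod_cast hpH k l
                  · rw [abs_of_nonneg (by positivity)]
                    calc (X : ℝ) ^ (k : ℕ) ≤ (Xm : ℝ) ^ (k : ℕ) := pow_le_pow_left₀ (by positivity) hXr _
                      _ ≤ _ := pow_le_pow_right₀ (by exact_mod_cast hXm1) k.2.le
              _ = _ := by simp
        _ = (K * L * (Xm ^ K * Real.exp (L * Z))) * H * (2 * (L * (10000 * L))) * ε := by simp; ring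
        _ ≤ Ω * Ω ^ 5 * Ω * ε := by
          rw [hHr]
          have h9 : (0 : ℝ) ≤ 2 * (L * (10000 * L)) := by positivity
          gcongr
        _ = 1 / Ω ^ 14 := by rw [hε]; field_simp
        _ ≤ _ := one_div_le_one_div_of_le (by positivity) (pow_le_pow_right₀ (by linarith) (by norm_num))
    have hV3 : |V| ≤ 3 / Ω ^ 13 := by
      have h1 : V = (V - W) + W := by ring
      rw [h1]
      refine (abs_add_le _ _).trans ?_
      calc _ ≤ 1 / Ω ^ 13 + (1 / Ω ^ 13 + 1 / Ω ^ 13) := add_le_add hVW hb1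
        _ = _ := by ring
    have hfac : (K : ℝ) * L * H * Xm ^ K * 2 ^ (13 * L * (s + r)) ≤ Ω ^ 6 := by
      have h1 : (2 : ℝ) ^ (13 * L * (s + r)) ≤ 2 ^ (450000 * L ^ 2) := by
        apply pow_le_pow_right₀ (by norm_num)
        have : s + r ≤ 30000 * L := by omega
        calc 13 * L * (s + r) ≤ 13 * L * (30000 * L) := Nat.mul_le_mul_left _ this
          _ = 390000 * L ^ 2 := by ring
          _ ≤ _ := by omega
      calc (K : ℝ) * L * H * Xm ^ K * 2 ^ (13 * L * (s + r))
          = (K * L * Xm ^ K * 2 ^ (13 * L * (s + r))) * H := by ring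
        _ ≤ (K * L * Xm ^ K * 2 ^ (450000 * L ^ 2)) * H := by gcongr
        _ ≤ Ω * Ω ^ 5 := by rw [hHr]; gcongr
        _ = _ := by ring
    have hfin : (1 : ℝ) ≤ 3 / Ω ^ 13 * (Ω ^ 6) ^ 2 := by
      refine h.trans ?_
      gcongr
    have : 3 / Ω ^ 13 * (Ω ^ 6) ^ 2 = 3 / Ω := by field_simp
    rw [this, le_div_iff₀ hΩpos] at hfin
    linarith
  -- zero estimate
  let f : ℕ × ℕ → ℤ := fun q => ((q.1 * b + q.2 * a : ℕ) : ℤ)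
  let G : Finset (ℕ × ℕ) := Finset.range (10000 * L) ×ˢ Finset.range (10000 * L)
  have hinj : Set.InjOn f G := by
    intro q hq q' hq' h
    simp only [G, Finset.coe_product, Set.mem_prod, Finset.mem_coe, Finset.mem_range] at hq hq'
    have h' : q.1 * b + q.2 * a = q'.1 * b + q'.2 * a := by
      simp only [f] at h
      exact Int.ofNat.inj h
    obtain ⟨h1, h2⟩ := tl_inj a b (10000 * L) _ _ _ _ hc hA1 hq.1 hq'.1 hq.2 hq'.2 h' ha hb
    exact Prod.ext h1 h2
  let inv : ℤ → ℕ × ℕ := Function.invFunOn f G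
  have hinv : ∀ X ∈ G.image f, inv X ∈ G ∧ f (inv X) = X := by
    intro X hX
    have : X ∈ f '' G := by
      simpa using hX
    exact ⟨Function.invFunOn_mem this, Function.invFunOn_eq this⟩
  apply tl_zero_est K L p hp0 α hα b (G.image f) ?_ (fun X => α ^ (inv X).1 * β ^ (inv X).2)
  · intro X hX j hj
    obtain ⟨h1, h2⟩ := hinv X hX
    simp only [G, Finset.mem_product, Finset.mem_range] at h1
    have h3 := hvan ((inv X).1 + j) (inv X).2 (by omega) h1.2
    rw [← h3]
    apply Finset.sum_congr rfl; intro k _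
    apply Finset.sum_congr rfl; intro l _
    have h4 : (X : ℝ) + j * (b : ℤ) = ((((inv X).1 + j) * b + (inv X).2 * a : ℕ) : ℝ) := by
      conv_lhs => rw [← h2]
      simp only [f]
      push_cast; ring
    rw [h4, pow_add α]
    ring
  · intro X _
    have : 0 < α := by linarith
    have : 0 < β := by linarith
    positivity
  · rw [Finset.card_image_of_injOn hinj]
    simp only [G, Finset.card_product, Finset.card_range]
    rw [hK]; apply le_of_eq; ring
end

section
open Polynomial in
theorem rt_irred (m : ℤ) (hm : -1 ≤ m) :
    Irreducible (X ^ 3 - C (m : ℚ) * X ^ 2 - C ((m : ℚ) + 3) * X - 1 : ℚ[X]) := by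
  set P : ℤ[X] := X ^ 3 - C m * X ^ 2 - C (m + 3) * X - 1 with hP
  have hmon : P.Monic := by
    rw [hP]; monicity!
  have hdeg : P.natDegree = 3 := by
    rw [hP]; compute_degree!
  have hirr : Irreducible P := by
    rw [hmon.irreducible_iff_roots_eq_zero_of_degree_le_three (by omega) (by omega)]
    rw [Multiset.eq_zero_iff_forall_notMem]
    intro r hr
    have h0 : P.eval r = 0 := (Polynomial.mem_roots'.mp hr).2
    simp [hP] at h0
    have hd : r * (r ^ 2 - m * r - (m + 3)) = 1 := by linarith
    rcases Int.isUnit_iff.mp (IsUnit.of_mul_eq_one _ hd) with h | h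
    · subst h; omega
    · subst h; omega
  have := (hmon.irreducible_iff_irreducible_map_fraction_map (K := ℚ)).mp hirr
  convert this using 1
  simp [hP]
  rfl

structure RTup (m : ℤ) (ρ : Fin 3 → ℝ) : Prop where
  root : ∀ i, ρ i ^ 3 - m * ρ i ^ 2 - (m + 3) * ρ i - 1 = 0
  next : ∀ i, ρ (i + 1) = ρ i ^ 2 - (m + 1) * ρ i - 2
  sum : ρ 0 + ρ 1 + ρ 2 = m

theorem RTup.conj {m : ℤ} {ρ : Fin 3 → ℝ} (h : RTup m ρ) (hm : -1 ≤ m) (f : Polynomial ℚ) (i : Fin 3)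
    (hf : Polynomial.aeval (ρ i) f = 0) (j : Fin 3) : Polynomial.aeval (ρ j) f = 0 := by
  have hd : ∀ k, minpoly ℚ (ρ k) = (Polynomial.X ^ 3 - Polynomial.C (m : ℚ) * Polynomial.X ^ 2 -
      Polynomial.C ((m : ℚ) + 3) * Polynomial.X - 1) := by
    intro k
    symm
    apply minpoly.eq_of_irreducible_of_monic (rt_irred m hm)
    · have := h.root k
      simpa using this
    · monicity!
  have h1 := minpoly.dvd ℚ (ρ i) hf
  rw [hd i, ← hd j] at h1
  exact (Polynomial.aeval_eq_zero_of_dvd_aeval_eq_zero h1 (minpoly.aeval _ _))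

noncomputable def goodRing (ρ : Fin 3 → ℝ) : Subring (Fin 3 → ℝ) :=
  (integralClosure ℤ (Fin 3 → ℝ)).toSubring ⊓
    (Polynomial.aeval ρ : Polynomial ℚ →ₐ[ℚ] (Fin 3 → ℝ)).range.toSubring

theorem mem_goodRing {ρ z : Fin 3 → ℝ} : z ∈ goodRing ρ ↔
    IsIntegral ℤ z ∧ ∃ g : Polynomial ℚ, Polynomial.aeval ρ g = z := by
  rfl

theorem aeval_pi_apply (ρ : Fin 3 → ℝ) (g : Polynomial ℚ) (i : Fin 3) :
    Polynomial.aeval ρ g i = Polynomial.aeval (ρ i) g := by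
  have := Polynomial.aeval_algHom_apply (Pi.evalAlgHom ℚ (fun _ : Fin 3 => ℝ) i) ρ g
  simpa using this.symm

theorem RTup.trace_rat {m : ℤ} {ρ : Fin 3 → ℝ} (h : RTup m ρ) (g : Polynomial ℚ) :
    ∃ q : ℚ, (q : ℝ) = ∑ i, Polynomial.aeval ρ g i := by
  have hs : ∀ n : ℕ, (∃ q : ℚ, (q : ℝ) = ρ 0 ^ n + ρ 1 ^ n + ρ 2 ^ n) ∧
      (∃ q : ℚ, (q : ℝ) = ρ 0 ^ (n+1) + ρ 1 ^ (n+1) + ρ 2 ^ (n+1)) ∧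
      (∃ q : ℚ, (q : ℝ) = ρ 0 ^ (n+2) + ρ 1 ^ (n+2) + ρ 2 ^ (n+2)) := by
    intro n
    induction n with
    | zero =>
      refine ⟨⟨3, by norm_num⟩, ⟨m, by simp [h.sum]⟩, ⟨m ^ 2 + 2 * m + 6, ?_⟩⟩
      have h0 := h.next 0
      have h1 := h.next 1
      have h2 := h.next 2
      have hs := h.sum
      simp at h0 h1 h2
      push_cast
      linear_combination (1 : ℝ) * h0 + h1 + h2 - (m + 2) * hs
    | succ n ih =>
      obtain ⟨⟨a, ha⟩, ⟨b, hb⟩, ⟨c, hc⟩⟩ := ih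
      refine ⟨⟨b, hb⟩, ⟨c, hc⟩, ⟨m * c + (m + 3) * b + a, ?_⟩⟩
      push_cast
      rw [ha, hb, hc]
      have h0 := h.root 0
      have h1 := h.root 1
      have h2 := h.root 2
      linear_combination - ρ 0 ^ n * h0 - ρ 1 ^ n * h1 - ρ 2 ^ n * h2
  simp only [aeval_pi_apply, Fin.sum_univ_three]
  induction g using Polynomial.induction_on' with
  | add p q hp hq =>
    obtain ⟨a, ha⟩ := hp
    obtain ⟨b, hb⟩ := hq
    refine ⟨a + b, ?_⟩
    simp only [map_add]; push_cast; rw [ha, hb]; ring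
  | monomial n a =>
    obtain ⟨b, hb⟩ := (hs n).1
    refine ⟨a * b, ?_⟩
    push_cast
    simp only [Polynomial.aeval_monomial, hb]
    simp
    ring

theorem int_of_rat_integral (x : ℝ) (hx : IsIntegral ℤ x) (q : ℚ) (hq : (q : ℝ) = x) : ∃ n : ℤ, (n : ℝ) = x := by
  have : IsIntegral ℤ q := by
    rw [← hq] at hx
    exact (isIntegral_algebraMap_iff (algebraMap ℚ ℝ).injective).mp hx
  obtain ⟨n, hn⟩ := IsIntegrallyClosed.isIntegral_iff.mp this
  refine ⟨n, ?_⟩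
  rw [← hq, ← hn]; simp

theorem int_comp {z : Fin 3 → ℝ} (hz : IsIntegral ℤ z) (i : Fin 3) : IsIntegral ℤ (z i) :=
  hz.map (Pi.evalRingHom (fun _ : Fin 3 => ℝ) i).toIntAlgHom

theorem RTup.trace_int {m : ℤ} {ρ : Fin 3 → ℝ} (h : RTup m ρ) {z : Fin 3 → ℝ} (hz : z ∈ goodRing ρ) :
    ∃ n : ℤ, (n : ℝ) = z 0 + z 1 + z 2 := by
  obtain ⟨h1, g, hg⟩ := mem_goodRing.mp hz
  obtain ⟨q, hq⟩ := h.trace_rat g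
  rw [hg, Fin.sum_univ_three] at hq
  exact int_of_rat_integral _ (((int_comp h1 0).add (int_comp h1 1)).add (int_comp h1 2)) q hq

theorem RTup.mem_self {m : ℤ} {ρ : Fin 3 → ℝ} (h : RTup m ρ) : ρ ∈ goodRing ρ := by
  rw [mem_goodRing]
  refine ⟨⟨Polynomial.X ^ 3 - Polynomial.C m * Polynomial.X ^ 2 - Polynomial.C (m + 3) * Polynomial.X - 1,
    by monicity!, ?_⟩, Polynomial.X, by simp⟩
  funext i
  have := h.root i
  simp only [Polynomial.eval₂_sub, Polynomial.eval₂_mul, Polynomial.eval₂_pow, Polynomial.eval₂_X,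
    Polynomial.eval₂_C, Polynomial.eval₂_one]
  simpa using this

theorem RTup.mem_shift {m : ℤ} {ρ : Fin 3 → ℝ} (h : RTup m ρ) {z : Fin 3 → ℝ} (hz : z ∈ goodRing ρ) :
    (fun i => z (i + 1)) ∈ goodRing ρ := by
  obtain ⟨h1, g, hg⟩ := mem_goodRing.mp hz
  rw [mem_goodRing]
  constructor
  · let φ : (Fin 3 → ℝ) →+* (Fin 3 → ℝ) := RingHom.pi (fun i => Pi.evalRingHom (fun _ : Fin 3 => ℝ) (i+1))
    exact h1.map φ.toIntAlgHom
  · refine ⟨g.comp (Polynomial.X ^ 2 - Polynomial.C ((m : ℚ) + 1) * Polynomial.X - Polynomial.C 2), ?_⟩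
    funext i
    rw [aeval_pi_apply, Polynomial.aeval_comp, ← hg, aeval_pi_apply, h.next i]
    congr 1
    simp

theorem RTup.norm_int {m : ℤ} {ρ : Fin 3 → ℝ} (h : RTup m ρ) {z : Fin 3 → ℝ} (hz : z ∈ goodRing ρ) :
    ∃ n : ℤ, (n : ℝ) = z 0 * z 1 * z 2 := by
  have h1 := h.mem_shift hz
  have h2 := h.mem_shift h1
  have h3 := (goodRing ρ).mul_mem ((goodRing ρ).mul_mem hz h1) h2
  obtain ⟨n, hn⟩ := h.trace_int h3
  simp at hn
  have h4 := int_comp (mem_goodRing.mp h3).1 0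
  simp at h4
  refine int_of_rat_integral _ h4 (n / 3) ?_
  push_cast
  rw [hn]; ring

theorem RTup.zero_of_zero {m : ℤ} {ρ : Fin 3 → ℝ} (h : RTup m ρ) (hm : -1 ≤ m) {z : Fin 3 → ℝ}
    (hz : z ∈ goodRing ρ) (i : Fin 3) (hi : z i = 0) (j : Fin 3) : z j = 0 := by
  obtain ⟨h1, g, hg⟩ := mem_goodRing.mp hz
  rw [← hg, aeval_pi_apply] at hi ⊢
  exact h.conj hm g i hi j

/-- Norm bound : a good element has a coordinate 2 that is zero or not too small. -/
theorem RTup.liouville {m : ℤ} {ρ : Fin 3 → ℝ} (h : RTup m ρ) (hm : -1 ≤ m) {z : Fin 3 → ℝ}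
    (hz : z ∈ goodRing ρ) (B : ℝ) (hB : ∀ i, |z i| ≤ B) : z 2 = 0 ∨ 1 ≤ |z 2| * B ^ 2 := by
  obtain ⟨n, hn⟩ := h.norm_int hz
  by_cases h0 : n = 0
  · left
    rw [h0] at hn
    have : z 0 * z 1 * z 2 = 0 := by rw [← hn]; simp
    rcases mul_eq_zero.mp this with h' | h'
    · rcases mul_eq_zero.mp h' with h'' | h''
      · exact h.zero_of_zero hm hz _ h'' _
      · exact h.zero_of_zero hm hz _ h'' _
    · exact h'
  · right
    have h1 : (1 : ℝ) ≤ |(n : ℝ)| := by exact_mod_cast Int.one_le_abs h0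
    rw [hn, abs_mul, abs_mul] at h1
    have h2 : |z 0| * |z 1| ≤ B * B := mul_le_mul (hB 0) (hB 1) (abs_nonneg _) ((abs_nonneg _).trans (hB 0))
    nlinarith [abs_nonneg (z 2)]

theorem RTup.hLi {m : ℤ} {ρ : Fin 3 → ℝ} (h : RTup m ρ) (hm : -1 ≤ m) (hb : ∀ i, |ρ i| ≤ 2 ^ 13)
    (H K L X Y s r : ℕ) (p : Fin K → Fin L → ℤ) (hp : ∀ k l, |p k l| ≤ (H : ℤ)) (hXY : X ≤ Y) (hY : 1 ≤ Y) :
      (∑ k : Fin K, ∑ l : Fin L, (p k l : ℝ) * (X : ℝ) ^ (k : ℕ) * ((-ρ 2) ^ s * (ρ 0) ^ r) ^ (l : ℕ) = 0 ∨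
      1 ≤ |∑ k : Fin K, ∑ l : Fin L, (p k l : ℝ) * (X : ℝ) ^ (k : ℕ) * ((-ρ 2) ^ s * (ρ 0) ^ r) ^ (l : ℕ)| *
        ((K : ℝ) * L * H * Y ^ K * 2 ^ (13 * L * (s + r))) ^ 2) := by
  set z : Fin 3 → ℝ := ∑ k : Fin K, ∑ l : Fin L, ((p k l : ℤ) : Fin 3 → ℝ) * ((X : ℕ) : Fin 3 → ℝ) ^ (k : ℕ) *
    ((-ρ) ^ s * (fun i => ρ (i + 1)) ^ r) ^ (l : ℕ) with hz
  have hzm : z ∈ goodRing ρ := by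
    rw [hz]
    refine Subring.sum_mem _ fun k _ => Subring.sum_mem _ fun l _ => ?_
    refine Subring.mul_mem _ (Subring.mul_mem _ (intCast_mem _ _) (Subring.pow_mem _ (natCast_mem _ _) _)) ?_
    exact Subring.pow_mem _ (Subring.mul_mem _ (Subring.pow_mem _ (Subring.neg_mem _ h.mem_self) _)
      (Subring.pow_mem _ (h.mem_shift h.mem_self) _)) _
  have hzi : ∀ i, z i = ∑ k : Fin K, ∑ l : Fin L, (p k l : ℝ) * (X : ℝ) ^ (k : ℕ) *
      ((-ρ i) ^ s * (ρ (i + 1)) ^ r) ^ (l : ℕ) := by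
    intro i
    rw [hz]
    simp [Finset.sum_apply]
  have h2 := hzi 2
  have e : (2 : Fin 3) + 1 = 0 := rfl
  rw [e] at h2
  rw [← h2]
  apply h.liouville hm hzm
  intro i
  rw [hzi i]
  have hY' : (1 : ℝ) ≤ Y := by exact_mod_cast hY
  have hX' : (X : ℝ) ≤ Y := by exact_mod_cast hXY
  have hterm : ∀ k : Fin K, ∀ l : Fin L, |(p k l : ℝ) * (X : ℝ) ^ (k : ℕ) * ((-ρ i) ^ s * (ρ (i + 1)) ^ r) ^ (l : ℕ)|
      ≤ H * Y ^ K * 2 ^ (13 * L * (s + r)) := by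
    intro k l
    rw [abs_mul, abs_mul]
    have h1 : |(p k l : ℝ)| ≤ H := by exact_mod_cast hp k l
    have h3 : |(X : ℝ) ^ (k : ℕ)| ≤ Y ^ K := by
      rw [abs_of_nonneg (by positivity)]
      calc (X : ℝ) ^ (k : ℕ) ≤ Y ^ (k : ℕ) := pow_le_pow_left₀ (by positivity) hX' _
        _ ≤ _ := pow_le_pow_right₀ hY' k.2.le
    have h4 : |((-ρ i) ^ s * (ρ (i + 1)) ^ r) ^ (l : ℕ)| ≤ 2 ^ (13 * L * (s + r)) := by
      rw [abs_pow, abs_mul, abs_pow, abs_pow, abs_neg]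
      calc (|ρ i| ^ s * |ρ (i + 1)| ^ r) ^ (l : ℕ) ≤ ((2 ^ 13) ^ s * (2 ^ 13) ^ r) ^ (l : ℕ) := by
            have := hb i
            have := hb (i + 1)
            gcongr
        _ = 2 ^ (13 * l * (s + r)) := by
            rw [← pow_add, ← pow_mul, ← pow_mul]; congr 1; ring
        _ ≤ _ := by
            apply pow_le_pow_right₀ (by norm_num)
            have := l.2.le
            gcongr
    exact mul_le_mul (mul_le_mul h1 h3 (abs_nonneg _) (by positivity)) h4 (abs_nonneg _) (by positivity)
  calc _ ≤ ∑ k : Fin K, ∑ l : Fin L, (H : ℝ) * Y ^ K * 2 ^ (13 * L * (s + r)) := by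
        refine (Finset.abs_sum_le_sum_abs _ _).trans (Finset.sum_le_sum fun k _ => ?_)
        exact (Finset.abs_sum_le_sum_abs _ _).trans (Finset.sum_le_sum fun l _ => hterm k l)
    _ = _ := by simp; ring
end

section
theorem exists_roots (m : ℤ) (hm : -1 ≤ m) : ∃ ρ : Fin 3 → ℝ, RTup m ρ ∧ (m : ℝ) + 1 < ρ 0 ∧ 123 / 100 < ρ 0 ∧
    ρ 0 < m + 3 ∧ ρ 1 = -1 / (1 + ρ 0) ∧ ρ 2 = -1 - 1 / ρ 0 := by
  have hm' : (-1 : ℝ) ≤ m := by exact_mod_cast hm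
  obtain ⟨L, hL1, hL2, hL3⟩ : ∃ L : ℝ, (m : ℝ) + 1 ≤ L ∧ 123 / 100 ≤ L ∧ L ^ 3 - m * L ^ 2 - (m + 3) * L - 1 < 0 ∧ L ≤ m + 3 := by
    rcases eq_or_lt_of_le hm with h | h
    · refine ⟨123 / 100, ?_⟩
      subst h; norm_num
    · rcases eq_or_lt_of_le (show 0 ≤ m by omega) with h | h
      · refine ⟨123 / 100, ?_⟩
        subst h; norm_num
      · have : (1 : ℝ) ≤ m := by exact_mod_cast h
        exact ⟨m + 1, le_rfl, by linarith, by nlinarith, by linarith⟩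
  have hcont : ContinuousOn (fun t : ℝ => t ^ 3 - m * t ^ 2 - (m + 3) * t - 1) (Set.Icc L (m + 3)) := by fun_prop
  have hmem := intermediate_value_Icc (f := fun t : ℝ => t ^ 3 - m * t ^ 2 - (m + 3) * t - 1) hL3.2 hcont
  obtain ⟨r, ⟨hr1, hr2⟩, hr0⟩ := hmem (show (0 : ℝ) ∈ _ from ⟨hL3.1.le, by nlinarith [sq_nonneg ((m : ℝ) + 3)]⟩)
  simp only at hr0
  have hrL : L < r := by
    rcases eq_or_lt_of_le hr1 with h | h
    · rw [← h] at hr0; linarith [hL3.1]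
    · exact h
  have hrU : r < m + 3 := by
    rcases eq_or_lt_of_le hr2 with h | h
    · rw [h] at hr0; nlinarith [sq_nonneg ((m : ℝ) + 3)]
    · exact h
  have hpos : 0 < r := by linarith
  refine ⟨![r, -1 / (1 + r), -1 - 1 / r], ⟨?_, ?_, ?_⟩, ?_⟩
  · have hmr : (m : ℝ) * (r ^ 2 + r) = r ^ 3 - 3 * r - 1 := by linarith
    have hmv : (m : ℝ) = (r ^ 3 - 3 * r - 1) / (r ^ 2 + r) := by field_simp; linarith
    intro i
    fin_cases i
    · simpa using hr0
    · simp; rw [hmv]; field_simp; ring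
    · simp; rw [hmv]; field_simp; ring
  · have hmv : (m : ℝ) = (r ^ 3 - 3 * r - 1) / (r ^ 2 + r) := by field_simp; linarith
    intro i
    fin_cases i
    · simp; rw [hmv]; field_simp; ring
    · simp; rw [hmv]; field_simp; ring
    · simp; rw [hmv]; field_simp; ring
  · have hmv : (m : ℝ) = (r ^ 3 - 3 * r - 1) / (r ^ 2 + r) := by field_simp; linarith
    simp; rw [hmv]; field_simp; ring
  · simp
    refine ⟨by linarith, by linarith, by linarith⟩

theorem pigeon2 (s t : ℝ) (N : ℕ) (hN : 1 ≤ N) : ∃ k : ℕ, 1 ≤ k ∧ k ≤ N ^ 2 ∧ ∃ a b : ℤ,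
    |k * s - a| ≤ 1 / N ∧ |k * t - b| ≤ 1 / N := by
  have hN' : (0 : ℝ) < N := by exact_mod_cast hN
  let f : ℕ → ℕ × ℕ := fun k => (⌊Int.fract (k * s) * N⌋₊, ⌊Int.fract (k * t) * N⌋₊)
  have key : ∀ x : ℝ, ⌊Int.fract x * N⌋₊ < N := by
    intro x
    rw [Nat.floor_lt (mul_nonneg (Int.fract_nonneg _) hN'.le)]
    nlinarith [Int.fract_lt_one x]
  have hmaps : ∀ k ∈ Finset.range (N ^ 2 + 1), f k ∈ Finset.range N ×ˢ Finset.range N := by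
    intro k _
    simp only [f, Finset.mem_product, Finset.mem_range]
    exact ⟨key _, key _⟩
  obtain ⟨i, hi, j, hj, hij, hf⟩ := Finset.exists_ne_map_eq_of_card_lt_of_maps_to (by simp [sq]) hmaps
  have main : ∀ i j : ℕ, i < j → j ≤ N ^ 2 → f i = f j → ∃ k : ℕ, 1 ≤ k ∧ k ≤ N ^ 2 ∧ ∃ a b : ℤ,
    |k * s - a| ≤ 1 / N ∧ |k * t - b| ≤ 1 / N := by
    intro i j hij hj hf
    have hfl : ∀ x y : ℝ, ⌊Int.fract x * N⌋₊ = ⌊Int.fract y * N⌋₊ → |Int.fract y - Int.fract x| ≤ 1 / N := by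
      intro x y h
      have hx := Nat.floor_le (mul_nonneg (Int.fract_nonneg x) hN'.le)
      have hx' := Nat.lt_floor_add_one (Int.fract x * N)
      have hy := Nat.floor_le (mul_nonneg (Int.fract_nonneg y) hN'.le)
      have hy' := Nat.lt_floor_add_one (Int.fract y * N)
      rw [h] at hx hx'
      rw [abs_le, le_div_iff₀ hN', neg_le, ← neg_le, ← neg_div, div_le_iff₀ hN']
      constructor <;> nlinarith
    refine ⟨j - i, by omega, by omega, ⌊j * s⌋ - ⌊i * s⌋, ⌊j * t⌋ - ⌊i * t⌋, ?_, ?_⟩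
    · have := hfl _ _ (congrArg Prod.fst hf)
      convert this using 2
      rw [Nat.cast_sub hij.le]; push_cast [Int.fract]; ring
    · have := hfl _ _ (congrArg Prod.snd hf)
      convert this using 2
      rw [Nat.cast_sub hij.le]; push_cast [Int.fract]; ring
  simp only [Finset.mem_range] at hi hj
  rcases lt_or_gt_of_ne hij with h | h
  · exact main i j h (by omega) hf
  · exact main j i h (by omega) hf.symm

theorem RTup.mem_inv {m : ℤ} {ρ : Fin 3 → ℝ} (h : RTup m ρ) (z : Fin 3 → ℝ) (hz : z ∈ goodRing ρ)
    (h1 : z 0 * z 1 * z 2 = 1) : z⁻¹ ∈ goodRing ρ := by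
  have h2 := Subring.mul_mem _ (h.mem_shift hz) (h.mem_shift (h.mem_shift hz))
  have hz0 : z 0 ≠ 0 := by rintro h; rw [h] at h1; simp at h1
  have hz1 : z 1 ≠ 0 := by rintro h; rw [h] at h1; simp at h1
  have hz2 : z 2 ≠ 0 := by rintro h; rw [h] at h1; simp at h1
  convert h2 using 1
  funext i
  fin_cases i
  · simp; field_simp; linarith
  · simp; field_simp; linarith
  · simp; field_simp; linarith

theorem goodRing_zpow {ρ z : Fin 3 → ℝ} (h1 : z ∈ goodRing ρ) (h2 : z⁻¹ ∈ goodRing ρ) (a : ℤ) :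
    z ^ a ∈ goodRing ρ := by
  rcases a with n | n
  · simpa using Subring.pow_mem _ h1 n
  · rw [zpow_negSucc, ← inv_pow]
    exact Subring.pow_mem _ h2 _

theorem amgm_eq (a b c : ℝ) (ha : 0 < a) (hb : 0 < b) (hc : 0 < c) (hs : a + b + c < 4)
    (hl : Real.log a + Real.log b + Real.log c = 0) (n : ℤ) (hn : (n : ℝ) = a + b + c) :
    a = 1 ∧ b = 1 ∧ c = 1 := by
  have h1 := Real.log_le_sub_one_of_pos ha
  have h2 := Real.log_le_sub_one_of_pos hb
  have h3 := Real.log_le_sub_one_of_pos hc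
  have hn3 : (3 : ℝ) ≤ n := by linarith
  have hn4 : (n : ℝ) < 4 := by linarith
  have hn3' : 3 ≤ n := by exact_mod_cast hn3
  have hn4' : n < 4 := by exact_mod_cast hn4
  have : n = 3 := by omega
  rw [this] at hn; push_cast at hn
  refine ⟨?_, ?_, ?_⟩
  · by_contra h
    have := Real.log_lt_sub_one_of_pos ha h
    linarith
  · by_contra h
    have := Real.log_lt_sub_one_of_pos hb h
    linarith
  · by_contra h
    have := Real.log_lt_sub_one_of_pos hc h
    linarith

/-- unit lemma -/
theorem RTup.unit_rel {m : ℤ} {ρ : Fin 3 → ℝ} (h : RTup m ρ) (hlo : 123 / 100 < ρ 0) (hhi : ρ 0 < 5003)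
    (h1 : ρ 1 = -1 / (1 + ρ 0)) (h2 : ρ 2 = -1 - 1 / ρ 0)
    (u : Fin 3 → ℝ) (hu : u ∈ goodRing ρ) (hu1 : u 0 * u 1 * u 2 = 1) :
    ∃ k : ℕ, 1 ≤ k ∧ k ≤ 40000 ∧ ∃ a b : ℤ,
      k * Real.log |u 1| = a * Real.log |ρ 1| + b * Real.log |ρ 2| ∧
      k * Real.log |u 2| = a * Real.log |ρ 2| + b * Real.log |ρ 0| := by
  have hprod : ρ 0 * ρ 1 * ρ 2 = 1 := by rw [h1, h2]; field_simp; ring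
  have hl1 : Real.log |ρ 1| = - Real.log (1 + ρ 0) := by
    rw [h1, abs_div, abs_neg, abs_one, abs_of_pos (by linarith), one_div, Real.log_inv]
  have hl2 : Real.log |ρ 2| = Real.log (1 + ρ 0) - Real.log (ρ 0) := by
    have : ρ 2 = -((1 + ρ 0) / ρ 0) := by rw [h2]; field_simp; ring
    rw [this, abs_neg, abs_of_pos (by positivity), Real.log_div (by linarith) (by linarith)]
  have hl0 : Real.log |ρ 0| = Real.log (ρ 0) := by rw [abs_of_pos (by linarith)]
  have h0pos : 0 < Real.log (ρ 0) := Real.log_pos (by linarith)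
  have h2pos : Real.log (ρ 0) < Real.log (1 + ρ 0) := Real.log_lt_log (by linarith) (by linarith)
  have hmax : Real.log (1 + ρ 0) ≤ 9 := by
    rw [Real.log_le_iff_le_exp (by linarith)]
    have h3 : Real.exp 9 = Real.exp 1 ^ 9 := by rw [← Real.exp_nat_mul]; norm_num
    have h4 := Real.exp_one_gt_d9
    rw [h3]
    calc 1 + ρ 0 ≤ 2.7 ^ 9 := by norm_num; linarith
      _ ≤ _ := pow_le_pow_left₀ (by norm_num) (by linarith) _
  rw [hl1, hl2, hl0]
  set x := Real.log (ρ 0) with hx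
  set w := Real.log (1 + ρ 0) with hw
  have hu0n : u 0 ≠ 0 := by rintro h; rw [h] at hu1; simp at hu1
  have hu1n : u 1 ≠ 0 := by rintro h; rw [h] at hu1; simp at hu1
  have hu2n : u 2 ≠ 0 := by rintro h; rw [h] at hu1; simp at hu1
  have hlsum : Real.log |u 0| + Real.log |u 1| + Real.log |u 2| = 0 := by
    rw [← Real.log_mul (by positivity) (by positivity), ← Real.log_mul (by positivity) (by positivity),
      ← abs_mul, ← abs_mul, hu1]; simp
  -- l = (x, -w, w - x)
  have hdet : 0 < x ^ 2 + x * (w - x) + (w - x) ^ 2 := by nlinarith [sq_nonneg (w - x)]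
  set Δ := x ^ 2 + x * (w - x) + (w - x) ^ 2 with hΔ
  obtain ⟨s, t, e1, e2⟩ : ∃ s t : ℝ, Real.log |u 1| = s * (-w) + t * (w - x) ∧
      Real.log |u 2| = s * (w - x) + t * x := by
    refine ⟨(-(x * Real.log |u 1|) + (w - x) * Real.log |u 2|) / Δ,
      ((w - x) * Real.log |u 1| + w * Real.log |u 2|) / Δ, ?_, ?_⟩
    · field_simp; rw [hΔ]; ring
    · field_simp; rw [hΔ]; ring
  have e0 : Real.log |u 0| = s * x + t * (-w) := by linear_combination hlsum - e1 - e2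
  obtain ⟨k, hk1, hk2, a, b, ha, hb⟩ := pigeon2 s t 200 (by norm_num)
  refine ⟨k, hk1, by omega, a, b, ?_⟩
  set z : Fin 3 → ℝ := u ^ k * ρ ^ (-a) * (fun i => ρ (i + 1)) ^ (-b) with hz
  have hρm := h.mem_self
  have hρi := h.mem_inv ρ hρm hprod
  have hsi := h.mem_inv _ (h.mem_shift hρm) (by simp; linarith)
  have hzm : z ∈ goodRing ρ := Subring.mul_mem _ (Subring.mul_mem _ (Subring.pow_mem _ hu k)
    (goodRing_zpow hρm hρi _)) (goodRing_zpow (h.mem_shift hρm) hsi _)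
  obtain ⟨n, hn⟩ := h.trace_int (Subring.pow_mem _ hzm 2)
  have hρn : ∀ i, ρ i ≠ 0 := by
    intro i hi
    fin_cases i
    · simp at hi; rw [hi] at hprod; simp at hprod
    · simp at hi; rw [hi] at hprod; simp at hprod
    · simp at hi; rw [hi] at hprod; simp at hprod
  have hun : ∀ i, u i ≠ 0 := by
    intro i
    fin_cases i
    · exact hu0n
    · exact hu1n
    · exact hu2n
  have hlog : ∀ i, Real.log ((z ^ 2) i) = 2 * (k * Real.log |u i| - a * Real.log |ρ i| - b * Real.log |ρ (i + 1)|) := by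
    intro i
    have e : (z ^ 2) i = (u i ^ k * ρ i ^ (-a) * ρ (i + 1) ^ (-b)) ^ 2 := by simp [hz]
    have hi := hun i
    have hi1 := hρn i
    have hi2 := hρn (i + 1)
    rw [e, Real.log_pow, ← Real.log_abs, abs_mul, abs_mul, abs_pow, abs_zpow, abs_zpow,
      Real.log_mul (by positivity) (by positivity), Real.log_mul (by positivity) (by positivity), Real.log_pow,
      Real.log_zpow, Real.log_zpow]
    push_cast; ring
  have hzpos : ∀ i, 0 < (z ^ 2) i := by
    intro i
    have e : (z ^ 2) i = (u i ^ k * ρ i ^ (-a) * ρ (i + 1) ^ (-b)) ^ 2 := by simp [hz]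
    have hi := hun i
    have hi1 := hρn i
    have hi2 := hρn (i + 1)
    rw [e]; positivity
  have hz0 := hlog 0
  have hz1 := hlog 1
  have hz2 := hlog 2
  simp only [show (0 : Fin 3) + 1 = 1 from rfl, show (1 : Fin 3) + 1 = 2 from rfl, show (2 : Fin 3) + 1 = 0 from rfl,
    hl0, hl1, hl2, e0, e1, e2] at hz0 hz1 hz2
  rw [abs_le] at ha hb
  set α := (k : ℝ) * s - a with hα
  set β := (k : ℝ) * t - b with hβ
  push_cast at ha hb
  have g0 : Real.log ((z ^ 2) 0) = 2 * (α * x + β * (-w)) := by rw [hz0, hα, hβ]; ring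
  have g1 : Real.log ((z ^ 2) 1) = 2 * (α * (-w) + β * (w - x)) := by rw [hz1, hα, hβ]; ring
  have g2 : Real.log ((z ^ 2) 2) = 2 * (α * (w - x) + β * x) := by rw [hz2, hα, hβ]; ring
  have hexp : Real.exp (18 / 100) < 4 / 3 := by
    have := Real.exp_bound_div_one_sub_of_interval (x := 18 / 100) (by norm_num) (by norm_num)
    norm_num at this ⊢
    linarith
  have hsm : ∀ i, Real.log ((z ^ 2) i) ≤ 18 / 100 → (z ^ 2) i < 4 / 3 := by
    intro i hi
    refine lt_of_le_of_lt ?_ hexp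
    rw [← Real.log_le_iff_le_exp (hzpos i)]
    exact hi
  have bx : ∀ c d p q : ℝ, -(1/200) ≤ c → c ≤ 1/200 → -(1/200) ≤ d → d ≤ 1/200 → |p| ≤ 9 → |q| ≤ 9 → 2 * (c * p + d * q) ≤ 18 / 100 := by
    intro c d p q h1 h2 h3 h4 h5 h6
    have a1 : c * p ≤ 1 / 200 * 9 := by
      refine (le_abs_self _).trans ?_
      rw [abs_mul]
      exact mul_le_mul (abs_le.mpr ⟨h1, h2⟩) h5 (abs_nonneg _) (by norm_num)
    have a2 : d * q ≤ 1 / 200 * 9 := by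
      refine (le_abs_self _).trans ?_
      rw [abs_mul]
      exact mul_le_mul (abs_le.mpr ⟨h3, h4⟩) h6 (abs_nonneg _) (by norm_num)
    linarith
  have ax : |x| ≤ 9 := by rw [abs_le]; constructor <;> linarith
  have aw : |-w| ≤ 9 := by rw [abs_le]; constructor <;> linarith
  have awx : |w - x| ≤ 9 := by rw [abs_le]; constructor <;> linarith
  have s0 := hsm 0 (by rw [g0]; exact bx _ _ _ _ ha.1 ha.2 hb.1 hb.2 ax aw)
  have s1 := hsm 1 (by rw [g1]; exact bx _ _ _ _ ha.1 ha.2 hb.1 hb.2 aw awx)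
  have s2 := hsm 2 (by rw [g2]; exact bx _ _ _ _ ha.1 ha.2 hb.1 hb.2 awx ax)
  obtain ⟨r0, r1, r2⟩ := amgm_eq _ _ _ (hzpos 0) (hzpos 1) (hzpos 2) (by linarith) (by rw [g0, g1, g2]; ring) n hn
  rw [r1, Real.log_one] at g1
  rw [r2, Real.log_one] at g2
  rw [e1, e2]
  constructor
  · rw [hα, hβ] at g1; linarith
  · rw [hα, hβ] at g2; linarith
end

section
theorem RTup.unit_mem {m : ℤ} {ρ : Fin 3 → ℝ} (h : RTup m ρ) (x y : ℤ)
    (h1 : ∀ i, (1 + ρ i) * ρ (i + 1) = -1)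
    (hF : x ^ 3 - m * x ^ 2 * y - (m + 3) * x * y ^ 2 - y ^ 3 = m ^ 2 + 3 * m + 9)
    (hD : (x - y * ρ 0) * (x - y * ρ 1) * (x - y * ρ 2) = m ^ 2 + 3 * m + 9)
    (u : Fin 3 → ℝ) (hu : ∀ i, u i = ρ (i + 1) * (x - y * ρ i) ^ 2 * (x - y * ρ (i + 1 + 1)) / (m ^ 2 + 3 * m + 9)) :
    u ∈ goodRing ρ ∧ ∀ i, u i * (x - y * ρ (i + 1)) = ρ (i + 1) * (x - y * ρ i) := by
  have hDpos : (0 : ℝ) < (m : ℝ) ^ 2 + 3 * m + 9 := by nlinarith [sq_nonneg ((m : ℝ) + 3 / 2)]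
  have hne : ∀ i, (x - y * ρ i) ≠ 0 := by
    intro i hi
    fin_cases i <;> · simp at hi; rw [hi] at hD; simp at hD; linarith
  have hD' : ∀ i : Fin 3, (x - y * ρ i) * (x - y * ρ (i + 1)) * (x - y * ρ (i + 1 + 1)) = m ^ 2 + 3 * m + 9 := by
    intro i
    fin_cases i
    · exact hD
    · simp only [Fin.mk_one, show (1 : Fin 3) + 1 = 2 from rfl, show (2 : Fin 3) + 1 = 0 from rfl]; linarith
    · simp only [Fin.reduceFinMk, show (2 : Fin 3) + 1 = 0 from rfl, show (0 : Fin 3) + 1 = 1 from rfl]; linarith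
  have hrel : ∀ i, u i * (x - y * ρ (i + 1)) = ρ (i + 1) * (x - y * ρ i) := by
    intro i
    rw [hu i, div_mul_eq_mul_div, div_eq_iff hDpos.ne']
    have := hD' i
    linear_combination ρ (i + 1) * (x - y * ρ i) * this
  refine ⟨?_, hrel⟩
  rw [mem_goodRing]
  constructor
  · set n : ℤ := m + x * y * (x + y) with hn
    refine ⟨Polynomial.X ^ 3 - Polynomial.C n * Polynomial.X ^ 2 - Polynomial.C (n + 3) * Polynomial.X - 1,
      by monicity!, ?_⟩
    funext i
    simp only [Polynomial.eval₂_sub, Polynomial.eval₂_mul, Polynomial.eval₂_pow, Polynomial.eval₂_X,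
      Polynomial.eval₂_C, Polynomial.eval₂_one]
    have hgoal : u i ^ 3 - n * u i ^ 2 - (n + 3) * u i - 1 = 0 := by
      set T := ρ i with hT
      set B : ℝ := x * T + x + y with hB
      have hA : u i * B = y * T - x := by
        have e1 := hrel i
        have e2 := h1 i
        rw [← hT] at e1 e2
        have hB' : B = (1 + T) * (x - y * ρ (i + 1)) := by
          rw [hB]; linear_combination y * e2
        rw [hB']
        linear_combination (1 + T) * e1 + (x - y * T) * e2
      have hBne : B ≠ 0 := by
        have e2 := h1 i
        rw [← hT] at e2
        have hB' : B = (1 + T) * (x - y * ρ (i + 1)) := by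
          rw [hB]; linear_combination y * e2
        rw [hB']
        apply mul_ne_zero _ (hne _)
        intro h0; rw [h0] at e2; norm_num at e2
      have hFr : (x : ℝ) ^ 3 - m * x ^ 2 * y - (m + 3) * x * y ^ 2 - y ^ 3 = m ^ 2 + 3 * m + 9 := by exact_mod_cast hF
      have hr := h.root i
      rw [← hT] at hr
      have hnr : (n : ℝ) = m + x * y * (x + y) := by rw [hn]; push_cast; ring
      have key : B ^ 3 * (u i ^ 3 - n * u i ^ 2 - (n + 3) * u i - 1) = 0 := by
        have e : B ^ 3 * (u i ^ 3 - n * u i ^ 2 - (n + 3) * u i - 1) =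
          (u i * B) ^ 3 - n * (u i * B) ^ 2 * B - (n + 3) * (u i * B) * B ^ 2 - B ^ 3 := by ring
        rw [e, hA, hB, hnr]
        linear_combination ((y : ℝ) ^ 3 - (m + x * y * (x + y)) * y ^ 2 * x - (m + x * y * (x + y) + 3) * y * x ^ 2 - x ^ 3) * hr
          + (x * y * (x + y) * (T ^ 2 + T)) * hFr
      rcases mul_eq_zero.mp key with h | h
      · exact absurd h (pow_ne_zero _ hBne)
      · exact h
    simpa using hgoal
  · set a : Fin 3 → ℝ := (x : Fin 3 → ℝ) - (y : Fin 3 → ℝ) * ρ with ha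
    have ham : a ∈ goodRing ρ := Subring.sub_mem _ (intCast_mem _ _) (Subring.mul_mem _ (intCast_mem _ _) h.mem_self)
    have hz := Subring.mul_mem _ (Subring.mul_mem _ (h.mem_shift h.mem_self) (Subring.pow_mem _ ham 2))
      (h.mem_shift (h.mem_shift ham))
    obtain ⟨_, g, hg⟩ := mem_goodRing.mp hz
    refine ⟨g * Polynomial.C (1 / ((m : ℚ) ^ 2 + 3 * m + 9)), ?_⟩
    rw [map_mul, hg]
    funext i
    rw [hu i]
    simp [ha]
    field_simp

theorem pl_n1 (r η y Y : ℝ) (hlo : 123 / 100 < r) (hhi : r < 5003) (hY : Y = |y|) (hY12 : 10 ^ 12 ≤ Y)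
    (hη1 : |η| ≤ 1 / 100) (c : ℝ) (hc : 0 ≤ c) (hc2 : c ≤ 2) :
    |η + y * (r + c)| ≤ 5006 * Y ∧ (1 ≤ c → 2 * Y ≤ |η + y * (r + c)|) := by
  have h3 : |y * (r + c)| = Y * (r + c) := by
    rw [abs_mul, abs_of_pos (show 0 < r + c by linarith), hY]
  have hYpos : 0 ≤ Y := by linarith
  constructor
  · refine (abs_add_le _ _).trans ?_
    rw [h3]
    have : Y * (r + c) ≤ Y * 5005 := mul_le_mul_of_nonneg_left (by linarith) hYpos
    linarith
  · intro h1
    have h4 := abs_sub_abs_le_abs_sub (y * (r + c)) (-η)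
    rw [h3, abs_neg, sub_neg_eq_add, add_comm _ η] at h4
    have : Y * 2.2 ≤ Y * (r + c) := mul_le_mul_of_nonneg_left (by linarith) hYpos
    linarith

theorem pl_n2 (v ε : ℝ) (hv : |v + 1| ≤ ε) (h9s : ε ≤ 1 / 2) : abs (Real.log |v|) ≤ 2 * ε := by
  have hv : abs (|v| - 1) ≤ ε := by
    have : |v| = |-v| := (abs_neg _).symm
    rw [this]
    have h3 := abs_abs_sub_abs_le (-v) 1
    rw [abs_one] at h3
    refine h3.trans ?_
    rw [show -v - 1 = -(v + 1) by ring, abs_neg]; exact hv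
  obtain ⟨v1, v2⟩ := abs_le.mp hv
  have vpos : 0 < |v| := by linarith
  have hp : 0 ≤ ε := by linarith
  rw [abs_le]
  have u1 := Real.log_le_sub_one_of_pos vpos
  have u2 := Real.one_sub_inv_le_log_of_pos vpos
  constructor
  · refine le_trans ?_ u2
    have : |v|⁻¹ ≤ 1 + 2 * ε := by
      rw [inv_le_iff_one_le_mul₀ vpos]
      nlinarith
    linarith
  · linarith

theorem pl_n3 (r a1 a2 D Y u : ℝ) (hr : 0 < r) (hhi : r < 5003) (hY : 0 < Y) (h1 : |a1| ≤ 5006 * Y) (h2 : |a2| ≤ 5006 * Y)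
    (hD : 6 < D) (hu : u = r * a2 ^ 2 * a1 / D) (hu1 : 1 < |u|) : Real.log |u| ≤ 36 + 3 * Real.log Y := by
  have hu2hi : |u| ≤ 2 ^ 50 * Y ^ 3 := by
    rw [hu, abs_div, abs_of_pos (show (0 : ℝ) < D by linarith), div_le_iff₀ (by linarith), abs_mul, abs_mul, abs_pow,
      abs_of_pos hr]
    calc r * |a2| ^ 2 * |a1| ≤ 5003 * (5006 * Y) ^ 2 * (5006 * Y) := by gcongr
      _ = 5003 * 5006 ^ 3 * Y ^ 3 := by ring
      _ ≤ 2 ^ 50 * 6 * Y ^ 3 := mul_le_mul_of_nonneg_right (by norm_num) (by positivity)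
      _ = 2 ^ 50 * Y ^ 3 * 6 := by ring
      _ ≤ _ := by gcongr
  have h3 : Real.log |u| ≤ Real.log (2 ^ 50 * Y ^ 3) := Real.log_le_log (by linarith) hu2hi
  have h4 := Real.log_two_lt_d9
  rw [Real.log_mul (by positivity) (by positivity), Real.log_pow, Real.log_pow] at h3
  push_cast at h3
  linarith

theorem pl_n4 (r η a2 v Y : ℝ) (hlo : 1 < r) (hY : 10 ^ 12 ≤ Y) (hη : |η| ≤ 18 / Y ^ 2)
    (ha2 : 2 * Y ≤ |a2|) (hv : v * a2 = (-1 / r) * η) : |v| ≤ 9 / Y ^ 3 ∧ 9 / Y ^ 3 ≤ 1 / 2 := by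
  have hYpos : 0 < Y := by linarith
  constructor
  · have h4 : |v| * |a2| ≤ |η| := by
      rw [← abs_mul, hv, abs_mul, neg_div, abs_neg, abs_of_pos (by positivity)]
      have : 1 / r ≤ 1 := by rw [div_le_one (by linarith)]; linarith
      exact mul_le_of_le_one_left (abs_nonneg _) this
    have h5 : |v| * (2 * Y) ≤ 18 / Y ^ 2 :=
      (mul_le_mul_of_nonneg_left ha2 (abs_nonneg _)).trans (h4.trans hη)
    rw [le_div_iff₀ (by positivity)] at h5 ⊢
    linarith
  · rw [div_le_div_iff₀ (by positivity) (by norm_num)]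
    have : (10 ^ 12) ^ 3 ≤ Y ^ 3 := pow_le_pow_left₀ (by norm_num) hY 3
    linarith

set_option maxHeartbeats 4000000 in
theorem part2_a (m x y : ℤ) (hm : -1 ≤ m) (ρ : Fin 3 → ℝ) (h : RTup m ρ)
    (hlo : 123 / 100 < ρ 0) (hhi : ρ 0 < 5003)
    (h1 : ρ 1 = -1 / (1 + ρ 0)) (h2 : ρ 2 = -1 - 1 / ρ 0)
    (hF : x ^ 3 - m * x ^ 2 * y - (m + 3) * x * y ^ 2 - y ^ 3 = m ^ 2 + 3 * m + 9)
    (hy : 10 ^ 12 ≤ |y|) (hη : |x - y * ρ 0| * y ^ 2 ≤ 18)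
    : ∃ P Q : ℤ, |(P : ℝ) * Real.log (-ρ 2) - Q * Real.log (ρ 0)| ≤ 720000 / |(y : ℝ)| ^ 3 ∧
      0 < (Q : ℝ) * Real.log (-ρ 2) + (P + Q) * Real.log (ρ 0) ∧
      (Q : ℝ) * Real.log (-ρ 2) + (P + Q) * Real.log (ρ 0) ≤ 40000 * (36 + 3 * Real.log |(y : ℝ)|) := by
  have hp0 : 0 < ρ 0 := by linarith
  have hDr : ((m : ℝ)) = (ρ 0 ^ 3 - 3 * ρ 0 - 1) / (ρ 0 ^ 2 + ρ 0) := by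
    have := h.root 0
    field_simp; linarith
  have hFr : (x : ℝ) ^ 3 - m * x ^ 2 * y - (m + 3) * x * y ^ 2 - y ^ 3 = m ^ 2 + 3 * m + 9 := by exact_mod_cast hF
  have hD : (x - y * ρ 0) * (x - y * ρ 1) * (x - y * ρ 2) = m ^ 2 + 3 * m + 9 := by
    rw [← hFr, h1, h2, hDr]; field_simp; ring
  have hDpos : (6 : ℝ) < (m : ℝ) ^ 2 + 3 * m + 9 := by nlinarith [sq_nonneg ((m : ℝ) + 3 / 2)]
  have hcyc : ∀ i, (1 + ρ i) * ρ (i + 1) = -1 := by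
    intro i
    fin_cases i
    · simp [h1]; field_simp
    · simp [h1, h2]; field_simp; ring
    · simp [h2]; field_simp; ring
  set u : Fin 3 → ℝ := fun i => ρ (i + 1) * (x - y * ρ i) ^ 2 * (x - y * ρ (i + 1 + 1)) / (m ^ 2 + 3 * m + 9) with hu
  obtain ⟨hum, hurel⟩ := h.unit_mem x y hcyc hF hD u (fun i => rfl)
  have hr0 := hurel 0
  have hr1 := hurel 1
  have hr2 := hurel 2
  simp only [show (0 : Fin 3) + 1 = 1 from rfl, show (1 : Fin 3) + 1 = 2 from rfl, show (2 : Fin 3) + 1 = 0 from rfl] at hr0 hr1 hr2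
  set η : ℝ := x - y * ρ 0 with hηd
  have hηne : η ≠ 0 := by
    intro h0; rw [h0] at hD; simp at hD; linarith
  have ha1 : (x : ℝ) - y * ρ 1 ≠ 0 := by
    intro h0; rw [h0] at hD; simp at hD; linarith
  have ha2 : (x : ℝ) - y * ρ 2 ≠ 0 := by
    intro h0; rw [h0] at hD; simp at hD; linarith
  have hprod : ρ 0 * ρ 1 * ρ 2 = 1 := by rw [h1, h2]; field_simp; ring
  have hu1 : u 0 * u 1 * u 2 = 1 := by
    have hne : η * (x - y * ρ 1) * (x - y * ρ 2) ≠ 0 := mul_ne_zero (mul_ne_zero hηne ha1) ha2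
    apply mul_right_cancel₀ hne
    calc u 0 * u 1 * u 2 * (η * (x - y * ρ 1) * (x - y * ρ 2)) =
        (u 0 * (x - y * ρ 1)) * (u 1 * (x - y * ρ 2)) * (u 2 * η) := by ring
      _ = _ := by rw [hr0, hr1, hr2]; linear_combination (η * (x - y * ρ 1) * (x - y * ρ 2)) * hprod
  obtain ⟨k, hk1, hk2, a, b, e1, e2⟩ := h.unit_rel hlo hhi h1 h2 u hum hu1
  -- sizes
  set Y : ℝ := |(y : ℝ)| with hY
  have hY12 : (10 : ℝ) ^ 12 ≤ Y := by
    rw [hY, ← Int.cast_abs]; exact_mod_cast hy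
  have hYpos : 0 < Y := by positivity
  have hη' : |η| ≤ 18 / Y ^ 2 := by
    rw [le_div_iff₀ (by positivity), hY, sq_abs]; exact hη
  have hη1 : |η| ≤ 1 / 100 := by
    refine hη'.trans ?_
    rw [div_le_div_iff₀ (by positivity) (by norm_num)]
    have : ((10 : ℝ) ^ 12) ^ 2 ≤ Y ^ 2 := pow_le_pow_left₀ (by norm_num) hY12 2
    linarith
  have hd2 : (x : ℝ) - y * ρ 2 = η + y * (ρ 0 + (1 + 1 / ρ 0)) := by rw [hηd, h2]; ring
  have hd1 : (x : ℝ) - y * ρ 1 = η + y * (ρ 0 + 1 / (1 + ρ 0)) := by rw [hηd, h1]; ring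
  have hinv : 1 / ρ 0 ≤ 1 := by rw [div_le_one hp0]; linarith
  have hinvp : 0 < 1 / ρ 0 := by positivity
  have hinv' : 1 / (1 + ρ 0) ≤ 1 := by rw [div_le_one (by linarith)]; linarith
  have hinvp' : 0 < 1 / (1 + ρ 0) := by positivity
  have hn2 := pl_n1 (ρ 0) η y Y hlo hhi hY hY12 hη1 (1 + 1 / ρ 0) (by linarith) (by linarith)
  have hA2lo := hn2.2 (by linarith)
  have hA2hi := hn2.1
  have hA1hi := (pl_n1 (ρ 0) η y Y hlo hhi hY hY12 hη1 (1 / (1 + ρ 0)) (by linarith) (by linarith)).1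
  rw [← hd2] at hA2lo hA2hi
  rw [← hd1] at hA1hi
  have h3 : (u 1 + 1) * (x - y * ρ 2) = (-1 / ρ 0) * η := by
    have : (u 1 + 1) * (x - y * ρ 2) = ρ 2 * (x - y * ρ 1) + (x - y * ρ 2) := by rw [add_mul, hr1]; ring
    rw [this, hd1, hd2, h2]; field_simp; ring
  obtain ⟨hu1s, h9s⟩ := pl_n4 (ρ 0) η _ _ Y (by linarith) hY12 hη' hA2lo h3
  have hlog1 : abs (Real.log |u 1|) ≤ 18 / Y ^ 3 := by
    refine (pl_n2 _ _ hu1s h9s).trans (le_of_eq ?_)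
    ring
  have hu2pos : 1 < |u 2| := by
    have h3 : |u 2| * |η| = ρ 0 * |(x : ℝ) - y * ρ 2| := by
      rw [← abs_mul, hr2, abs_mul, abs_of_pos hp0]
    by_contra hcon
    push Not at hcon
    have h4 : |u 2| * |η| ≤ 1 * (1 / 100) := mul_le_mul hcon hη1 (abs_nonneg _) (by norm_num)
    have h5 : 1 * (2 * Y) ≤ ρ 0 * |(x : ℝ) - y * ρ 2| := mul_le_mul (by linarith) hA2lo (by linarith) hp0.le
    linarith
  have hlam2 : 0 < Real.log |u 2| := Real.log_pos hu2pos
  have hlog2 : Real.log |u 2| ≤ 36 + 3 * Real.log Y :=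
    pl_n3 (ρ 0) _ _ _ Y (u 2) hp0 hhi hYpos hA1hi hA2hi hDpos rfl hu2pos
  -- logs
  have hl1 : Real.log |ρ 1| = - Real.log (1 + ρ 0) := by
    rw [h1, abs_div, abs_neg, abs_one, abs_of_pos (by linarith), one_div, Real.log_inv]
  have hρ2neg : -ρ 2 = 1 + 1 / ρ 0 := by rw [h2]; ring
  have hl2' : Real.log |ρ 2| = Real.log (-ρ 2) := by rw [abs_of_neg (by linarith)]
  have hl0' : Real.log |ρ 0| = Real.log (ρ 0) := by rw [abs_of_pos hp0]
  have hlsum : Real.log (1 + ρ 0) = Real.log (-ρ 2) + Real.log (ρ 0) := by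
    rw [← Real.log_mul (by linarith) hp0.ne', hρ2neg]
    congr 1; field_simp; ring
  rw [hl1, hl2', hlsum] at e1
  rw [hl2', hl0'] at e2
  set l0 := Real.log (ρ 0) with hl0d
  set l2 := Real.log (-ρ 2) with hl2d
  have hk1r : (1 : ℝ) ≤ k := by exact_mod_cast hk1
  have hk2r : (k : ℝ) ≤ 40000 := by exact_mod_cast hk2
  have hΛ : |((b : ℝ) - a) * l2 - a * l0| ≤ 720000 / Y ^ 3 := by
    have : ((b : ℝ) - a) * l2 - a * l0 = k * Real.log |u 1| := by rw [e1]; ring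
    rw [this, abs_mul, abs_of_nonneg (by linarith)]
    calc (k : ℝ) * abs (Real.log |u 1|) ≤ 40000 * (18 / Y ^ 3) := by gcongr
      _ = _ := by ring
  refine ⟨b - a, a, ?_, ?_, ?_⟩
  · push_cast; exact hΛ
  · have : (a : ℝ) * l2 + (((b - a : ℤ) : ℝ) + a) * l0 = k * Real.log |u 2| := by rw [e2]; push_cast; ring
    rw [this]; positivity
  · have : (a : ℝ) * l2 + (((b - a : ℤ) : ℝ) + a) * l0 = k * Real.log |u 2| := by rw [e2]; push_cast; ring
    rw [this]
    have h0 : 0 ≤ 36 + 3 * Real.log Y := hlam2.le.trans hlog2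
    gcongr
end

section
theorem pl_end (A l : ℕ) (Y : ℝ) (hY : 1 ≤ Y) (hl80 : 80 ≤ l) (hAge : 2 ^ (l - 1) ≤ A)
    (hAle : (A : ℝ) ≤ 240000 * (36 + 3 * Real.log Y))
    (hfin : Y ^ 3 ≤ 720000 * ((2 : ℝ) ^ (1000000 * (1000 * l) ^ 2)) ^ 21) : False := by
  have hYpos : 0 < Y := by linarith
  have hgrow : ∀ n : ℕ, 80 ≤ n → 5 * 10 ^ 18 * n ^ 2 < 2 ^ (n - 1) := by
    intro n hn
    induction n, hn using Nat.le_induction with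
    | base => norm_num
    | succ n hn ih =>
      have e : n + 1 - 1 = (n - 1) + 1 := by omega
      rw [e, pow_succ 2 (n - 1)]
      have h2 : (n + 1) ^ 2 ≤ 2 * n ^ 2 := by nlinarith
      linarith
  have hgl := hgrow l hl80
  have hlogY : 3 * Real.log Y ≤ 14 + 147 * 10 ^ 11 * (l : ℝ) ^ 2 := by
    have h3 := Real.log_le_log (by positivity) hfin
    rw [← pow_mul, Real.log_pow, Real.log_mul (by norm_num) (by positivity), Real.log_pow] at h3
    have h4 := Real.log_two_lt_d9
    have h5 : Real.log 720000 ≤ 14 := by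
      rw [Real.log_le_iff_le_exp (by norm_num)]
      have h3 : Real.exp 14 = Real.exp 1 ^ 14 := by rw [← Real.exp_nat_mul]; norm_num
      have h4 := Real.exp_one_gt_d9
      rw [h3]
      calc (720000 : ℝ) ≤ 2.7 ^ 14 := by norm_num
        _ ≤ _ := pow_le_pow_left₀ (by norm_num) (by linarith) _
    have e : ((1000000 * (1000 * l) ^ 2 * 21 : ℕ) : ℝ) = 21 * 10 ^ 12 * (l : ℝ) ^ 2 := by push_cast; ring
    rw [e] at h3
    push_cast at h3
    have h6 : 0 ≤ (l : ℝ) ^ 2 := by positivity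
    generalize (l : ℝ) ^ 2 = t at *
    nlinarith
  have hglr : (5 : ℝ) * 10 ^ 18 * l ^ 2 < A := by
    have := lt_of_lt_of_le hgl hAge
    exact_mod_cast this
  have hl80r : (80 : ℝ) ^ 2 ≤ (l : ℝ) ^ 2 := pow_le_pow_left₀ (by norm_num) (by exact_mod_cast hl80) 2
  linarith

theorem pl_ten (l : ℕ) (hl : 80 ≤ l) : 10000 * (1000 * l) ≤ 2 ^ (l - 1) := by
  induction l, hl using Nat.le_induction with
  | base => norm_num
  | succ n hn ih =>
    have e : n + 1 - 1 = (n - 1) + 1 := by omega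
    rw [e, pow_succ]
    omega

set_option maxHeartbeats 4000000 in
theorem part2_large (m x y : ℤ) (hm : -1 ≤ m) (ρ : Fin 3 → ℝ) (h : RTup m ρ)
    (hlo : 123 / 100 < ρ 0) (hhi : ρ 0 < 5003)
    (h1 : ρ 1 = -1 / (1 + ρ 0)) (h2 : ρ 2 = -1 - 1 / ρ 0)
    (hF : x ^ 3 - m * x ^ 2 * y - (m + 3) * x * y ^ 2 - y ^ 3 = m ^ 2 + 3 * m + 9)
    (hy : 10 ^ 12 ≤ |y|) (hη : |x - y * ρ 0| * y ^ 2 ≤ 18)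
    (hFa : ∀ P Q : ℕ, 0 < P → 0 < Q → P < 2 ^ 79 → Q < 2 ^ 79 →
      1 / (10 : ℝ) ^ 30 ≤ |P * Real.log (-ρ 2) - Q * Real.log (ρ 0)|) : False := by
  have hp0 : 0 < ρ 0 := by linarith
  obtain ⟨p, q, hΛ, hEpos, hEle⟩ := part2_a m x y hm ρ h hlo hhi h1 h2 hF hy hη
  set Y : ℝ := |(y : ℝ)| with hY
  have hY12 : (10 : ℝ) ^ 12 ≤ Y := by
    rw [hY, ← Int.cast_abs]; exact_mod_cast hy
  have hYpos : 0 < Y := by positivity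
  have hinv : 1 / ρ 0 ≤ 1 := by rw [div_le_one hp0]; linarith
  have hinvp : 0 < 1 / ρ 0 := by positivity
  have hρ2neg : -ρ 2 = 1 + 1 / ρ 0 := by rw [h2]; ring
  have hlsum : Real.log (1 + ρ 0) = Real.log (-ρ 2) + Real.log (ρ 0) := by
    rw [← Real.log_mul (by linarith) hp0.ne', hρ2neg]
    congr 1; field_simp; ring
  have hl0 : 1 / 6 ≤ Real.log (ρ 0) := by
    rw [Real.le_log_iff_exp_le hp0]
    have := Real.exp_bound_div_one_sub_of_interval (x := 1 / 6) (by norm_num) (by norm_num)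
    norm_num at this ⊢
    linarith
  have hl2 : 1 / 6000 ≤ Real.log (-ρ 2) := by
    refine le_trans ?_ (Real.one_sub_inv_le_log_of_pos (by linarith))
    rw [hρ2neg]
    have : 1 - (1 + 1 / ρ 0)⁻¹ = 1 / (1 + ρ 0) := by field_simp; ring
    rw [this]
    exact one_div_le_one_div_of_le (by linarith) (by linarith)
  have hl9 : Real.log (1 + ρ 0) ≤ 9 := by
    rw [Real.log_le_iff_le_exp (by linarith)]
    have h3 : Real.exp 9 = Real.exp 1 ^ 9 := by rw [← Real.exp_nat_mul]; norm_num
    have h4 := Real.exp_one_gt_d9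
    rw [h3]
    calc 1 + ρ 0 ≤ 2.7 ^ 9 := by norm_num; linarith
      _ ≤ _ := pow_le_pow_left₀ (by norm_num) (by linarith) _
  set l0 := Real.log (ρ 0) with hl0d
  set l2 := Real.log (-ρ 2) with hl2d
  have hsmall : 720000 / Y ^ 3 < 1 / 10 ^ 30 := by
    rw [div_lt_div_iff₀ (by positivity) (by norm_num)]
    calc (720000 : ℝ) * 10 ^ 30 < (10 ^ 12) ^ 3 := by norm_num
      _ ≤ Y ^ 3 := pow_le_pow_left₀ (by norm_num) hY12 3
      _ = _ := by ring
  have hsmall' : |(p : ℝ) * l2 - q * l0| < 1 / 6000 := lt_of_le_of_lt hΛ (hsmall.trans (by norm_num))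
  obtain ⟨s1, s2⟩ := abs_lt.mp hsmall'
  have ha : 1 ≤ q := by
    by_contra hcon
    have ha0r : (q : ℝ) ≤ 0 := by exact_mod_cast (show q ≤ 0 by omega)
    by_cases hb : 1 ≤ p
    · have hbr : (1 : ℝ) ≤ p := by exact_mod_cast hb
      nlinarith
    · have hbr : (p : ℝ) ≤ 0 := by exact_mod_cast (show p ≤ 0 by omega)
      nlinarith
  have har : (1 : ℝ) ≤ q := by exact_mod_cast ha
  have hb : 1 ≤ p := by
    by_contra hcon
    have hbr : (p : ℝ) ≤ 0 := by exact_mod_cast (show p ≤ 0 by omega)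
    nlinarith
  obtain ⟨P, hP⟩ : ∃ P : ℕ, p = P := ⟨p.toNat, by omega⟩
  obtain ⟨Q, hQ⟩ : ∃ Q : ℕ, q = Q := ⟨q.toNat, by omega⟩
  have hPr : (p : ℝ) = P := by exact_mod_cast hP
  have hQr : (q : ℝ) = Q := by exact_mod_cast hQ
  rw [hPr, hQr] at hΛ hEle
  have hPpos : 0 < P := by omega
  have hQpos : 0 < Q := by omega
  obtain ⟨g, P0, Q0, hg, hcop, hPe, hQe⟩ := Nat.exists_coprime' (Nat.gcd_pos_of_pos_left Q hPpos)
  have hP0 : 0 < P0 := Nat.pos_of_ne_zero (by rintro rfl; simp at hPe; omega)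
  have hQ0 : 0 < Q0 := Nat.pos_of_ne_zero (by rintro rfl; simp at hQe; omega)
  have hg1 : (1 : ℝ) ≤ g := by exact_mod_cast hg
  have hΛ0 : |(P0 : ℝ) * l2 - Q0 * l0| ≤ 720000 / Y ^ 3 := by
    refine le_trans ?_ hΛ
    rw [hPe, hQe]; push_cast
    rw [show (P0 : ℝ) * g * l2 - Q0 * g * l0 = g * (P0 * l2 - Q0 * l0) by ring, abs_mul, abs_of_nonneg (show (0 : ℝ) ≤ g by linarith)]
    nlinarith [abs_nonneg ((P0 : ℝ) * l2 - Q0 * l0)]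
  have hPP : (P0 : ℝ) ≤ P := by exact_mod_cast (hPe ▸ Nat.le_mul_of_pos_right P0 hg)
  have hQQ : (Q0 : ℝ) ≤ Q := by exact_mod_cast (hQe ▸ Nat.le_mul_of_pos_right Q0 hg)
  set A := max P0 Q0 with hA
  have hAle : (A : ℝ) ≤ 240000 * (36 + 3 * Real.log Y) := by
    have h3 : (A : ℝ) ≤ P + Q := by
      rw [hA]; push_cast
      have : (0 : ℝ) ≤ P := by positivity
      have : (0 : ℝ) ≤ Q := by positivity
      apply max_le <;> linarith
    have h4 : ((P : ℝ) + Q) * l0 ≤ 40000 * (36 + 3 * Real.log Y) := by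
      have : 0 ≤ (Q : ℝ) * l2 := by positivity
      linarith
    have h6 : (0 : ℝ) ≤ P + Q := by positivity
    nlinarith
  by_cases hbig : A < 2 ^ 79
  · have := hFa P0 Q0 hP0 hQ0 (lt_of_le_of_lt (le_max_left _ _) hbig) (lt_of_le_of_lt (le_max_right _ _) hbig)
    linarith
  push Not at hbig
  set l := Nat.log 2 A + 1 with hl
  have hApos : A ≠ 0 := by intro h0; rw [h0] at hbig; norm_num at hbig
  have hAlt : A < 2 ^ l := Nat.lt_pow_succ_log_self (by norm_num) A
  have hAge : 2 ^ (l - 1) ≤ A := Nat.pow_log_le_self 2 hApos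
  have hl80 : 80 ≤ l := by
    have : 79 ≤ Nat.log 2 A := (Nat.le_log_iff_pow_le (by norm_num) hApos).mpr hbig
    omega
  have h10 : 10000 * (1000 * l) ≤ A := (pl_ten l hl80).trans hAge
  have htl := two_logs (-ρ 2) (ρ 0) (by linarith) (by linarith) (by linarith) (by linarith)
    (h.hLi hm (by
      intro i
      fin_cases i
      · simp; rw [abs_of_pos hp0]; linarith
      · simp [h1]; rw [abs_div, abs_neg, abs_one, abs_of_pos (show 0 < 1 + ρ 0 by linarith), div_le_iff₀ (by linarith)]; nlinarith only [hlo, hhi]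
      · simp; rw [abs_of_neg (by linarith), hρ2neg]; linarith))
    P0 Q0 l (1000 * l) hP0 hQ0 hcop hl80 rfl hAlt h10
  have hfin := htl.trans_le hΛ0
  refine pl_end A l Y (by linarith) hl80 hAge hAle ?_
  rw [div_lt_div_iff₀ (by positivity) (by positivity), one_mul] at hfin
  exact hfin.le
end

section
/-- evaluate the first argument before continuing (for kernel evaluation) -/
def force {α : Type} (x : ℕ) (f : ℕ → α) : α := Nat.rec (motive := fun _ => α) (f 0) (fun k _ => f (Nat.succ k)) x

theorem force_eq {α : Type} (x : ℕ) (f : ℕ → α) : force x f = f x := by cases x <;> rfl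

local notation:65 a:65 "⊕ₙ" b:66 => Nat.add a b
local notation:65 a:65 "⊖ₙ" b:66 => Nat.sub a b
local notation:70 a:70 "⊗ₙ" b:71 => Nat.mul a b
local notation:70 a:70 "⊘ₙ" b:71 => Nat.div a b

/-- boolean conditional by the recursor -/
def ifb {α : Type} (b : Bool) (x y : α) : α := Bool.rec (motive := fun _ => α) y x b

/-- positive and negative part of the cubic form with parameter n = m + 1 -/
def fA (x y : ℕ) : ℕ := x ⊗ₙ x ⊗ₙ (x ⊕ₙ y)
def fB (n x y : ℕ) : ℕ := y ⊗ₙ (n ⊗ₙ (x ⊗ₙ x) ⊕ₙ ((n ⊕ₙ 2) ⊗ₙ x ⊕ₙ y) ⊗ₙ y)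

def artN (S w : ℕ) (k : ℕ) : ℕ → ℕ → ℕ :=
  Nat.rec (motive := fun _ => ℕ → ℕ → ℕ) (fun _ _ => 0)
    (fun _ ih d t => ifb (Nat.beq t 0) 0 (t ⊘ₙ d ⊕ₙ force (t ⊗ₙ w ⊘ₙ S) fun t' => force (d ⊕ₙ 2) fun d' => ih d' t')) k

def laN (S Z : ℕ) : ℕ := force Z fun Z => force (Z ⊗ₙ Z ⊘ₙ S) fun w => 2 ⊗ₙ artN S w 110 1 Z

def newtN (S n : ℕ) (k : ℕ) : ℕ → ℕ :=
  Nat.rec (motive := fun _ => ℕ → ℕ) (fun R => R)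
    (fun _ ih R => force (R ⊗ₙ R) fun R2 => force ((R2 ⊗ₙ (2 ⊗ₙ R ⊕ₙ S) ⊕ₙ S ⊗ₙ S ⊗ₙ S ⊖ₙ n ⊗ₙ R2 ⊗ₙ S) ⊘ₙ (3 ⊗ₙ R2 ⊕ₙ 2 ⊗ₙ R ⊗ₙ S ⊖ₙ S ⊗ₙ (2 ⊗ₙ n ⊗ₙ R ⊕ₙ (n ⊕ₙ 2) ⊗ₙ S)))
      fun R' => ih R') k

def isCubeMod (c : ℕ) : Bool :=
  (force (Nat.mod c 7) fun r => Nat.beq r 0 || Nat.beq r 1 || Nat.beq r 6) &&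
  (force (Nat.mod c 9) fun r => Nat.beq r 0 || Nat.beq r 1 || Nat.beq r 8) &&
  (force (Nat.mod c 13) fun r => Nat.beq r 0 || Nat.beq r 1 || Nat.beq r 5 || Nat.beq r 8 || Nat.beq r 12)

/-- no multiple of (P,Q) with second coordinate at least 5 is a solution -/
def noSol (D F Q : ℕ) : Bool :=
  ifb (Nat.beq (Nat.mod D F) 0) (ifb (isCubeMod (D ⊘ₙ F)) (ifb (Nat.beq D F) (Nat.ble Q 4) false) true) true

def convN (n D B : ℕ) (k : ℕ) : ℕ → ℕ → ℕ → ℕ → ℕ → ℕ → Bool :=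
  Nat.rec (motive := fun _ => ℕ → ℕ → ℕ → ℕ → ℕ → ℕ → Bool) (fun _ _ _ _ _ _ => false)
  (fun _ ih P Q r P' Q' r' =>
    ifb (Nat.ble (4 ⊗ₙ Q') r')
    (ifb (ifb (Nat.ble Q' 4) true (force (fA P Q) fun a => force (fB n P Q) fun b => force ((a ⊖ₙ b) ⊕ₙ (b ⊖ₙ a)) fun f => noSol D f Q))
    (ifb (Nat.ble B Q') true
      (force (r ⊘ₙ r') fun a => force (P ⊕ₙ a ⊗ₙ P') fun P'' => force (Q ⊕ₙ a ⊗ₙ Q') fun Q'' => force (r ⊖ₙ a ⊗ₙ r') fun r'' =>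
        ih P' Q' r' P'' Q'' r'')) false) false) k

def smallN (n D y : ℕ) (k : ℕ) : ℕ → Bool :=
  Nat.rec (motive := fun _ => ℕ → Bool) (fun _ => true)
  (fun _ ih x => force x fun x => force (fA x y) fun a => force (fB n x y) fun b =>
      ifb (ifb (Nat.beq a (b ⊕ₙ D)) ((Nat.beq n 0 && Nat.beq x 2 && Nat.beq y 1) || (Nat.beq n 6 && Nat.beq x 19 && Nat.beq y 3)) true)
        (ifb (ifb (Nat.beq b (a ⊕ₙ D)) ((Nat.beq n 2 && Nat.beq x 5 && Nat.beq y 2) || (Nat.beq n 6 && Nat.beq x 4 && Nat.beq y 1)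
          || (Nat.beq n 13 && Nat.beq x 4 && Nat.beq y 1)) true)
        (ih (Nat.succ x)) false) false) k

def farN (B E T : ℕ) (k : ℕ) : ℕ → ℕ → ℕ → ℕ → ℕ → ℕ → Bool :=
  Nat.rec (motive := fun _ => ℕ → ℕ → ℕ → ℕ → ℕ → ℕ → Bool) (fun _ _ _ _ _ _ => false)
  (fun _ ih u v r u' v' r' =>
    ifb (ifb (Nat.ble B (u ⊕ₙ u')) true (Nat.ble B (v ⊕ₙ v')))
      (Nat.ble (E ⊗ₙ (u ⊕ₙ v) ⊕ₙ T) r && Nat.ble (E ⊗ₙ (u' ⊕ₙ v') ⊕ₙ T) r')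
      (force (r ⊘ₙ r') fun a => force (u ⊕ₙ a ⊗ₙ u') fun u'' => force (v ⊕ₙ a ⊗ₙ v') fun v'' => force (r ⊖ₙ a ⊗ₙ r') fun r'' =>
        ih u' v' r' u'' v'' r'')) k

def chkR (S n R : ℕ) : Bool :=
  Nat.ble 3 R && Nat.ble (fA R S ⊕ₙ 1) (fB n R S) && Nat.ble (fB n (R ⊕ₙ 4) S ⊕ₙ 1) (fA (R ⊕ₙ 4) S)

def chkS (S n D R : ℕ) : Bool :=
  smallN n D 1 39 (R ⊘ₙ S ⊖ₙ 18) && smallN n D 2 11 (2 ⊗ₙ R ⊘ₙ S ⊖ₙ 4) && smallN n D 3 7 (3 ⊗ₙ R ⊘ₙ S ⊖ₙ 2)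
    && smallN n D 4 5 (4 ⊗ₙ R ⊘ₙ S ⊖ₙ 1)

def chkC (S n D R : ℕ) : Bool :=
  force (R ⊘ₙ S) fun a => force (R ⊖ₙ a ⊗ₙ S) fun r => force (S ⊘ₙ r) fun a' => force (a ⊗ₙ a' ⊕ₙ 1) fun P' => force (S ⊖ₙ a' ⊗ₙ r) fun r' =>
    Nat.ble 4 r && convN n D 1000000000000 60 a 1 r P' a' r'

def chkF (S R b L T : ℕ) : Bool :=
  force (L ⊕ₙ laN S ((R ⊖ₙ b ⊗ₙ S) ⊗ₙ S ⊘ₙ (R ⊕ₙ b ⊗ₙ S ⊕ₙ 4))) fun L0 => force (laN S (S ⊗ₙ S ⊘ₙ (2 ⊗ₙ R ⊕ₙ 8 ⊕ₙ S))) fun L2 =>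
    farN 604462909807314587353088 8388608 T 80 0 1 L0 1 0 L2

def chk1 (S T n b L : ℕ) : Bool :=
  force (newtN S n 9 ((n ⊕ₙ 2) ⊗ₙ S) ⊖ₙ 2) fun R => force (n ⊗ₙ n ⊕ₙ n ⊕ₙ 7) fun D =>
    chkR S n R && chkS S n D R && chkC S n D R && chkF S R b L T

/-- run the check for n, n + 1, ..., n + k - 1; L approximates S log n -/
def runN (S T : ℕ) (k : ℕ) : ℕ → ℕ → ℕ :=
  Nat.rec (motive := fun _ => ℕ → ℕ → ℕ) (fun _ L => L)
  (fun _ ih n L => ifb (chk1 S T n n L) (force (L ⊕ₙ laN S (S ⊘ₙ (2 ⊗ₙ n ⊕ₙ 1))) fun L' => force (Nat.succ n) fun n' => ih n' L') 0) k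
end

section
theorem ifb_true {α : Type} (x y : α) : ifb true x y = x := rfl
theorem ifb_false {α : Type} (x y : α) : ifb false x y = y := rfl
theorem ifb_eq {α : Type} (b : Bool) (x y : α) : ifb b x y = if b = true then x else y := by cases b <;> rfl
theorem ifb_ft (b c : Bool) : ifb b c false = (b && c) := by cases b <;> rfl
theorem ifb_tt (b c : Bool) : ifb b c true = (!b || c) := by cases b <;> rfl
theorem ifb_to (b c : Bool) : ifb b true c = (b || c) := by cases b <;> rfl

theorem HasSum.congr_fun' {f g : ℕ → ℝ} {a : ℝ} (hf : HasSum f a) (h : ∀ i, g i = f i) : HasSum g a := by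
  rw [show g = f from funext h]; exact hf

theorem artN_succ (S w k d t : ℕ) : artN S w (k + 1) d t =
    if t = 0 then 0 else t / d + artN S w k (d + 2) (t * w / S) := by
  show ifb (Nat.beq t 0) 0 (t / d + force (t * w / S) fun t' => force (d + 2) fun d' => artN S w k d' t') = _
  simp only [force_eq, ifb_eq, Nat.beq_eq]

theorem art_base (T q d G : ℝ) (hq : 0 ≤ q) (hq4 : q ≤ 1 / 4) (hT : 0 ≤ T) (hT3 : T ≤ 3) (hd : 1 ≤ d)
    (hG : HasSum (fun i : ℕ => T * q ^ i / (d + 2 * i)) G) : 0 ≤ G ∧ G ≤ 4 := by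
  constructor
  · exact hG.nonneg (fun i => by positivity)
  · have hgeo := (hasSum_geometric_of_lt_one hq (by linarith)).mul_left T
    have := hasSum_le (fun i => by
      apply div_le_self (by positivity)
      have : (0 : ℝ) ≤ i := by positivity
      linarith) hG hgeo
    refine this.trans ?_
    have : (1 - q)⁻¹ ≤ 4 / 3 := by
      rw [inv_le_comm₀ (by linarith) (by norm_num)]; linarith
    have h0 : 0 ≤ (1 - q)⁻¹ := by rw [inv_nonneg]; linarith
    nlinarith

theorem artN_spec (S w : ℕ) (W : ℝ) (hS : 0 < S) (hw : (w : ℝ) ≤ W) (hw' : W < w + 1) (hW : 4 * W ≤ S) (k : ℕ) :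
    ∀ (d t : ℕ) (T G : ℝ), 1 ≤ d → t ≤ S → t < 4 ^ k → (t : ℝ) ≤ T → T ≤ t + 3 →
      HasSum (fun i : ℕ => T * (W / S) ^ i / (d + 2 * i)) G →
      (artN S w k d t : ℝ) ≤ G ∧ G ≤ artN S w k d t + (4 * k + 4) := by
  have hS' : (0 : ℝ) < S := by exact_mod_cast hS
  have hW0 : 0 ≤ W := le_trans (by positivity) hw
  have hq : 0 ≤ W / S := by positivity
  have hq4 : W / S ≤ 1 / 4 := by rw [div_le_iff₀ hS']; linarith
  induction k with
  | zero =>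
    intro d t T G hd htS ht h1 h2 hG
    have ht0 : t = 0 := by simpa using ht
    subst ht0
    have hz : artN S w 0 d 0 = 0 := rfl
    have := art_base T (W / S) d G hq hq4 (by simpa using h1) (by simpa using h2) (by exact_mod_cast hd) hG
    rw [hz]; push_cast; constructor <;> linarith
  | succ k ih =>
    intro d t T G hd htS ht h1 h2 hG
    rw [artN_succ]
    have hdr : (1 : ℝ) ≤ d := by exact_mod_cast hd
    by_cases ht0 : t = 0
    · subst ht0
      have := art_base T (W / S) d G hq hq4 (by simpa using h1) (by simpa using h2) hdr hG
      simp only [if_true]; push_cast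
      have : (0 : ℝ) ≤ k := by positivity
      constructor <;> linarith
    · rw [if_neg ht0]
      have hG' : HasSum (fun i : ℕ => (T * (W / S)) * (W / S) ^ i / (((d + 2 : ℕ) : ℝ) + 2 * i)) (G - T / d) := by
        have := (hasSum_nat_add_iff' 1).mpr hG
        simp only [Finset.sum_range_one, pow_zero, Nat.cast_zero, mul_zero, add_zero, mul_one] at this
        refine this.congr_fun' ?_
        intro i
        push_cast
        rw [pow_succ]; ring
      have htr : (0 : ℝ) ≤ t := by positivity
      have hwr : (0 : ℝ) ≤ w := by positivity
      have e1 : ((t * w / S : ℕ) : ℝ) ≤ t * w / S := by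
        have := @Nat.cast_div_le ℝ _ _ _ (t * w) S
        push_cast at this; exact this
      have e2 : (t * w / S : ℝ) < ((t * w / S : ℕ) : ℝ) + 1 := by
        rw [div_lt_iff₀ hS']
        have := Nat.lt_div_mul_add (a := t * w) hS
        have h3 : t * w < (t * w / S + 1) * S := by rw [add_mul, one_mul]; exact this
        exact_mod_cast h3
      have e3 : (t * w / S : ℝ) ≤ T * (W / S) := by
        have : 0 ≤ T := by linarith
        rw [← mul_div_assoc]; gcongr
      have htSr : (t : ℝ) ≤ S := by exact_mod_cast htS
      have e4 : T * (W / S) ≤ t * w / S + (3 / 4 + 1) := by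
        have : T * (W / S) = (T - t) * (W / S) + t * (W - w) / S + t * w / S := by field_simp; ring
        rw [this]
        have a1 : (T - t) * (W / S) ≤ 3 * (1 / 4) := by
          apply mul_le_mul (by linarith) hq4 hq (by norm_num)
        have a2 : t * (W - w) / S ≤ 1 := by
          rw [div_le_one hS']
          calc t * (W - w) ≤ t * 1 := by apply mul_le_mul_of_nonneg_left (by linarith) htr
            _ ≤ S := by linarith
        linarith
      have hlt : t * w / S ≤ t / 4 := by
        have : 4 * w ≤ S := by
          have : (4 * w : ℝ) ≤ S := by linarith
          exact_mod_cast this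
        rw [Nat.le_div_iff_mul_le (by norm_num)]
        have h3 : t * w / S * S ≤ t * w := Nat.div_mul_le_self _ _
        by_contra hc
        push Not at hc
        have : t * S < t * w / S * 4 * S := by nlinarith
        nlinarith
      have hlt' : t * w / S < 4 ^ k := lt_of_le_of_lt hlt (by rw [Nat.div_lt_iff_lt_mul (by norm_num)]; rw [pow_succ] at ht; exact ht)
      have := ih (d + 2) (t * w / S) (T * (W / S)) (G - T / d) (by omega) (hlt.trans ((Nat.div_le_self _ _).trans htS)) hlt'
        (e1.trans e3) (by linarith) hG'
      have b1 : ((t / d : ℕ) : ℝ) ≤ T / d := (Nat.cast_div_le).trans (by gcongr)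
      have b2 : T / d ≤ ((t / d : ℕ) : ℝ) + 4 := by
        rw [div_le_iff₀ (by linarith)]
        have := Nat.lt_div_mul_add (a := t) (b := d) (by omega)
        have h3 : t < (t / d + 1) * d := by rw [add_mul, one_mul]; exact this
        have h4 : (t : ℝ) < (((t / d : ℕ) : ℝ) + 1) * d := by exact_mod_cast h3
        nlinarith
      push_cast
      constructor <;> linarith [this.1, this.2]

theorem laN_eq (S Z : ℕ) : laN S Z = 2 * artN S (Z * Z / S) 110 1 Z := by
  show (force Z fun Z => force (Z * Z / S) fun w => 2 * artN S w 110 1 Z) = _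
  simp only [force_eq]

theorem laN_spec (S Z : ℕ) (hS : S = 2 ^ 220) (hZ : 2 * Z ≤ S) :
    (laN S Z : ℝ) ≤ S * (Real.log (1 + Z / S) - Real.log (1 - Z / S)) ∧
    S * (Real.log (1 + Z / S) - Real.log (1 - Z / S)) ≤ laN S Z + 888 := by
  have hS0 : 0 < S := by rw [hS]; positivity
  have hS' : (0 : ℝ) < S := by exact_mod_cast hS0
  have hZr : 2 * (Z : ℝ) ≤ S := by exact_mod_cast hZ
  have hZ0 : (0 : ℝ) ≤ Z := by positivity
  have hv : |(Z / S : ℝ)| < 1 := by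
    rw [abs_of_nonneg (by positivity), div_lt_one hS']; linarith
  have hh := (Real.hasSum_log_sub_log_of_abs_lt_one hv).mul_left ((S : ℝ) / 2)
  set h := Real.log (1 + Z / S) - Real.log (1 - Z / S) with hhd
  have hG : HasSum (fun i : ℕ => (Z : ℝ) * ((Z * Z / S : ℝ) / S) ^ i / (((1 : ℕ) : ℝ) + 2 * i)) (S / 2 * h) := by
    refine hh.congr_fun' ?_
    intro i
    have : (Z * Z / S : ℝ) / S = (Z / S) ^ 2 := by field_simp
    rw [this, ← pow_mul, pow_succ]
    push_cast
    field_simp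
    ring
  have := artN_spec S (Z * Z / S) (Z * Z / S) hS0 (by
      have := @Nat.cast_div_le ℝ _ _ _ (Z * Z) S
      push_cast at this; exact this) (by
      rw [div_lt_iff₀ hS']
      have := Nat.lt_div_mul_add (a := Z * Z) hS0
      have h3 : Z * Z < (Z * Z / S + 1) * S := by rw [add_mul, one_mul]; exact this
      exact_mod_cast h3) (by
      rw [← mul_div_assoc, div_le_iff₀ hS']; nlinarith) 110 1 Z Z _ le_rfl (by omega)
      (by rw [show (4 : ℕ) ^ 110 = 2 ^ 220 by norm_num, ← hS]; omega) le_rfl (by linarith) hG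
  rw [laN_eq]
  push_cast at this ⊢
  constructor <;> linarith [this.1, this.2]

theorem la_close (S Z : ℕ) (v : ℝ) (hS : S = 2 ^ 220) (hZ : 2 * Z ≤ S) (h1 : (Z : ℝ) ≤ S * v) (h2 : S * v ≤ Z + 8) :
    (laN S Z : ℝ) ≤ S * (Real.log (1 + v) - Real.log (1 - v)) ∧
    S * (Real.log (1 + v) - Real.log (1 - v)) ≤ laN S Z + 1000 := by
  have hS0 : 0 < S := by rw [hS]; positivity
  have hS' : (0 : ℝ) < S := by exact_mod_cast hS0
  have hSb : (1000 : ℝ) ≤ S := by rw [hS]; norm_num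
  have hZr : 2 * (Z : ℝ) ≤ S := by exact_mod_cast hZ
  have hZ0 : (0 : ℝ) ≤ Z := by positivity
  obtain ⟨a, b⟩ := laN_spec S Z hS hZ
  set u : ℝ := Z / S with hu
  have hu0 : 0 ≤ u := by positivity
  have hSu : S * u = Z := by rw [hu]; field_simp
  have huv : u ≤ v := by rw [← hSu] at h1; exact le_of_mul_le_mul_left h1 hS'
  have hu2 : u ≤ 1 / 2 := by rw [hu, div_le_iff₀ hS']; linarith
  have hv2 : v ≤ 1 / 2 + 1 / 100 := by
    have : S * v ≤ S * (1 / 2 + 1 / 100) := by linarith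
    exact le_of_mul_le_mul_left this hS'
  have m1 : Real.log (1 + u) ≤ Real.log (1 + v) := Real.log_le_log (by linarith) (by linarith)
  have m2 : Real.log (1 - v) ≤ Real.log (1 - u) := Real.log_le_log (by linarith) (by linarith)
  have m3 : Real.log (1 + v) - Real.log (1 + u) ≤ v - u := by
    rw [← Real.log_div (by linarith) (by linarith)]
    refine (Real.log_le_sub_one_of_pos (by apply div_pos <;> linarith)).trans ?_
    rw [show (1 + v) / (1 + u) - 1 = (v - u) / (1 + u) by field_simp; ring]
    exact div_le_self (by linarith) (by linarith)
  have m4 : Real.log (1 - u) - Real.log (1 - v) ≤ 4 * (v - u) := by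
    have hv1 : 1 - v ≠ 0 := by linarith
    rw [← Real.log_div (by linarith) (by linarith)]
    refine (Real.log_le_sub_one_of_pos (by apply div_pos <;> linarith)).trans ?_
    rw [show (1 - u) / (1 - v) - 1 = (v - u) / (1 - v) by field_simp; ring, div_le_iff₀ (by linarith)]
    nlinarith
  have hd : S * (v - u) ≤ 8 := by rw [mul_sub, hSu]; linarith
  constructor
  · refine a.trans (mul_le_mul_of_nonneg_left (by linarith) hS'.le)
  · have : S * (Real.log (1 + v) - Real.log (1 - v)) ≤ S * (Real.log (1 + u) - Real.log (1 - u)) + S * (5 * (v - u)) := by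
      rw [← mul_add]
      exact mul_le_mul_of_nonneg_left (by linarith) hS'.le
    linarith
end

section
theorem fA_eq (x y : ℕ) : fA x y = x * x * (x + y) := rfl
theorem fB_eq (n x y : ℕ) : fB n x y = y * (n * (x * x) + ((n + 2) * x + y) * y) := rfl

theorem smallN_succ (n D y k x : ℕ) : smallN n D y (k + 1) x = ifb (ifb (Nat.beq (fA x y) (fB n x y + D)) ((Nat.beq n 0 && Nat.beq x 2 && Nat.beq y 1) || (Nat.beq n 6 && Nat.beq x 19 && Nat.beq y 3)) true)
        (ifb (ifb (Nat.beq (fB n x y) (fA x y + D)) ((Nat.beq n 2 && Nat.beq x 5 && Nat.beq y 2) || (Nat.beq n 6 && Nat.beq x 4 && Nat.beq y 1)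
          || (Nat.beq n 13 && Nat.beq x 4 && Nat.beq y 1)) true)
        (smallN n D y k (x + 1)) false) false := by
  show (force x fun x => force (fA x y) fun a => force (fB n x y) fun b =>
      ifb (ifb (Nat.beq a (b + D)) ((Nat.beq n 0 && Nat.beq x 2 && Nat.beq y 1) || (Nat.beq n 6 && Nat.beq x 19 && Nat.beq y 3)) true)
        (ifb (ifb (Nat.beq b (a + D)) ((Nat.beq n 2 && Nat.beq x 5 && Nat.beq y 2) || (Nat.beq n 6 && Nat.beq x 4 && Nat.beq y 1)
          || (Nat.beq n 13 && Nat.beq x 4 && Nat.beq y 1)) true)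
        (smallN n D y k (x + 1)) false) false) = _
  simp only [force_eq]

theorem smallN_spec (n D y k : ℕ) : ∀ x0, smallN n D y k x0 = true → ∀ x, x0 ≤ x → x < x0 + k →
    (fA x y = fB n x y + D → (n = 0 ∧ x = 2 ∧ y = 1) ∨ (n = 6 ∧ x = 19 ∧ y = 3)) ∧
    (fB n x y = fA x y + D → (n = 2 ∧ x = 5 ∧ y = 2) ∨ (n = 6 ∧ x = 4 ∧ y = 1) ∨ (n = 13 ∧ x = 4 ∧ y = 1)) := by
  induction k with
  | zero => intro x0 _ x h1 h2; omega
  | succ k ih =>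
    intro x0 h x h1 h2
    rw [smallN_succ] at h
    simp only [ifb_ft, ifb_tt, Bool.and_eq_true, Bool.or_eq_true, Nat.beq_eq, Bool.not_eq_true', Bool.not_eq_eq_eq_not, Bool.not_true, ← Bool.not_eq_true] at h
    obtain ⟨ha, hb, hc⟩ := h
    rcases Nat.lt_or_ge x0 x with hlt | hge
    · exact ih (x0 + 1) hc x hlt (by omega)
    · have : x = x0 := by omega
      subst this
      constructor <;> intro h <;> tauto

theorem convN_succ (n D B k P Q r P' Q' r' : ℕ) : convN n D B (k + 1) P Q r P' Q' r' =
    (Nat.ble (4 * Q') r' && ((Nat.ble Q' 4 || noSol D ((fA P Q - fB n P Q) + (fB n P Q - fA P Q)) Q) &&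
     (Nat.ble B Q' || convN n D B k P' Q' r' (P + r / r' * P') (Q + r / r' * Q') (r - r / r' * r')))) := by
  show ifb (Nat.ble (4 * Q') r')
    (ifb (ifb (Nat.ble Q' 4) true (force (fA P Q) fun a => force (fB n P Q) fun b => force ((a - b) + (b - a)) fun f => noSol D f Q))
    (ifb (Nat.ble B Q') true
      (force (r / r') fun a => force (P + a * P') fun P'' => force (Q + a * Q') fun Q'' => force (r - a * r') fun r'' =>
        convN n D B k P' Q' r' P'' Q'' r'')) false) false = _
  simp only [force_eq, ifb_ft, ifb_to]

theorem isCubeMod_cube (t : ℕ) : isCubeMod (t ^ 3) = true := by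
  have h : isCubeMod (t ^ 3) = ((Nat.beq (t ^ 3 % 7) 0 || Nat.beq (t ^ 3 % 7) 1 || Nat.beq (t ^ 3 % 7) 6) &&
    (Nat.beq (t ^ 3 % 9) 0 || Nat.beq (t ^ 3 % 9) 1 || Nat.beq (t ^ 3 % 9) 8) &&
    (Nat.beq (t ^ 3 % 13) 0 || Nat.beq (t ^ 3 % 13) 1 || Nat.beq (t ^ 3 % 13) 5 || Nat.beq (t ^ 3 % 13) 8 || Nat.beq (t ^ 3 % 13) 12)) := by
    show ((force (t ^ 3 % 7) fun r => Nat.beq r 0 || Nat.beq r 1 || Nat.beq r 6) &&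
      (force (t ^ 3 % 9) fun r => Nat.beq r 0 || Nat.beq r 1 || Nat.beq r 8) &&
      (force (t ^ 3 % 13) fun r => Nat.beq r 0 || Nat.beq r 1 || Nat.beq r 5 || Nat.beq r 8 || Nat.beq r 12)) = _
    simp only [force_eq]
  rw [h]
  simp only [Bool.and_eq_true, Bool.or_eq_true, Nat.beq_eq]
  have h7 : t % 7 < 7 := Nat.mod_lt _ (by norm_num)
  have h9 : t % 9 < 9 := Nat.mod_lt _ (by norm_num)
  have h13 : t % 13 < 13 := Nat.mod_lt _ (by norm_num)
  refine ⟨⟨?_, ?_⟩, ?_⟩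
  · rw [Nat.pow_mod]; generalize t % 7 = s at *; interval_cases s <;> simp
  · rw [Nat.pow_mod]; generalize t % 9 = s at *; interval_cases s <;> simp
  · rw [Nat.pow_mod]; generalize t % 13 = s at *; interval_cases s <;> simp

theorem noSol_spec (D F Q t : ℕ) (hD : 0 < D) (h : noSol D F Q = true) (ht : D = t ^ 3 * F) (hQ : 5 ≤ t * Q) : False := by
  have hF : 0 < F := Nat.pos_of_ne_zero (by rintro rfl; simp at ht; omega)
  have e : noSol D F Q = ifb (Nat.beq (D % F) 0) (ifb (isCubeMod (D / F)) (ifb (Nat.beq D F) (Nat.ble Q 4) false) true) true := rfl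
  rw [e, ht, Nat.mul_mod_left, Nat.mul_div_cancel _ hF, isCubeMod_cube] at h
  have e2 : Nat.beq 0 0 = true := rfl
  rw [e2, ifb_true, ifb_true, ifb_ft] at h
  simp only [Bool.and_eq_true, Nat.beq_eq, Nat.ble_eq] at h
  obtain ⟨h1, h2⟩ := h
  have h3 : t ^ 3 = 1 := Nat.eq_of_mul_eq_mul_right hF (by omega)
  have h4 : t = 1 := by simpa using h3
  subst h4
  omega

/-- approximation lemma -/
theorem conv_par (ρ : ℝ) (P Q P' Q' X Y : ℤ) (s : ℤ) (hs : s = 1 ∨ s = -1) (hdet : P * Q' - P' * Q = s)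
    (hQ : 0 ≤ Q) (he : 0 ≤ s * (P - ρ * Q)) (he' : s * (P' - ρ * Q') ≤ 0)
    (hQY : Q ≤ Y) (hY : Y < Q') (hY0 : 0 < Y) (herr : 2 * Y * |X - ρ * Y| < 1) : X * Q = P * Y := by
  by_contra hne
  -- X = a P + b P', Y = a Q + b Q'
  set b : ℤ := s * (P * Y - X * Q) with hb
  set a : ℤ := s * (X * Q' - P' * Y) with ha
  have hss : s * s = 1 := by rcases hs with rfl | rfl <;> norm_num
  have hX : X = a * P + b * P' := by
    have : a * P + b * P' = (s * (P * Q' - P' * Q)) * X := by rw [ha, hb]; ring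
    rw [this, hdet, hss, one_mul]
  have hYY : Y = a * Q + b * Q' := by
    have : a * Q + b * Q' = (s * (P * Q' - P' * Q)) * Y := by rw [ha, hb]; ring
    rw [this, hdet, hss, one_mul]
  have hb0 : b ≠ 0 := by
    intro h0
    apply hne
    have : s * b = 0 := by rw [h0, mul_zero]
    rw [hb, ← mul_assoc, hss, one_mul] at this
    linarith
  -- opposite signs
  have hopp : (a ≤ -1 ∧ 1 ≤ b) ∨ (1 ≤ a ∧ b ≤ -1) := by
    rcases lt_or_gt_of_ne hb0 with h | h
    · right
      refine ⟨?_, by omega⟩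
      by_contra hc
      have : a * Q ≤ 0 := mul_nonpos_of_nonpos_of_nonneg (by omega) hQ
      nlinarith
    · left
      refine ⟨?_, by omega⟩
      by_contra hc
      have : 0 ≤ a * Q := mul_nonneg (by omega) hQ
      nlinarith
  set e : ℝ := P - ρ * Q with hed
  set e' : ℝ := P' - ρ * Q' with hed'
  have hXe : (X - ρ * Y : ℝ) = a * e + b * e' := by
    have h1 : (X : ℝ) = a * P + b * P' := by exact_mod_cast hX
    have h2 : (Y : ℝ) = a * Q + b * Q' := by exact_mod_cast hYY
    rw [h1, h2, hed, hed']; ring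
  have habs : |e| ≤ |(X - ρ * Y : ℝ)| := by
    rw [hXe]
    have key : ∀ a b e e' : ℝ, 1 ≤ a → b ≤ 0 → 0 ≤ e → e' ≤ 0 → |e| ≤ |a * e + b * e'| := by
      intro a b e e' h1 h2 h3 h4
      have : 0 ≤ b * e' := mul_nonneg_of_nonpos_of_nonpos h2 h4
      rw [abs_of_nonneg h3]
      refine le_trans ?_ (le_abs_self _)
      nlinarith
    rcases hs with rfl | rfl
    · simp only [Int.cast_one, one_mul] at he he'
      rcases hopp with ⟨h1, h2⟩ | ⟨h1, h2⟩
      · have := key (-a) (-b) e e' (by exact_mod_cast (by omega : (1 : ℤ) ≤ -a)) (by exact_mod_cast (by omega : -b ≤ (0 : ℤ))) he he'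
        rwa [show -(a : ℝ) * e + -(b : ℝ) * e' = -(a * e + b * e') by ring, abs_neg] at this
      · exact key a b e e' (by exact_mod_cast h1) (by exact_mod_cast (by omega : b ≤ (0 : ℤ))) he he'
    · simp only [Int.cast_neg, Int.cast_one, neg_mul, one_mul] at he he'
      rcases hopp with ⟨h1, h2⟩ | ⟨h1, h2⟩
      · have := key (-a) (-b) (-e) (-e') (by exact_mod_cast (by omega : (1 : ℤ) ≤ -a)) (by exact_mod_cast (by omega : -b ≤ (0 : ℤ))) he (by linarith)
        rwa [show -(a : ℝ) * -e + -(b : ℝ) * -e' = (a * e + b * e') by ring, abs_neg] at this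
      · have := key a b (-e) (-e') (by exact_mod_cast h1) (by exact_mod_cast (by omega : b ≤ (0 : ℤ))) he (by linarith)
        rwa [show (a : ℝ) * -e + (b : ℝ) * -e' = -(a * e + b * e') by ring, abs_neg, abs_neg] at this
  have hinte : (1 : ℝ) ≤ |((P * Y - X * Q : ℤ) : ℝ)| := by
    rw [← Int.cast_abs]
    have : P * Y - X * Q ≠ 0 := fun h => hne (by linarith)
    exact_mod_cast Int.one_le_abs this
  have hle : |((P * Y - X * Q : ℤ) : ℝ)| ≤ |e| * Y + |(X - ρ * Y : ℝ)| * Q := by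
    have hYr : (0 : ℝ) < Y := by exact_mod_cast hY0
    have hQr : (0 : ℝ) ≤ Q := by exact_mod_cast hQ
    have : ((P * Y - X * Q : ℤ) : ℝ) = e * Y - (X - ρ * Y) * Q := by push_cast; rw [hed]; ring
    rw [this]
    refine (abs_sub _ _).trans ?_
    rw [abs_mul, abs_mul, abs_of_pos hYr, abs_of_nonneg hQr]
  have hYr : (0 : ℝ) < Y := by exact_mod_cast hY0
  have hQYr : (Q : ℝ) ≤ Y := by exact_mod_cast hQY
  have i1 : |e| * Y ≤ |(X - ρ * Y : ℝ)| * Y := mul_le_mul_of_nonneg_right habs hYr.le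
  have i2 : |(X - ρ * Y : ℝ)| * Q ≤ |(X - ρ * Y : ℝ)| * Y := mul_le_mul_of_nonneg_left hQYr (abs_nonneg _)
  linarith

theorem nat_par (P Q X Y : ℕ) (hcop : Nat.Coprime P Q) (h : X * Q = P * Y) (hQ : 0 < Q) : ∃ t, X = t * P ∧ Y = t * Q := by
  have : Q ∣ Y := by
    have h1 : Q ∣ P * Y := ⟨X, by rw [← h]; ring⟩
    exact hcop.symm.dvd_of_dvd_mul_left h1
  obtain ⟨t, ht⟩ := this
  refine ⟨t, ?_, by rw [ht]; ring⟩
  apply Nat.eq_of_mul_eq_mul_right hQ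
  rw [h, ht]; ring

theorem convN_spec (S R n D B X Y : ℕ) (ρ : ℝ) (hS : 0 < S) (hD : 0 < D) (hR1 : (R : ℝ) < ρ * S) (hR2 : ρ * S < R + 4)
    (hY5 : 5 ≤ Y) (hYB : Y < B) (herr : 2 * (Y : ℝ) * |X - ρ * Y| < 1)
    (hF : fA X Y = fB n X Y + D ∨ fB n X Y = fA X Y + D) (k : ℕ) :
    ∀ (P Q r P' Q' r' : ℕ) (s : ℤ), (s = 1 ∨ s = -1) → (P : ℤ) * S - Q * R = s * r → (P' : ℤ) * S - Q' * R = -s * r' →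
      (P : ℤ) * Q' - P' * Q = s → 4 * Q ≤ r → 0 < Q → 0 < Q' → Q ≤ Y → convN n D B k P Q r P' Q' r' = true → False := by
  have hSr : (0 : ℝ) < S := by exact_mod_cast hS
  induction k with
  | zero => intro P Q r P' Q' r' s _ _ _ _ _ _ _ _ h; exact absurd h (by simp [convN])
  | succ k ih =>
    intro P Q r P' Q' r' s hs h1 h2 hdet hr hQ hQ' hQY h
    rw [convN_succ] at h
    simp only [Bool.and_eq_true, Bool.or_eq_true, Nat.ble_eq] at h
    obtain ⟨hr', hns, hrec⟩ := h
    rcases Nat.lt_or_ge Y Q' with hlt | hge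
    · have hns := hns.resolve_left (by omega)
      have key : ∀ (P Q r : ℕ) (s : ℤ), (s = 1 ∨ s = -1) → (P : ℤ) * S - Q * R = s * r → 4 * Q ≤ r → (0 : ℝ) ≤ s * ((P : ℝ) - ρ * Q) := by
        intro P Q r s hs h1 hr
        have h1r : (P : ℝ) * S - Q * R = s * r := by exact_mod_cast h1
        have hrr : 4 * (Q : ℝ) ≤ r := by exact_mod_cast hr
        have hQ0 : (0 : ℝ) ≤ Q := by positivity
        have hr0 : (0 : ℝ) ≤ r := by positivity
        have b1 : 0 ≤ (Q : ℝ) * (ρ * S - R) := mul_nonneg hQ0 (by linarith)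
        have b2 : (Q : ℝ) * (ρ * S - R) ≤ Q * 4 := mul_le_mul_of_nonneg_left (by linarith) hQ0
        have : (0 : ℝ) ≤ (s * ((P : ℝ) - ρ * Q)) * S := by
          rcases hs with rfl | rfl
          · push_cast at h1r ⊢; linarith
          · push_cast at h1r ⊢; linarith
        exact nonneg_of_mul_nonneg_left this hSr
      have hpar := conv_par ρ P Q P' Q' X Y s hs hdet (by positivity) (by exact_mod_cast key P Q r s hs h1 hr)
        (by
          have := key P' Q' r' (-s) (by omega) h2 hr'
          push_cast at this ⊢
          linarith) (by exact_mod_cast hQY) (by exact_mod_cast hlt) (by omega) (by exact_mod_cast herr)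
      have hpar' : X * Q = P * Y := by exact_mod_cast hpar
      have hcop : Nat.Coprime P Q := by
        rw [← Nat.isCoprime_iff_coprime]
        rcases hs with rfl | rfl
        · exact ⟨Q', -P', by linarith⟩
        · exact ⟨-Q', P', by linarith⟩
      obtain ⟨t, hX, hYt⟩ := nat_par P Q X Y hcop hpar' hQ
      refine noSol_spec D _ Q t hD hns ?_ (by rw [← hYt]; exact hY5)
      have eA : fA X Y = t ^ 3 * fA P Q := by rw [hX, hYt, fA_eq, fA_eq]; ring
      have eB : fB n X Y = t ^ 3 * fB n P Q := by rw [hX, hYt, fB_eq, fB_eq]; ring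
      rw [eA, eB] at hF
      rw [mul_add, Nat.mul_sub, Nat.mul_sub]
      omega
    · have hrec := hrec.resolve_left (by omega)
      have hle : r / r' * r' ≤ r := Nat.div_mul_le_self _ _
      generalize r / r' = q at *
      refine ih P' Q' r' _ _ _ (-s) (by omega) h2 ?_ ?_ hr' hQ' (by positivity) hge hrec
      · push_cast [Nat.cast_sub hle]
        rw [neg_neg]
        linear_combination h1 + (q : ℤ) * h2
      · push_cast
        linear_combination -hdet

theorem farN_succ (B E T k u v r u' v' r' : ℕ) : farN B E T (k + 1) u v r u' v' r' =
    if (Nat.ble B (u + u') || Nat.ble B (v + v')) = true then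
      (Nat.ble (E * (u + v) + T) r && Nat.ble (E * (u' + v') + T) r')
    else farN B E T k u' v' r' (u + r / r' * u') (v + r / r' * v') (r - r / r' * r') := by
  show ifb (ifb (Nat.ble B (u + u')) true (Nat.ble B (v + v')))
      (Nat.ble (E * (u + v) + T) r && Nat.ble (E * (u' + v') + T) r')
      (force (r / r') fun a => force (u + a * u') fun u'' => force (v + a * v') fun v'' => force (r - a * r') fun r'' =>
        farN B E T k u' v' r' u'' v'' r'') = _
  simp only [force_eq, ifb_to]
  rw [ifb_eq]

theorem far_par (l2 l0 ε : ℝ) (u v u' v' P Q : ℤ) (s : ℤ) (hs : s = 1 ∨ s = -1) (hdet : u * v' - u' * v = s ∨ u * v' - u' * v = -s)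
    (hu : 0 ≤ u) (hv : 0 ≤ v) (hu' : 0 ≤ u') (hv' : 0 ≤ v') (hf : ε ≤ s * (u * l2 - v * l0)) (hf' : ε ≤ -s * (u' * l2 - v' * l0)) (hε : 0 ≤ ε)
    (hP : 0 < P) (hQ : 0 < Q) (hlt : P < u + u' ∨ Q < v + v') : ε ≤ |P * l2 - Q * l0| := by
  obtain ⟨d, hd, hdd⟩ : ∃ d : ℤ, d * d = 1 ∧ u * v' - u' * v = d := ⟨_, by rcases hdet with h | h <;> rw [h] <;> rcases hs with rfl | rfl <;> norm_num, rfl⟩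
  set a : ℤ := d * (P * v' - u' * Q) with ha
  set b : ℤ := d * (u * Q - P * v) with hb
  have hPe : P = a * u + b * u' := by
    have : a * u + b * u' = (d * (u * v' - u' * v)) * P := by rw [ha, hb]; ring
    rw [this, hdd, hd, one_mul]
  have hQe : Q = a * v + b * v' := by
    have : a * v + b * v' = (d * (u * v' - u' * v)) * Q := by rw [ha, hb]; ring
    rw [this, hdd, hd, one_mul]
  set f : ℝ := s * (u * l2 - v * l0) with hfd
  set f' : ℝ := -s * (u' * l2 - v' * l0) with hfd'
  have hPr : (P : ℝ) = a * u + b * u' := by exact_mod_cast hPe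
  have hQr : (Q : ℝ) = a * v + b * v' := by exact_mod_cast hQe
  have hL : s * (P * l2 - Q * l0) = a * f - b * f' := by rw [hPr, hQr, hfd, hfd']; ring
  have habs : |P * l2 - Q * l0| = |a * f - b * f'| := by
    rw [← hL, abs_mul]
    rcases hs with rfl | rfl <;> simp
  rw [habs]
  have hnot : ¬ (1 ≤ a ∧ 1 ≤ b) := by
    rintro ⟨h1, h2⟩
    rcases hlt with h | h
    · nlinarith
    · nlinarith
  have hnot2 : ¬ (a ≤ 0 ∧ b ≤ 0) := by
    rintro ⟨h1, h2⟩
    nlinarith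
  by_cases h1 : 1 ≤ a
  · have hb0 : b ≤ 0 := by by_contra h; exact hnot ⟨h1, by omega⟩
    have h1r : (1 : ℝ) ≤ a := by exact_mod_cast h1
    have hbr : (b : ℝ) ≤ 0 := by exact_mod_cast hb0
    refine le_trans ?_ (le_abs_self _)
    have : b * f' ≤ 0 := mul_nonpos_of_nonpos_of_nonneg hbr (by linarith)
    have h3 : 1 * f ≤ a * f := mul_le_mul_of_nonneg_right h1r (by linarith)
    linarith
  · have hb0 : 1 ≤ b := by by_contra h; exact hnot2 ⟨by omega, by omega⟩
    have h1r : (a : ℝ) ≤ 0 := by exact_mod_cast (by omega : a ≤ 0)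
    have hbr : (1 : ℝ) ≤ b := by exact_mod_cast hb0
    refine le_trans ?_ (neg_le_abs _)
    have : a * f ≤ 0 := mul_nonpos_of_nonpos_of_nonneg h1r (by linarith)
    have h3 : 1 * f' ≤ b * f' := mul_le_mul_of_nonneg_right hbr (by linarith)
    linarith

theorem farN_spec (S B E T L0 L2 P Q : ℕ) (l0 l2 : ℝ) (hS : 0 < S)
    (hP : 0 < P) (hQ : 0 < Q) (hPB : P < B) (hQB : Q < B)
    (a0 : (L0 : ℝ) ≤ S * l0) (b0 : S * l0 ≤ L0 + E) (a2 : (L2 : ℝ) ≤ S * l2) (b2 : S * l2 ≤ L2 + E) (k : ℕ) :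
    ∀ (u v r u' v' r' : ℕ) (s : ℤ), (s = 1 ∨ s = -1) → (u : ℤ) * L2 - v * L0 = s * r → (u' : ℤ) * L2 - v' * L0 = -s * r' →
      ((u : ℤ) * v' - u' * v = s ∨ (u : ℤ) * v' - u' * v = -s) → farN B E T k u v r u' v' r' = true →
      (T / S : ℝ) ≤ |P * l2 - Q * l0| := by
  have hSr : (0 : ℝ) < S := by exact_mod_cast hS
  induction k with
  | zero => intro u v r u' v' r' s _ _ _ _ h; exact absurd h (by simp [farN])
  | succ k ih =>
    intro u v r u' v' r' s hs h1 h2 hdet h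
    rw [farN_succ] at h
    split_ifs at h with hc
    · simp only [Bool.and_eq_true, Bool.or_eq_true, Nat.ble_eq] at h hc
      have key : ∀ (u v r : ℕ) (s : ℤ), (s = 1 ∨ s = -1) → (u : ℤ) * L2 - v * L0 = s * r → E * (u + v) + T ≤ r →
          (T / S : ℝ) ≤ s * ((u : ℝ) * l2 - v * l0) := by
        intro u v r s hs h1 hr
        have h1r : (u : ℝ) * L2 - v * L0 = s * r := by exact_mod_cast h1
        have hrr : E * ((u : ℝ) + v) + T ≤ r := by exact_mod_cast hr
        have hu0 : (0 : ℝ) ≤ u := by positivity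
        have hv0 : (0 : ℝ) ≤ v := by positivity
        have c1 := mul_le_mul_of_nonneg_left a0 hv0
        have c2 := mul_le_mul_of_nonneg_left b0 hv0
        have c3 := mul_le_mul_of_nonneg_left a2 hu0
        have c4 := mul_le_mul_of_nonneg_left b2 hu0
        have hE1 : 0 ≤ (E : ℝ) * u := by positivity
        have hE2 : 0 ≤ (E : ℝ) * v := by positivity
        rw [div_le_iff₀ hSr]
        rcases hs with rfl | rfl
        · push_cast at h1r ⊢; linarith
        · push_cast at h1r ⊢; linarith
      have := far_par l2 l0 (T / S) u v u' v' P Q s hs hdet (by positivity) (by positivity) (by positivity) (by positivity)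
        (by exact_mod_cast key u v r s hs h1 h.1) (by
          have := key u' v' r' (-s) (by omega) h2 h.2
          push_cast at this ⊢; exact this) (by positivity) (by exact_mod_cast hP) (by exact_mod_cast hQ) (by omega)
      exact_mod_cast this
    · have hle : r / r' * r' ≤ r := Nat.div_mul_le_self _ _
      generalize r / r' = q at *
      refine ih u' v' r' _ _ _ (-s) (by omega) h2 ?_ ?_ h
      · push_cast [Nat.cast_sub hle]
        rw [neg_neg]
        linear_combination h1 + (q : ℤ) * h2
      · rcases hdet with h | h
        · left; push_cast; linear_combination -h
        · right; push_cast; linear_combination -h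
end

section
/-- basic facts about the large root, n = m + 1 -/
structure BR (n : ℕ) (ρ : ℝ) : Prop where
  root : ρ ^ 3 + ρ ^ 2 - n * ρ ^ 2 - (n + 2) * ρ - 1 = 0
  lo : 123 / 100 < ρ
  gt : (n : ℝ) < ρ
  lt : ρ < n + 2

theorem BR.fact {n : ℕ} {ρ : ℝ} (h : BR n ρ) (X Y : ℝ) : X ^ 2 * (X + Y) - Y * (n * X ^ 2 + ((n + 2) * X + Y) * Y) =
    (X - ρ * Y) * (X ^ 2 + (ρ + 1 - n) * X * Y + Y ^ 2 / ρ) := by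
  have hp : ρ ≠ 0 := by have := h.lo; linarith
  have hr := h.root
  field_simp
  linear_combination X * Y ^ 2 * hr

theorem BR.key {n : ℕ} {ρ : ℝ} (h : BR n ρ) : ((n : ℝ) ^ 2 + n + 7) < 1.9 * (ρ ^ 2 + (ρ + 1 - n) * ρ + 1 / ρ) := by
  have hlo := h.lo
  have hp0 : 0 < ρ := by linarith
  have hr := h.root
  obtain ⟨p, hp⟩ : ∃ p, p = ρ ^ 2 + ρ := ⟨_, rfl⟩
  have hp27 : 2.7 < p := by rw [hp]; nlinarith
  have hn : (n : ℝ) * p = ρ * p - 2 * ρ - 1 := by rw [hp]; linear_combination -hr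
  have h1 : ((n : ℝ) ^ 2 + n + 7) * p ^ 2 = (p + 1) ^ 3 := by
    have : ((n : ℝ) ^ 2 + n + 7) * p ^ 2 = (n * p) ^ 2 + (n * p) * p + 7 * p ^ 2 := by ring
    rw [this, hn, hp]; ring
  have h2 : (ρ ^ 2 + (ρ + 1 - n) * ρ + 1 / ρ) * p = (p + 1) ^ 2 := by
    have : (ρ ^ 2 + (ρ + 1 - n) * ρ + 1 / ρ) * p = 2 * ρ ^ 2 * p + ρ * p - ρ * (n * p) + (p / ρ) := by ring
    have h3 : p / ρ = ρ + 1 := by rw [hp]; field_simp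
    rw [this, hn, h3, hp]; ring
  have hpp : 0 < p ^ 2 := by positivity
  refine lt_of_mul_lt_mul_right ?_ hpp.le
  rw [h1, show 1.9 * (ρ ^ 2 + (ρ + 1 - n) * ρ + 1 / ρ) * p ^ 2 = 1.9 * p * ((ρ ^ 2 + (ρ + 1 - n) * ρ + 1 / ρ) * p) by ring, h2]
  have : 0 < (p + 1) ^ 2 := by positivity
  nlinarith

theorem BR.herr {n X Y : ℕ} {ρ : ℝ} (h : BR n ρ) (hY : 5 ≤ Y) (hη : |X - ρ * Y| * (Y : ℝ) ^ 2 ≤ 18)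
    (hF : fA X Y = fB n X Y + (n * n + n + 7) ∨ fB n X Y = fA X Y + (n * n + n + 7)) : 2 * (Y : ℝ) * |X - ρ * Y| < 1 := by
  have hlo := h.lo
  have hgt := h.gt
  have hp0 : 0 < ρ := by linarith
  have hYr : (5 : ℝ) ≤ Y := by exact_mod_cast hY
  have hη0 : 0 ≤ |X - ρ * Y| := abs_nonneg _
  have hη1 : |X - ρ * Y| ≤ 0.72 := by
    have h25 : (25 : ℝ) ≤ (Y : ℝ) ^ 2 := by nlinarith
    nlinarith
  have hXlo : 0.88 * (ρ * Y) ≤ X := by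
    have := neg_abs_le ((X : ℝ) - ρ * Y)
    nlinarith
  have hD : |X - ρ * Y| * ((X : ℝ) ^ 2 + (ρ + 1 - n) * X * Y + (Y : ℝ) ^ 2 / ρ) = (n : ℝ) ^ 2 + n + 7 := by
    have hq : 0 ≤ ((X : ℝ) ^ 2 + (ρ + 1 - n) * X * Y + (Y : ℝ) ^ 2 / ρ) := by
      have : 0 ≤ ρ + 1 - n := by linarith
      positivity
    have hf := h.fact X Y
    rw [← abs_of_nonneg hq, ← abs_mul, ← hf]
    rw [fA_eq, fB_eq] at hF
    rcases hF with hF | hF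
    · have hFr : (X : ℝ) * X * (X + Y) = Y * (n * (X * X) + ((n + 2) * X + Y) * Y) + (n * n + n + 7) := by exact_mod_cast hF
      rw [show (X : ℝ) ^ 2 * (X + Y) - Y * (n * X ^ 2 + ((n + 2) * X + Y) * Y) = (n : ℝ) ^ 2 + n + 7 by linarith]
      exact abs_of_nonneg (by positivity)
    · have hFr : (Y : ℝ) * (n * (X * X) + ((n + 2) * X + Y) * Y) = X * X * (X + Y) + (n * n + n + 7) := by exact_mod_cast hF
      rw [show (X : ℝ) ^ 2 * (X + Y) - Y * (n * X ^ 2 + ((n + 2) * X + Y) * Y) = -((n : ℝ) ^ 2 + n + 7) by linarith, abs_neg]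
      exact abs_of_nonneg (by positivity)
  have hkey := h.key
  have hY0 : (0 : ℝ) < Y := by linarith
  have hq : 0.77 * (Y : ℝ) ^ 2 * (ρ ^ 2 + (ρ + 1 - n) * ρ + 1 / ρ) ≤ ((X : ℝ) ^ 2 + (ρ + 1 - n) * X * Y + (Y : ℝ) ^ 2 / ρ) := by
    have e1 : (0.88 * (ρ * Y)) ^ 2 ≤ (X : ℝ) ^ 2 := pow_le_pow_left₀ (by positivity) hXlo 2
    have e2 : (ρ + 1 - n) * (0.88 * (ρ * Y)) * Y ≤ (ρ + 1 - n) * X * Y := by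
      apply mul_le_mul_of_nonneg_right _ hY0.le
      apply mul_le_mul_of_nonneg_left hXlo; linarith
    have e3 : 0 ≤ (Y : ℝ) ^ 2 / ρ := by positivity
    have e4 : 0 ≤ (ρ + 1 - n) * (ρ * Y) * Y := by
      have : 0 ≤ ρ + 1 - n := by linarith
      positivity
    have e5 : 0 ≤ (ρ * Y) ^ 2 := by positivity
    have : 0.77 * (Y : ℝ) ^ 2 * (ρ ^ 2 + (ρ + 1 - n) * ρ + 1 / ρ) = 0.77 * (ρ * Y) ^ 2 + 0.77 * ((ρ + 1 - n) * (ρ * Y) * Y) + 0.77 * ((Y : ℝ) ^ 2 / ρ) := by ring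
    rw [this]
    linarith
  set K := ρ ^ 2 + (ρ + 1 - n) * ρ + 1 / ρ
  set η := |(X : ℝ) - ρ * Y|
  have hK : 0 < K := by
    have : (0 : ℝ) ≤ (n : ℝ) ^ 2 + n + 7 := by positivity
    linarith
  have h1 : η * (0.77 * (Y : ℝ) ^ 2 * K) ≤ (n : ℝ) ^ 2 + n + 7 := by rw [← hD]; exact mul_le_mul_of_nonneg_left hq hη0
  have h2 : η * (0.77 * (Y : ℝ) ^ 2 * K) < 1.9 * K := by linarith
  have h3 : η * (0.77 * (Y : ℝ) ^ 2) < 1.9 := by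
    refine lt_of_mul_lt_mul_right ?_ hK.le
    linarith
  have h4 : η * Y * 5 ≤ η * Y * Y := mul_le_mul_of_nonneg_left hYr (by positivity)
  nlinarith

theorem chkR_spec (S n R : ℕ) (ρ : ℝ) (hS : 0 < S) (hb : BR n ρ) (h : chkR S n R = true) :
    (R : ℝ) < ρ * S ∧ ρ * S < R + 4 := by
  have e : chkR S n R = (Nat.ble 3 R && Nat.ble (fA R S + 1) (fB n R S) && Nat.ble (fB n (R + 4) S + 1) (fA (R + 4) S)) := rfl
  rw [e] at h
  simp only [Bool.and_eq_true, Nat.ble_eq] at h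
  obtain ⟨⟨_, h1⟩, h2⟩ := h
  have hlo := hb.lo
  have hgt := hb.gt
  have hSr : (0 : ℝ) < S := by exact_mod_cast hS
  have hq : ∀ X : ℝ, 0 ≤ X → 0 < (X ^ 2 + (ρ + 1 - n) * X * S + (S : ℝ) ^ 2 / ρ) := by
    intro X hX
    have : 0 ≤ ρ + 1 - n := by linarith
    have : 0 < (S : ℝ) ^ 2 / ρ := by apply div_pos <;> positivity
    positivity
  rw [fA_eq, fB_eq] at h1 h2
  constructor
  · have hf := hb.fact R S
    have h1r : (R : ℝ) * R * (R + S) + 1 ≤ S * (n * (R * R) + ((n + 2) * R + S) * S) := by exact_mod_cast h1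
    by_contra hc
    push Not at hc
    have : 0 ≤ ((R : ℝ) - ρ * S) * ((R : ℝ) ^ 2 + (ρ + 1 - n) * R * S + (S : ℝ) ^ 2 / ρ) :=
      mul_nonneg (by linarith) (hq R (by positivity)).le
    linarith
  · have hf := hb.fact (R + 4) S
    have h1r : (S : ℝ) * (n * ((R + 4) * (R + 4)) + ((n + 2) * (R + 4) + S) * S) + 1 ≤ (R + 4) * (R + 4) * ((R + 4) + S) := by exact_mod_cast h2
    by_contra hc
    push Not at hc
    have : ((R : ℝ) + 4 - ρ * S) * (((R : ℝ) + 4) ^ 2 + (ρ + 1 - n) * (R + 4) * S + (S : ℝ) ^ 2 / ρ) ≤ 0 :=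
      mul_nonpos_of_nonpos_of_nonneg (by linarith) (hq (R + 4) (by positivity)).le
    linarith

theorem small_rng (S R X Y c : ℕ) (ρ : ℝ) (hS : 1000 ≤ S) (hY : Y ≤ 4) (h1 : (R : ℝ) < ρ * S) (h2 : ρ * S < R + 4)
    (hX : |X - ρ * Y| < c + 1) : Y * R / S - c ≤ X ∧ X < Y * R / S - c + (2 * c + 3) := by
  have hSr : (1000 : ℝ) ≤ S := by exact_mod_cast hS
  have hYr : (Y : ℝ) ≤ 4 := by exact_mod_cast hY
  have hY0 : (0 : ℝ) ≤ Y := by positivity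
  obtain ⟨q, hq⟩ : ∃ q, q = Y * R / S := ⟨_, rfl⟩
  have hq1 : q * S ≤ Y * R := by rw [hq]; exact Nat.div_mul_le_self _ _
  have hq2 : Y * R < (q + 1) * S := by
    rw [hq, add_mul, one_mul]; exact Nat.lt_div_mul_add (by omega)
  have hq1r : (q : ℝ) * S ≤ Y * R := by exact_mod_cast hq1
  have hq2r : (Y : ℝ) * R < (q + 1) * S := by exact_mod_cast hq2
  rw [← hq]
  obtain ⟨ha, hb⟩ := abs_lt.mp hX
  have k1 : (Y : ℝ) * R ≤ Y * (ρ * S) := mul_le_mul_of_nonneg_left h1.le hY0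
  have k2 : (Y : ℝ) * (ρ * S) ≤ Y * (R + 4) := mul_le_mul_of_nonneg_left h2.le hY0
  have l1 : (q : ℝ) ≤ ρ * Y := by
    refine le_of_mul_le_mul_right (a := (S : ℝ)) ?_ (by linarith)
    linarith
  have l2 : ρ * Y < q + 2 := by
    refine lt_of_mul_lt_mul_right (a := (S : ℝ)) ?_ (by linarith)
    linarith
  have r1 : (q : ℝ) < X + c + 1 := by linarith
  have r2 : (X : ℝ) < q + c + 3 := by linarith
  have r1' : q < X + c + 1 := by exact_mod_cast r1
  have r2' : X < q + c + 3 := by exact_mod_cast r2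
  omega

theorem chkS_eq (S n D R : ℕ) : chkS S n D R = (smallN n D 1 39 (R / S - 18) && smallN n D 2 11 (2 * R / S - 4) && smallN n D 3 7 (3 * R / S - 2)
    && smallN n D 4 5 (4 * R / S - 1)) := rfl

theorem chkC_eq (S n D R : ℕ) : chkC S n D R = (Nat.ble 4 (R - R / S * S) && convN n D 1000000000000 60 (R / S) 1 (R - R / S * S)
    (R / S * (S / (R - R / S * S)) + 1) (S / (R - R / S * S)) (S - S / (R - R / S * S) * (R - R / S * S))) := by
  show (force (R / S) fun a => force (R - a * S) fun r => force (S / r) fun a' => force (a * a' + 1) fun P' => force (S - a' * r) fun r' =>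
    Nat.ble 4 r && convN n D 1000000000000 60 a 1 r P' a' r') = _
  simp only [force_eq]

theorem chk_tail2 (S n R X Y : ℕ) (ρ : ℝ) (a r b : ℕ) (hS : 1000 ≤ S) (hb : BR n ρ) (h1 : (R : ℝ) < ρ * S) (h2 : ρ * S < R + 4)
    (hr : R = a * S + r) (hmod : r < S) (c1 : 4 ≤ r) (hpos : 0 < b) (hle2 : b * r ≤ S)
    (c2 : convN n (n * n + n + 7) 1000000000000 60 a 1 r (a * b + 1) b (S - b * r) = true)
    (hge : 5 ≤ Y) (hYb : Y < 1000000000000) (hη : |X - ρ * Y| * (Y : ℝ) ^ 2 ≤ 18)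
    (hF : fA X Y = fB n X Y + (n * n + n + 7) ∨ fB n X Y = fA X Y + (n * n + n + 7)) : False := by
  have hRe : (R : ℤ) = a * S + r := by exact_mod_cast hr
  have hS0 : 0 < S := by omega
  have he := hb.herr hge hη hF
  generalize 1000000000000 = B at *
  generalize 60 = k at *
  have hD : 0 < n * n + n + 7 := by omega
  generalize n * n + n + 7 = D at *
  refine convN_spec S R n D B X Y ρ hS0 ?_ h1 h2 hge ?_
      he hF k _ _ _ _ _ _ (-1) (by norm_num) ?_ ?_ ?_ ?_ ?_ hpos ?_ c2
  · omega
  · omega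
  · push_cast; rw [hRe]; ring
  · push_cast [Nat.cast_sub hle2]; rw [hRe]; ring
  · push_cast; ring
  · omega
  · norm_num
  · omega

theorem chk_tail (S n R X Y : ℕ) (ρ : ℝ) (a : ℕ) (hS : 1000 ≤ S) (hb : BR n ρ) (h1 : (R : ℝ) < ρ * S) (h2 : ρ * S < R + 4)
    (hle : a * S ≤ R) (hmod : R - a * S < S) (c1 : 4 ≤ R - a * S)
    (c2 : convN n (n * n + n + 7) 1000000000000 60 a 1 (R - a * S)
    (a * (S / (R - a * S)) + 1) (S / (R - a * S)) (S - S / (R - a * S) * (R - a * S)) = true)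
    (hge : 5 ≤ Y) (hYb : Y < 1000000000000) (hη : |X - ρ * Y| * (Y : ℝ) ^ 2 ≤ 18)
    (hF : fA X Y = fB n X Y + (n * n + n + 7) ∨ fB n X Y = fA X Y + (n * n + n + 7)) : False := by
  obtain ⟨r, hr⟩ : ∃ r, r = R - a * S := ⟨_, rfl⟩
  rw [← hr] at hmod c1 c2
  exact chk_tail2 S n R X Y ρ a r (S / r) hS hb h1 h2 (by omega) hmod c1 (Nat.div_pos hmod.le (by omega)) (Nat.div_mul_le_self _ _) c2
    hge hYb hη hF

theorem chk_small (S n R X Y : ℕ) (ρ : ℝ) (hS : 1000 ≤ S) (hb : BR n ρ) (h1 : (R : ℝ) < ρ * S) (h2 : ρ * S < R + 4)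
    (hcS : chkS S n (n * n + n + 7) R = true) (hcC : chkC S n (n * n + n + 7) R = true)
    (hY : 1 ≤ Y) (hYb : Y < 10 ^ 12) (hη : |X - ρ * Y| * (Y : ℝ) ^ 2 ≤ 18)
    (hF : fA X Y = fB n X Y + (n * n + n + 7) ∨ fB n X Y = fA X Y + (n * n + n + 7)) :
    (fA X Y = fB n X Y + (n * n + n + 7) ∧ ((n = 0 ∧ X = 2 ∧ Y = 1) ∨ (n = 6 ∧ X = 19 ∧ Y = 3))) ∨
    (fB n X Y = fA X Y + (n * n + n + 7) ∧ ((n = 2 ∧ X = 5 ∧ Y = 2) ∨ (n = 6 ∧ X = 4 ∧ Y = 1) ∨ (n = 13 ∧ X = 4 ∧ Y = 1))) := by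
  have fin : ∀ k x0, smallN n (n * n + n + 7) Y k x0 = true → x0 ≤ X → X < x0 + k →
     ((fA X Y = fB n X Y + (n * n + n + 7) ∧ ((n = 0 ∧ X = 2 ∧ Y = 1) ∨ (n = 6 ∧ X = 19 ∧ Y = 3))) ∨
    (fB n X Y = fA X Y + (n * n + n + 7) ∧ ((n = 2 ∧ X = 5 ∧ Y = 2) ∨ (n = 6 ∧ X = 4 ∧ Y = 1) ∨ (n = 13 ∧ X = 4 ∧ Y = 1)))) := by
    intro k x0 h a b
    have := smallN_spec n (n * n + n + 7) Y k x0 h X a b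
    rcases hF with h | h
    · exact Or.inl ⟨h, this.1 h⟩
    · exact Or.inr ⟨h, this.2 h⟩
  rw [chkS_eq] at hcS
  simp only [Bool.and_eq_true] at hcS
  obtain ⟨⟨⟨s1, s2⟩, s3⟩, s4⟩ := hcS
  have hη0 : 0 ≤ |X - ρ * Y| := abs_nonneg _
  rcases Nat.lt_or_ge Y 5 with hlt | hge
  · have hY1234 : Y = 1 ∨ Y = 2 ∨ Y = 3 ∨ Y = 4 := by omega
    rcases hY1234 with rfl | rfl | rfl | rfl
    · have := small_rng S R X 1 18 ρ hS (by norm_num) h1 h2 (by push_cast at hη ⊢; linarith)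
      rw [one_mul] at this
      exact fin _ _ s1 this.1 this.2
    · have := small_rng S R X 2 4 ρ hS (by norm_num) h1 h2 (by push_cast at hη ⊢; linarith)
      exact fin _ _ s2 this.1 this.2
    · have := small_rng S R X 3 2 ρ hS (by norm_num) h1 h2 (by push_cast at hη ⊢; linarith)
      exact fin _ _ s3 this.1 this.2
    · have := small_rng S R X 4 1 ρ hS (by norm_num) h1 h2 (by push_cast at hη ⊢; linarith)
      exact fin _ _ s4 this.1 this.2
  · exfalso
    rw [chkC_eq] at hcC
    simp only [Bool.and_eq_true, Nat.ble_eq] at hcC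
    obtain ⟨c1, c2⟩ := hcC
    have hle : R / S * S ≤ R := Nat.div_mul_le_self _ _
    have hmod : R - R / S * S < S := by
      have := Nat.lt_div_mul_add (a := R) (b := S) (by omega)
      omega
    exact chk_tail S n R X Y ρ (R / S) hS hb h1 h2 hle hmod c1 c2 hge (by norm_num at hYb; exact hYb) hη hF
end

section
theorem zdiv0 (S N K : ℕ) (ρ b : ℝ) (hS : 0 < S) (hb : 1 ≤ b) (hρ : b ≤ ρ)
    (h1 : (N : ℝ) ≤ S * (ρ - b)) (h2 : S * (ρ - b) ≤ N + 4) (h3 : S * (ρ + b) ≤ K) (h4 : (K : ℝ) ≤ S * (ρ + b) + 4) :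
    ((N * S / K : ℕ) : ℝ) ≤ S * ((ρ - b) / (ρ + b)) ∧ S * ((ρ - b) / (ρ + b)) ≤ ((N * S / K : ℕ) : ℝ) + 8 := by
  have hSr : (0 : ℝ) < S := by exact_mod_cast hS
  have hs : 2 ≤ ρ + b := by linarith
  have hs0 : 0 < ρ + b := by linarith
  have hSs : 0 < S * (ρ + b) := by positivity
  have hK : (0 : ℝ) < K := by linarith
  have hKn : 0 < K := by exact_mod_cast hK
  have q1 : ((N * S / K : ℕ) : ℝ) * K ≤ N * S := by exact_mod_cast Nat.div_mul_le_self _ _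
  have q2 : (N : ℝ) * S < ((N * S / K : ℕ) : ℝ) * K + K := by exact_mod_cast Nat.lt_div_mul_add hKn
  generalize ((N * S / K : ℕ) : ℝ) = Z at *
  constructor
  · rw [← mul_div_assoc, le_div_iff₀ hs0]
    have e1 : Z * K ≤ S * (ρ - b) * S := q1.trans (mul_le_mul_of_nonneg_right h1 hSr.le)
    by_cases hZ : 0 ≤ Z
    · have e2 : Z * (S * (ρ + b)) ≤ Z * K := mul_le_mul_of_nonneg_left h3 hZ
      refine le_of_mul_le_mul_right (a := (S : ℝ)) ?_ hSr
      linarith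
    · push Not at hZ
      have : Z * (ρ + b) ≤ 0 := mul_nonpos_of_nonpos_of_nonneg hZ.le hs0.le
      have : 0 ≤ S * (ρ - b) := mul_nonneg hSr.le (by linarith)
      linarith
  · rw [← mul_div_assoc, div_le_iff₀ hs0]
    refine h2.trans ?_
    refine le_of_mul_le_mul_right (a := (K : ℝ)) ?_ hK
    have e1 : (N : ℝ) * S * (ρ + b) ≤ (Z * K + K) * (ρ + b) := mul_le_mul_of_nonneg_right q2.le hs0.le
    have e2 : (N : ℝ) * K ≤ N * (S * (ρ + b) + 4) := mul_le_mul_of_nonneg_left h4 (by positivity)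
    have e3 : (N : ℝ) ≤ K := by
      have : S * (ρ - b) ≤ S * (ρ + b) := mul_le_mul_of_nonneg_left (by linarith) hSr.le
      linarith
    have e4 : 2 * (K : ℝ) ≤ (ρ + b) * K := mul_le_mul_of_nonneg_right hs hK.le
    linarith

theorem zdiv2 (S K : ℕ) (ρ : ℝ) (hS : 0 < S) (hρ : 1 ≤ ρ)
    (h3 : S * (2 * ρ + 1) ≤ K) (h4 : (K : ℝ) ≤ S * (2 * ρ + 1) + 8) :
    ((S * S / K : ℕ) : ℝ) ≤ S * (1 / (2 * ρ + 1)) ∧ S * (1 / (2 * ρ + 1)) ≤ ((S * S / K : ℕ) : ℝ) + 8 := by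
  have hSr : (0 : ℝ) < S := by exact_mod_cast hS
  have hs0 : 0 < 2 * ρ + 1 := by linarith
  have hSs : 0 < S * (2 * ρ + 1) := by positivity
  have hK : (0 : ℝ) < K := by linarith
  have hKn : 0 < K := by exact_mod_cast hK
  have q1 : ((S * S / K : ℕ) : ℝ) * K ≤ S * S := by exact_mod_cast Nat.div_mul_le_self _ _
  have q2 : (S : ℝ) * S < ((S * S / K : ℕ) : ℝ) * K + K := by exact_mod_cast Nat.lt_div_mul_add hKn
  have q0 : (0 : ℝ) ≤ ((S * S / K : ℕ) : ℝ) := by positivity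
  generalize ((S * S / K : ℕ) : ℝ) = Z at *
  constructor
  · rw [← mul_div_assoc, mul_one, le_div_iff₀ hs0]
    have e2 : Z * (S * (2 * ρ + 1)) ≤ Z * K := mul_le_mul_of_nonneg_left h3 q0
    refine le_of_mul_le_mul_right (a := (S : ℝ)) ?_ hSr
    linarith
  · rw [← mul_div_assoc, mul_one, div_le_iff₀ hs0]
    refine le_of_mul_le_mul_right (a := (K : ℝ)) ?_ hK
    have e1 : (S : ℝ) * S * (2 * ρ + 1) ≤ (Z * K + K) * (2 * ρ + 1) := mul_le_mul_of_nonneg_right q2.le hs0.le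
    have e2 : (S : ℝ) * K ≤ S * (S * (2 * ρ + 1) + 8) := mul_le_mul_of_nonneg_left h4 hSr.le
    have e4 : 3 * (K : ℝ) ≤ (2 * ρ + 1) * K := mul_le_mul_of_nonneg_right (by linarith) hK.le
    have e5 : S * 3 ≤ S * (2 * ρ + 1) := mul_le_mul_of_nonneg_left (by linarith) hSr.le
    linarith

theorem log_v0 (ρ b : ℝ) (hb : 1 ≤ b) (hρ : b ≤ ρ) :
    Real.log ρ = Real.log b + (Real.log (1 + (ρ - b) / (ρ + b)) - Real.log (1 - (ρ - b) / (ρ + b))) := by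
  have hs : ρ + b ≠ 0 := by linarith
  rw [show 1 + (ρ - b) / (ρ + b) = 2 * ρ / (ρ + b) by field_simp; ring, show 1 - (ρ - b) / (ρ + b) = 2 * b / (ρ + b) by field_simp; ring]
  rw [Real.log_div (by linarith) hs, Real.log_div (by linarith) hs, Real.log_mul (by norm_num) (by linarith), Real.log_mul (by norm_num) (by linarith)]
  ring

theorem log_v2 (ρ : ℝ) (hρ : 1 ≤ ρ) :
    Real.log (1 + 1 / ρ) = (Real.log (1 + 1 / (2 * ρ + 1)) - Real.log (1 - 1 / (2 * ρ + 1))) := by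
  have hs : 2 * ρ + 1 ≠ 0 := by linarith
  have h0 : ρ ≠ 0 := by linarith
  rw [show 1 + 1 / ρ = (ρ + 1) / ρ by field_simp, show 1 + 1 / (2 * ρ + 1) = 2 * (ρ + 1) / (2 * ρ + 1) by field_simp; ring, show 1 - 1 / (2 * ρ + 1) = 2 * ρ / (2 * ρ + 1) by field_simp; ring]
  rw [Real.log_div (by linarith) h0, Real.log_div (by linarith) hs, Real.log_div (by linarith) hs, Real.log_mul (by norm_num) (by linarith), Real.log_mul (by norm_num) (by linarith)]
  ring

theorem chkF_eq (S R b L T : ℕ) : chkF S R b L T = farN 604462909807314587353088 8388608 T 80 0 1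
    (L + laN S ((R - b * S) * S / (R + b * S + 4))) 1 0 (laN S (S * S / (2 * R + 8 + S))) := by
  show (force (L + laN S ((R - b * S) * S / (R + b * S + 4))) fun L0 => force (laN S (S * S / (2 * R + 8 + S))) fun L2 =>
    farN 604462909807314587353088 8388608 T 80 0 1 L0 1 0 L2) = _
  simp only [force_eq]

theorem chkF_spec (S T R b L P Q : ℕ) (ρ : ℝ) (hS : S = 2 ^ 220) (hb1 : 1 ≤ b) (hb2 : b ≤ 5000) (hbρ : (b : ℝ) ≤ ρ) (hρ3 : ρ ≤ 3 * b)
    (hR1 : (R : ℝ) < ρ * S) (hR2 : ρ * S < R + 4) (hL1 : (L : ℝ) ≤ S * Real.log b) (hL2 : S * Real.log b ≤ L + 1000 * b)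
    (hP : 0 < P) (hQ : 0 < Q) (hPB : P < 2 ^ 79) (hQB : Q < 2 ^ 79)
    (h : chkF S R b L T = true) : (T : ℝ) / S ≤ |P * Real.log (1 + 1 / ρ) - Q * Real.log ρ| := by
  rw [chkF_eq] at h
  have hS0 : 0 < S := by rw [hS]; positivity
  have hS8 : 1000 ≤ S := by rw [hS]; norm_num
  have hSr : (0 : ℝ) < S := by exact_mod_cast hS0
  have hb1r : (1 : ℝ) ≤ b := by exact_mod_cast hb1
  have hb2r : (b : ℝ) ≤ 5000 := by exact_mod_cast hb2
  have hN1 : ((R - b * S : ℕ) : ℝ) ≤ S * (ρ - b) := by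
    rcases le_total (b * S) R with hh | hh
    · rw [Nat.cast_sub hh]; push_cast; linarith
    · rw [Nat.sub_eq_zero_of_le hh]; push_cast; exact mul_nonneg hSr.le (by linarith)
  have hN2 : S * (ρ - b) ≤ ((R - b * S : ℕ) : ℝ) + 4 := by
    have : R ≤ (R - b * S) + b * S := by omega
    have : (R : ℝ) ≤ ((R - b * S : ℕ) : ℝ) + b * S := by exact_mod_cast this
    linarith
  obtain ⟨z1, z2⟩ := zdiv0 S (R - b * S) (R + b * S + 4) ρ b hS0 hb1r hbρ hN1 hN2 (by push_cast; linarith) (by push_cast; linarith)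
  obtain ⟨w1, w2⟩ := zdiv2 S (2 * R + 8 + S) ρ hS0 (by linarith) (by push_cast; linarith) (by push_cast; linarith)
  have hv0 : (ρ - b) / (ρ + b) ≤ 1 / 2 := by rw [div_le_iff₀ (by linarith)]; linarith
  have hv2 : 1 / (2 * ρ + 1) ≤ 1 / 2 := by rw [div_le_iff₀ (by linarith)]; linarith
  have k0 := la_close S ((R - b * S) * S / (R + b * S + 4)) _ hS (by
    have : (2 : ℝ) * (((R - b * S) * S / (R + b * S + 4) : ℕ) : ℝ) ≤ S := by
      have := mul_le_mul_of_nonneg_left hv0 hSr.le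
      linarith
    exact_mod_cast this) z1 z2
  have k2 := la_close S (S * S / (2 * R + 8 + S)) _ hS (by
    have : (2 : ℝ) * ((S * S / (2 * R + 8 + S) : ℕ) : ℝ) ≤ S := by
      have := mul_le_mul_of_nonneg_left hv2 hSr.le
      linarith
    exact_mod_cast this) w1 w2
  have l0 := log_v0 ρ b hb1r hbρ
  have l2 := log_v2 ρ (by linarith)
  generalize laN S ((R - b * S) * S / (R + b * S + 4)) = A0 at *
  generalize laN S (S * S / (2 * R + 8 + S)) = A2 at *
  rw [← l2] at k2
  have k0' : (A0 : ℝ) ≤ S * (Real.log ρ - Real.log b) ∧ S * (Real.log ρ - Real.log b) ≤ A0 + 1000 := by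
    rw [l0, add_sub_cancel_left]; exact k0
  refine farN_spec S 604462909807314587353088 8388608 T (L + A0) A2 P Q (Real.log ρ) (Real.log (1 + 1 / ρ)) hS0 hP hQ
    (by norm_num at hPB; exact hPB) (by norm_num at hQB; exact hQB) ?_ ?_ k2.1 ?_ 80 0 1 _ 1 0 _ (-1) (by norm_num) (by push_cast; ring) (by push_cast; ring) (by norm_num) h
  · push_cast; linarith [k0'.1]
  · push_cast; linarith [k0'.2]
  · push_cast; linarith [k2.2]

theorem chk1_eq (S T n b L : ℕ) : ∃ R, chk1 S T n b L = (chkR S n R && chkS S n (n * n + n + 7) R && chkC S n (n * n + n + 7) R && chkF S R b L T) := by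
  refine ⟨newtN S n 9 ((n + 2) * S) - 2, ?_⟩
  show (force (newtN S n 9 ((n + 2) * S) - 2) fun R => force (n * n + n + 7) fun D =>
    chkR S n R && chkS S n D R && chkC S n D R && chkF S R b L T) = _
  simp only [force_eq]

theorem runN_succ (S T k n L : ℕ) : runN S T (k + 1) n L = ifb (chk1 S T n n L) (runN S T k (n + 1) (L + laN S (S / (2 * n + 1)))) 0 := by
  show ifb (chk1 S T n n L) (force (L + laN S (S / (2 * n + 1))) fun L' => force (Nat.succ n) fun n' => runN S T k n' L') 0 = _
  simp only [force_eq, Nat.succ_eq_add_one]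

theorem log_step (S n L : ℕ) (hS : S = 2 ^ 220) (hn : 1 ≤ n) (h1 : (L : ℝ) ≤ S * Real.log n) (h2 : S * Real.log n ≤ L + 1000 * n) :
    ((L + laN S (S / (2 * n + 1)) : ℕ) : ℝ) ≤ S * Real.log ((n + 1 : ℕ) : ℝ) ∧
     S * Real.log ((n + 1 : ℕ) : ℝ) ≤ ((L + laN S (S / (2 * n + 1)) : ℕ) : ℝ) + 1000 * ((n + 1 : ℕ) : ℝ) := by
  have hnr : (1 : ℝ) ≤ n := by exact_mod_cast hn
  have hS0 : 0 < S := by rw [hS]; positivity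
  have hSr : (0 : ℝ) < S := by exact_mod_cast hS0
  have q1 : ((S / (2 * n + 1) : ℕ) : ℝ) * (2 * n + 1) ≤ S := by exact_mod_cast Nat.div_mul_le_self _ _
  have q2 : (S : ℝ) < ((S / (2 * n + 1) : ℕ) : ℝ) * (2 * n + 1) + (2 * n + 1) := by exact_mod_cast Nat.lt_div_mul_add (by omega)
  have k := la_close S (S / (2 * n + 1)) (1 / (2 * (n : ℝ) + 1)) hS (by
      have := Nat.div_mul_le_self S (2 * n + 1)
      nlinarith [Nat.zero_le (S / (2 * n + 1))])
    (by rw [← mul_div_assoc, mul_one, le_div_iff₀ (by linarith)]; exact q1)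
    (by rw [← mul_div_assoc, mul_one, div_le_iff₀ (by linarith)]; linarith)
  rw [← log_v2 n hnr, show (1 : ℝ) + 1 / n = (n + 1) / n by field_simp, Real.log_div (by linarith) (by linarith)] at k
  push_cast
  constructor <;> linarith [k.1, k.2]

theorem runN_spec (S T : ℕ) (hS : S = 2 ^ 220) (k : ℕ) : ∀ n L : ℕ, 1 ≤ n → (L : ℝ) ≤ S * Real.log n → S * Real.log n ≤ L + 1000 * n → ∀ M, runN S T k n L = M → M ≠ 0 →
    ((∀ j : ℕ, n ≤ j → j < n + k → ∃ L' : ℕ, (L' : ℝ) ≤ S * Real.log j ∧ S * Real.log j ≤ L' + 1000 * j ∧ chk1 S T j j L' = true) ∧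
      (M : ℝ) ≤ S * Real.log ((n + k : ℕ) : ℝ) ∧ S * Real.log ((n + k : ℕ) : ℝ) ≤ M + 1000 * ((n + k : ℕ) : ℝ)) := by
  induction k with
  | zero => intro n L _ h1 h2 M hM _; refine ⟨fun j _ _ => by omega, ?_⟩; rw [add_zero]; rw [← hM]; exact ⟨h1, h2⟩
  | succ k ih =>
    intro n L hn h1 h2 M hM hM0
    rw [runN_succ] at hM
    cases hc : chk1 S T n n L with
    | false => rw [hc] at hM; exact absurd hM.symm hM0
    | true =>
      rw [hc, ifb_true] at hM
      have hl := log_step S n L hS hn h1 h2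
      have := ih (n + 1) _ (by omega) hl.1 hl.2 M hM hM0
      rw [show n + (k + 1) = n + 1 + k by omega]
      refine ⟨fun j hj1 hj2 => ?_, this.2⟩
      rcases Nat.eq_or_lt_of_le hj1 with rfl | hlt
      · exact ⟨L, h1, h2, hc⟩
      · exact this.1 j hlt (by omega)
end

/-- scaling factor (2 ^ 220) and threshold for the machine check -/
local notation "Sk" => 1684996666696914987166688442938726917102321526408785780068975640576
local notation "Tk" => 1684996666696914987166688442938726918

def CI (n L : ℕ) : Prop := 1 ≤ n ∧ (L : ℝ) ≤ ((Sk : ℕ) : ℝ) * Real.log n ∧ ((Sk : ℕ) : ℝ) * Real.log n ≤ L + 1000 * n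
def CJ (a b : ℕ) : Prop := ∀ j : ℕ, a ≤ j → j < b → ∃ L' : ℕ, CI j L' ∧ chk1 Sk Tk j j L' = true

theorem chunk_step (k n N L M : ℕ) (hJ : CJ 1 n ∧ CI n L) (h : runN Sk Tk k n L = M) (hN : n + k = N) (hM : Nat.beq M 0 = false) : CJ 1 N ∧ CI N M := by
  have hM0 : M ≠ 0 := by rintro rfl; simp at hM
  obtain ⟨hJ, hI⟩ := hJ
  obtain ⟨r1, r2, r3⟩ := runN_spec Sk Tk (by norm_num) k n L hI.1 hI.2.1 hI.2.2 M h hM0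
  rw [hN] at r1 r2 r3
  have := hI.1
  refine ⟨fun j hj1 hj2 => ?_, by omega, r2, r3⟩
  rcases Nat.lt_or_ge j n with hlt | hge
  · exact hJ j hj1 hlt
  · obtain ⟨L', a, b, c⟩ := r1 j hge hj2
    exact ⟨L', ⟨hj1, a, b⟩, c⟩

theorem chunk_zero : CJ 1 1 ∧ CI 1 0 := by
  refine ⟨fun j _ _ => by omega, le_refl _, ?_, ?_⟩ <;> norm_num

theorem chunk_n0 : chk1 Sk Tk 0 1 0 = true := by decide +kernel

theorem chunk_run0 : runN Sk Tk 250 1 0 = 9310369784427727747076007580271643960860841805445829578160640193286 := by decide +kernel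
theorem chunk_run1 : runN Sk Tk 250 251 9310369784427727747076007580271643960860841805445829578160640193286 = 10474960558495702129952345195677329744433730142000675572968909223490 := by decide +kernel
theorem chunk_run2 : runN Sk Tk 250 501 10474960558495702129952345195677329744433730142000675572968909223490 = 11157046452070680897269943026466427844987746871617599786436145013034 := by decide +kernel
theorem chunk_run3 : runN Sk Tk 250 751 11157046452070680897269943026466427844987746871617599786436145013034 = 11641228774172527197515853914378313739202271850064184251534537640312 := by decide +kernel
theorem chunk_run4 : runN Sk Tk 250 1001 11641228774172527197515853914378313739202271850064184251534537640312 = 12016888218024098950082076807097022925110154122084324383546270671400 := by decide +kernel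
theorem chunk_run5 : runN Sk Tk 250 1251 12016888218024098950082076807097022925110154122084324383546270671400 = 12323874931900844074240914951788082217053099967659076323058564525284 := by decide +kernel
theorem chunk_run6 : runN Sk Tk 250 1501 12323874931900844074240914951788082217053099967659076323058564525284 = 12583457936986445462602053239873895881797562867622088557072775226300 := by decide +kernel
theorem chunk_run7 : runN Sk Tk 250 1751 12583457936986445462602053239873895881797562867622088557072775226300 = 12808337595995738503102251368569707687904647404078093370138144080098 := by decide +kernel
theorem chunk_run8 : runN Sk Tk 250 2001 12808337595995738503102251368569707687904647404078093370138144080098 = 13006708051728531519207367024753417626888410185544990320329270475286 := by decide +kernel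
theorem chunk_run9 : runN Sk Tk 250 2251 13006708051728531519207367024753417626888410185544990320329270475286 = 13184165312279028193183688983642416174614944076692133476984580529434 := by decide +kernel
theorem chunk_run10 : runN Sk Tk 250 2501 13184165312279028193183688983642416174614944076692133476984580529434 = 13344701398331596574012287258000769981156460616905368495475106520386 := by decide +kernel
theorem chunk_run11 : runN Sk Tk 250 2751 13344701398331596574012287258000769981156460616905368495475106520386 = 13491264235806389706936081992757125426093361764127780404306325638766 := by decide +kernel
theorem chunk_run12 : runN Sk Tk 250 3001 13491264235806389706936081992757125426093361764127780404306325638766 = 13626092740230289122154715439525344317940226197232562515067679242748 := by decide +kernel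
theorem chunk_run13 : runN Sk Tk 250 3251 13626092740230289122154715439525344317940226197232562515067679242748 = 13750927404375725760438520516943591548022709662357173221476196251312 := by decide +kernel
theorem chunk_run14 : runN Sk Tk 250 3501 13750927404375725760438520516943591548022709662357173221476196251312 = 13867148076544416839950036610962697842034578858194585736748449268244 := by decide +kernel
theorem chunk_run15 : runN Sk Tk 250 3751 13867148076544416839950036610962697842034578858194585736748449268244 = 13975867193509966797376732288085488793152258914759442932386885356710 := by decide +kernel
theorem chunk_run16 : runN Sk Tk 250 4001 13975867193509966797376732288085488793152258914759442932386885356710 = 14077994705838855483915615826622400075331809880469103714483063652030 := by decide +kernel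
theorem chunk_run17 : runN Sk Tk 250 4251 14077994705838855483915615826622400075331809880469103714483063652030 = 14174284421570131142072144103101943489961031021706590527766337383700 := by decide +kernel
theorem chunk_run18 : runN Sk Tk 250 4501 14174284421570131142072144103101943489961031021706590527766337383700 = 14265367805888044096522865005432040055399452126443490360970671151976 := by decide +kernel
theorem chunk_run19 : runN Sk Tk 250 4751 14265367805888044096522865005432040055399452126443490360970671151976 = 14351779102787918165482512940777627238193091233095446144259251416132 := by decide +kernel

theorem chunk_all : CJ 1 5001 := by
  have h0 := chunk_step 250 1 251 _ _ chunk_zero chunk_run0 rfl rfl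
  have h1 := chunk_step 250 251 501 _ _ h0 chunk_run1 rfl rfl
  have h2 := chunk_step 250 501 751 _ _ h1 chunk_run2 rfl rfl
  have h3 := chunk_step 250 751 1001 _ _ h2 chunk_run3 rfl rfl
  have h4 := chunk_step 250 1001 1251 _ _ h3 chunk_run4 rfl rfl
  have h5 := chunk_step 250 1251 1501 _ _ h4 chunk_run5 rfl rfl
  have h6 := chunk_step 250 1501 1751 _ _ h5 chunk_run6 rfl rfl
  have h7 := chunk_step 250 1751 2001 _ _ h6 chunk_run7 rfl rfl
  have h8 := chunk_step 250 2001 2251 _ _ h7 chunk_run8 rfl rfl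
  have h9 := chunk_step 250 2251 2501 _ _ h8 chunk_run9 rfl rfl
  have h10 := chunk_step 250 2501 2751 _ _ h9 chunk_run10 rfl rfl
  have h11 := chunk_step 250 2751 3001 _ _ h10 chunk_run11 rfl rfl
  have h12 := chunk_step 250 3001 3251 _ _ h11 chunk_run12 rfl rfl
  have h13 := chunk_step 250 3251 3501 _ _ h12 chunk_run13 rfl rfl
  have h14 := chunk_step 250 3501 3751 _ _ h13 chunk_run14 rfl rfl
  have h15 := chunk_step 250 3751 4001 _ _ h14 chunk_run15 rfl rfl
  have h16 := chunk_step 250 4001 4251 _ _ h15 chunk_run16 rfl rfl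
  have h17 := chunk_step 250 4251 4501 _ _ h16 chunk_run17 rfl rfl
  have h18 := chunk_step 250 4501 4751 _ _ h17 chunk_run18 rfl rfl
  have h19 := chunk_step 250 4751 5001 _ _ h18 chunk_run19 rfl rfl
  exact h19.1

theorem chk_any (n : ℕ) (hn : n ≤ 5000) : ∃ b L : ℕ, (1 ≤ b ∧ b ≤ 5000 ∧ n ≤ b ∧ b ≤ n + 1 ∧ n + 2 ≤ 3 * b ∧ (b = n ∨ b = 1)) ∧ CI b L ∧ chk1 Sk Tk n b L = true := by
  rcases Nat.eq_zero_or_pos n with rfl | hp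
  · exact ⟨1, 0, by omega, chunk_zero.2, chunk_n0⟩
  · obtain ⟨L, h1, h2⟩ := chunk_all n hp (by omega)
    exact ⟨n, L, by omega, h1, h2⟩

theorem part2_nat (n X Y : ℕ) (hn : n ≤ 5000) (ρ : ℝ) (hb : BR n ρ) :
    (1 ≤ Y → Y < 10 ^ 12 → |X - ρ * Y| * (Y : ℝ) ^ 2 ≤ 18 →
      (fA X Y = fB n X Y + (n * n + n + 7) ∨ fB n X Y = fA X Y + (n * n + n + 7)) →
    (fA X Y = fB n X Y + (n * n + n + 7) ∧ ((n = 0 ∧ X = 2 ∧ Y = 1) ∨ (n = 6 ∧ X = 19 ∧ Y = 3))) ∨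
    (fB n X Y = fA X Y + (n * n + n + 7) ∧ ((n = 2 ∧ X = 5 ∧ Y = 2) ∨ (n = 6 ∧ X = 4 ∧ Y = 1) ∨ (n = 13 ∧ X = 4 ∧ Y = 1)))) ∧
    (∀ P Q : ℕ, 0 < P → 0 < Q → P < 2 ^ 79 → Q < 2 ^ 79 →
      1 / (10 : ℝ) ^ 30 ≤ |P * Real.log (1 + 1 / ρ) - Q * Real.log ρ|) := by
  obtain ⟨b, L, hbb, hI, hc⟩ := chk_any n hn
  obtain ⟨R, hR⟩ := chk1_eq Sk Tk n b L
  rw [hR] at hc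
  simp only [Bool.and_eq_true] at hc
  obtain ⟨⟨⟨c1, c2⟩, c3⟩, c4⟩ := hc
  obtain ⟨r1, r2⟩ := chkR_spec Sk n R ρ (by norm_num) hb c1
  refine ⟨fun hY1 hY2 hη hF => chk_small Sk n R X Y ρ (by norm_num) hb r1 r2 c2 c3 hY1 hY2 hη hF, fun P Q hP hQ hP2 hQ2 => ?_⟩
  have hlo := hb.lo
  have hgt := hb.gt
  have hlt := hb.lt
  have e1 : (b : ℝ) ≤ ρ := by
    rcases hbb.2.2.2.2.2 with h | h
    · rw [h]; exact hgt.le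
    · rw [h]; norm_num; linarith
  have e2 : ρ ≤ 3 * b := by
    have : (n : ℝ) + 2 ≤ 3 * b := by exact_mod_cast hbb.2.2.2.2.1
    linarith
  have := chkF_spec Sk Tk R b L P Q ρ (by norm_num) hbb.1 hbb.2.1 e1 e2 r1 r2 hI.2.1 hI.2.2 hP hQ hP2 hQ2 c4
  refine le_trans ?_ this
  norm_num

theorem part2 (m x y : ℤ) (hm : -1 ≤ m) (hM : m < 5000) (ρ : Fin 3 → ℝ) (h : RTup m ρ) (hgt : (m : ℝ) + 1 < ρ 0)
    (hlo : 123 / 100 < ρ 0) (hlt : ρ 0 < m + 3)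
    (h1 : ρ 1 = -1 / (1 + ρ 0)) (h2 : ρ 2 = -1 - 1 / ρ 0) (hxy : 0 < x * y)
    (hF : x ^ 3 - m * x ^ 2 * y - (m + 3) * x * y ^ 2 - y ^ 3 = m ^ 2 + 3 * m + 9)
    (hη : |x - y * ρ 0| * y ^ 2 ≤ 18) :
    (m = -1 ∧ x = 2 ∧ y = 1) ∨ (m = 5 ∧ x = 19 ∧ y = 3) ∨ (m = 1 ∧ x = -5 ∧ y = -2) ∨ (m = 5 ∧ x = -4 ∧ y = -1) ∨ (m = 12 ∧ x = -4 ∧ y = -1) := by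
  obtain ⟨n, hn⟩ : ∃ n : ℕ, (n : ℤ) = m + 1 := ⟨(m + 1).toNat, by omega⟩
  have hmn : m = n - 1 := by omega
  have hmr : (m : ℝ) = n - 1 := by rw [hmn]; push_cast; ring
  have hb : BR n (ρ 0) := ⟨by have := h.root 0; rw [hmr] at this; linear_combination this, hlo, by linarith, by linarith⟩
  have hM' : (m : ℝ) < 5000 := by exact_mod_cast hM
  have hneg : -ρ 2 = 1 + 1 / ρ 0 := by rw [h2]; ring
  have hsmall : |y| < 10 ^ 12 := by
    by_contra hc
    push Not at hc
    refine part2_large m x y hm ρ h hlo (by linarith) h1 h2 hF hc hη ?_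
    rw [hneg]
    exact (part2_nat n 0 0 (by omega) (ρ 0) hb).2
  rcases lt_trichotomy y 0 with hy | hy | hy
  · obtain ⟨Y, hY⟩ : ∃ Y : ℕ, (Y : ℤ) = -y := ⟨(-y).toNat, by omega⟩
    obtain ⟨X, hX⟩ : ∃ X : ℕ, (X : ℤ) = -x := ⟨(-x).toNat, by
      have : x < 0 := by nlinarith
      omega⟩
    obtain rfl : y = -Y := by omega
    obtain rfl : x = -X := by omega
    rw [abs_neg, abs_of_nonneg (by positivity)] at hsmall
    have := (part2_nat n X Y (by omega) (ρ 0) hb).1 (by omega) (by exact_mod_cast hsmall) (by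
      push_cast at hη
      rw [show -(X : ℝ) - -(Y : ℝ) * ρ 0 = -(X - ρ 0 * Y) by ring, abs_neg, neg_sq] at hη
      exact hη) (by
      right
      rw [fA_eq, fB_eq]
      zify
      subst hmn
      linear_combination hF)
    rw [fA_eq, fB_eq] at this
    rcases this with ⟨hh, _⟩ | ⟨_, hh⟩
    · exfalso
      zify at hh
      subst hmn
      have : 2 * ((n : ℤ) * n + n + 7) = 0 := by linear_combination - hF - hh
      have h0 : (0 : ℤ) ≤ (n : ℤ) * n + n := by positivity
      linarith
    · rcases hh with ⟨a, b, c⟩ | ⟨a, b, c⟩ | ⟨a, b, c⟩ <;> subst a b c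
      · exact Or.inr (Or.inr (Or.inl ⟨hmn, rfl, rfl⟩))
      · exact Or.inr (Or.inr (Or.inr (Or.inl ⟨hmn, rfl, rfl⟩)))
      · exact Or.inr (Or.inr (Or.inr (Or.inr ⟨hmn, rfl, rfl⟩)))
  · simp [hy] at hxy
  · obtain ⟨Y, hY⟩ : ∃ Y : ℕ, (Y : ℤ) = y := ⟨y.toNat, by omega⟩
    obtain ⟨X, hX⟩ : ∃ X : ℕ, (X : ℤ) = x := ⟨x.toNat, by
      have : 0 < x := by nlinarith
      omega⟩
    subst hX hY
    rw [abs_of_nonneg (by positivity)] at hsmall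
    have := (part2_nat n X Y (by omega) (ρ 0) hb).1 (by omega) (by exact_mod_cast hsmall) (by
      push_cast at hη
      rw [show (X : ℝ) - (Y : ℝ) * ρ 0 = (X - ρ 0 * Y) by ring] at hη
      exact hη) (by
      left
      rw [fA_eq, fB_eq]
      zify
      subst hmn
      linear_combination hF)
    rw [fA_eq, fB_eq] at this
    rcases this with ⟨_, hh⟩ | ⟨hh, _⟩
    · rcases hh with ⟨a, b, c⟩ | ⟨a, b, c⟩ <;> subst a b c
      · exact Or.inl ⟨hmn, rfl, rfl⟩
      · exact Or.inr (Or.inl ⟨hmn, rfl, rfl⟩)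
    · exfalso
      zify at hh
      subst hmn
      have : 2 * ((n : ℤ) * n + n + 7) = 0 := by linear_combination - hF - hh
      have h0 : (0 : ℤ) ≤ (n : ℤ) * n + n := by positivity
      linarith

section
open Finset in
/-- `∏_{i<n} (i + 2/3)` -/
noncomputable def hgP (n : ℕ) : ℝ := ∏ i ∈ Finset.range n, ((i : ℝ) + 2 / 3)

theorem hgP_zero : hgP 0 = 1 := by simp [hgP]
theorem hgP_succ (n : ℕ) : hgP (n + 1) = hgP n * (n + 2 / 3) := by simp [hgP, Finset.prod_range_succ]
theorem hgP_pos (n : ℕ) : 0 < hgP n := Finset.prod_pos fun i _ => by positivity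

/-- coefficients of the Padé denominators -/
noncomputable def hgT (j k : ℕ) : ℝ :=
  (-1) ^ k * ((2 * j + k).factorial * hgP (j + k)) / ((j + k).factorial * j.factorial * k.factorial * hgP j)

theorem hgT_gen (j k : ℕ) : hgT (j + 1) (k + 2) =
    ((2 * (j + k + 2) + 1) / (j + k + 3) : ℝ) * (2 * hgT j (k + 2) - hgT (j + 1) (k + 1)) -
     (((j + k + 2) ^ 2 - 1 / 9) / ((j + k + 2) * (j + k + 3)) : ℝ) * hgT (j + 1) k := by
  unfold hgT
  rw [show 2 * (j + 1) + (k + 2) = 2 * j + k + 2 + 1 + 1 by ring, show 2 * j + (k + 2) = 2 * j + k + 2 by ring,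
    show 2 * (j + 1) + (k + 1) = 2 * j + k + 2 + 1 by ring, show 2 * (j + 1) + k = 2 * j + k + 2 by ring,
    show j + 1 + (k + 2) = j + k + 1 + 1 + 1 by ring, show j + (k + 2) = j + k + 1 + 1 by ring,
    show j + 1 + (k + 1) = j + k + 1 + 1 by ring, show j + 1 + k = j + k + 1 by ring]
  simp only [hgP_succ, Nat.factorial_succ, pow_succ]
  have h1 := hgP_pos j
  have h2 := hgP_pos (j + k)
  have h3 : (0 : ℝ) < ((2 * j + k).factorial : ℝ) := by positivity
  have h4 : (0 : ℝ) < ((j + k).factorial : ℝ) := by positivity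
  have h5 : (0 : ℝ) < (j.factorial : ℝ) := by positivity
  have h6 : (0 : ℝ) < (k.factorial : ℝ) := by positivity
  generalize hgP (j + k) = a at *
  generalize hgP j = b at *
  push_cast
  generalize ((2 * j + k).factorial : ℝ) = c at *
  generalize ((j + k).factorial : ℝ) = d at *
  generalize (j.factorial : ℝ) = e at *
  generalize (k.factorial : ℝ) = f at *
  have hj : (0 : ℝ) ≤ j := by positivity
  have hk : (0 : ℝ) ≤ k := by positivity
  generalize (j : ℝ) = x at *
  generalize (k : ℝ) = y at *
  have : x + 2 / 3 ≠ 0 := by positivity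
  have : x + y + 1 ≠ 0 := by positivity
  have : x + y + 1 + 1 ≠ 0 := by positivity
  have : x + y + 1 + 1 + 1 ≠ 0 := by positivity
  have : x + y + 2 ≠ 0 := by positivity
  have : x + y + 3 ≠ 0 := by positivity
  have : x + 1 ≠ 0 := by positivity
  have : y + 1 ≠ 0 := by positivity
  have : y + 1 + 1 ≠ 0 := by positivity
  field_simp
  ring

theorem hgT_j0 (k : ℕ) : hgT 0 (k + 2) =
    ((2 * (k + 1) + 1) / (k + 2) : ℝ) * (- hgT 0 (k + 1)) -
     (((k + 1) ^ 2 - 1 / 9) / ((k + 1) * (k + 2)) : ℝ) * hgT 0 k := by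
  unfold hgT
  simp only [mul_zero, zero_add, hgP_succ, Nat.factorial_succ, pow_succ, hgP_zero]
  have h2 := hgP_pos k
  have h3 : (0 : ℝ) < (k.factorial : ℝ) := by positivity
  push_cast
  generalize hgP k = a at *
  generalize (k.factorial : ℝ) = f at *
  have hk : (0 : ℝ) ≤ k := by positivity
  generalize (k : ℝ) = y at *
  have : y + 1 ≠ 0 := by positivity
  have : y + 2 ≠ 0 := by positivity
  have : y + 1 + 1 ≠ 0 := by positivity
  field_simp
  ring

theorem hgT_k1 (j : ℕ) : hgT (j + 1) 1 =
    ((2 * (j + 1) + 1) / (j + 2) : ℝ) * (2 * hgT j 1 - hgT (j + 1) 0) := by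
  unfold hgT
  rw [show 2 * (j + 1) + 1 = 2 * j + 1 + 1 + 1 by ring, show 2 * (j + 1) + 0 = 2 * j + 1 + 1 by ring]
  simp only [hgP_succ, Nat.factorial_succ, pow_succ, pow_zero, add_zero, Nat.factorial_zero]
  have h1 := hgP_pos j
  have h3 : (0 : ℝ) < ((2 * j).factorial : ℝ) := by positivity
  have h4 : (0 : ℝ) < (j.factorial : ℝ) := by positivity
  push_cast
  generalize hgP j = a at *
  generalize ((2 * j).factorial : ℝ) = c at *
  generalize (j.factorial : ℝ) = f at *
  have hk : (0 : ℝ) ≤ j := by positivity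
  generalize (j : ℝ) = y at *
  have : y + 1 ≠ 0 := by positivity
  have : y + 2 ≠ 0 := by positivity
  have : y + 1 + 1 ≠ 0 := by positivity
  have : y + 2 / 3 ≠ 0 := by positivity
  field_simp
  ring

theorem hgT_k0 (j : ℕ) : hgT (j + 1) 0 =
    ((2 * j + 1) / (j + 1) : ℝ) * (2 * hgT j 0) := by
  unfold hgT
  rw [show 2 * (j + 1) + 0 = 2 * j + 1 + 1 by ring]
  simp only [hgP_succ, Nat.factorial_succ, pow_zero, add_zero, Nat.factorial_zero]
  have h1 := hgP_pos j
  have h3 : (0 : ℝ) < ((2 * j).factorial : ℝ) := by positivity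
  have h4 : (0 : ℝ) < (j.factorial : ℝ) := by positivity
  push_cast
  generalize hgP j = a at *
  generalize ((2 * j).factorial : ℝ) = c at *
  generalize (j.factorial : ℝ) = f at *
  have hk : (0 : ℝ) ≤ j := by positivity
  generalize (j : ℝ) = y at *
  have : y + 1 ≠ 0 := by positivity
  have : y + 2 / 3 ≠ 0 := by positivity
  field_simp
  ring

/-- Padé denominators -/
noncomputable def hgp (b δ : ℂ) (r : ℕ) : ℂ := ∑ q ∈ Finset.HasAntidiagonal.antidiagonal r, (hgT q.1 q.2 : ℂ) * b ^ q.1 * δ ^ q.2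

theorem hgp_zero (b δ : ℂ) : hgp b δ 0 = 1 := by
  simp [hgp, hgT, hgP_zero]
theorem hgp_one (b δ : ℂ) : hgp b δ 1 = 2 * b - 2 / 3 * δ := by
  simp [hgp, hgT, Finset.Nat.antidiagonal_succ, hgP, Finset.prod_range_succ]
  ring
theorem hgp_two (b δ : ℂ) : hgp b δ 2 = 6 * b ^ 2 - 5 * b * δ + 5 / 9 * δ ^ 2 := by
  have h0 : hgT 2 0 = 6 := by simp [hgT, hgP, Finset.prod_range_succ, Nat.factorial]; norm_num
  have h1 : hgT 1 1 = -5 := by simp [hgT, hgP, Finset.prod_range_succ, Nat.factorial]; norm_num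
  have h2 : hgT 0 2 = 5 / 9 := by simp [hgT, hgP, Finset.prod_range_succ, Nat.factorial]; norm_num
  simp [hgp, Finset.Nat.antidiagonal_succ, h0, h1, h2]
  ring
theorem hgp_four (b δ : ℂ) : hgp b δ 4 = 70 * b ^ 4 - 385 / 3 * b ^ 3 * δ + 220 / 3 * b ^ 2 * δ ^ 2 - 1100 / 81 * b * δ ^ 3 + 110 / 243 * δ ^ 4 := by
  have h0 : hgT 4 0 = 70 := by simp [hgT, hgP, Finset.prod_range_succ, Nat.factorial]; norm_num
  have h1 : hgT 3 1 = -385 / 3 := by simp [hgT, hgP, Finset.prod_range_succ, Nat.factorial]; norm_num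
  have h2 : hgT 2 2 = 220 / 3 := by simp [hgT, hgP, Finset.prod_range_succ, Nat.factorial]; norm_num
  have h3 : hgT 1 3 = -1100 / 81 := by simp [hgT, hgP, Finset.prod_range_succ, Nat.factorial]; norm_num
  have h4 : hgT 0 4 = 110 / 243 := by simp [hgT, hgP, Finset.prod_range_succ, Nat.factorial]; norm_num
  simp [hgp, Finset.Nat.antidiagonal_succ, h0, h1, h2, h3, h4]
  ring

theorem hgp_rec0 (b δ : ℂ) : hgp b δ 2 = ((3 / 2 : ℝ) : ℂ) * (2 * b - δ) * hgp b δ 1 - ((4 / 9 : ℝ) : ℂ) * δ ^ 2 * hgp b δ 0 := by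
  rw [hgp_zero, hgp_one, hgp_two]
  push_cast
  ring

theorem hgp_rec1 (b δ : ℂ) (n : ℕ) : hgp b δ (n + 3) = (((2 * (n + 2) + 1) / (n + 3) : ℝ) : ℂ) * (2 * b - δ) * hgp b δ (n + 2)
    - ((((n + 2) ^ 2 - 1 / 9) / ((n + 2) * (n + 3)) : ℝ) : ℂ) * δ ^ 2 * hgp b δ (n + 1) := by
  obtain ⟨c, hc⟩ : ∃ c : ℝ, c = (2 * (n + 2) + 1) / (n + 3) := ⟨_, rfl⟩
  obtain ⟨B, hB⟩ : ∃ B : ℝ, B = ((n + 2) ^ 2 - 1 / 9) / ((n + 2) * (n + 3)) := ⟨_, rfl⟩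
  rw [← hc, ← hB]
  have e1 : hgp b δ (n + 3) = hgT 0 (n + 3) * δ ^ (n + 3) + (hgT (n + 3) 0 * b ^ (n + 3) + (hgT (n + 2) 1 * b ^ (n + 2) * δ +
      ∑ q ∈ Finset.HasAntidiagonal.antidiagonal n, (hgT (q.1 + 1) (q.2 + 2) : ℂ) * b ^ (q.1 + 1) * δ ^ (q.2 + 2))) := by
    unfold hgp
    rw [Finset.Nat.sum_antidiagonal_succ, Finset.Nat.sum_antidiagonal_succ', Finset.Nat.sum_antidiagonal_succ']
    simp [add_assoc]
  have e2 : hgp b δ (n + 2) = (hgT (n + 2) 0 * b ^ (n + 2) + (hgT (n + 1) 1 * b ^ (n + 1) * δ +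
      ∑ q ∈ Finset.HasAntidiagonal.antidiagonal n, (hgT q.1 (q.2 + 2) : ℂ) * b ^ q.1 * δ ^ (q.2 + 2))) := by
    unfold hgp
    rw [Finset.Nat.sum_antidiagonal_succ', Finset.Nat.sum_antidiagonal_succ']
    simp [add_assoc]
  have e3 : hgp b δ (n + 2) = hgT 0 (n + 2) * δ ^ (n + 2) + (hgT (n + 2) 0 * b ^ (n + 2) +
      ∑ q ∈ Finset.HasAntidiagonal.antidiagonal n, (hgT (q.1 + 1) (q.2 + 1) : ℂ) * b ^ (q.1 + 1) * δ ^ (q.2 + 1)) := by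
    unfold hgp
    rw [Finset.Nat.sum_antidiagonal_succ, Finset.Nat.sum_antidiagonal_succ']
    simp [add_assoc]
  have e4 : hgp b δ (n + 1) = hgT 0 (n + 1) * δ ^ (n + 1) +
      ∑ q ∈ Finset.HasAntidiagonal.antidiagonal n, (hgT (q.1 + 1) q.2 : ℂ) * b ^ (q.1 + 1) * δ ^ q.2 := by
    unfold hgp
    rw [Finset.Nat.sum_antidiagonal_succ]
    simp
  have e5 : ∑ q ∈ Finset.HasAntidiagonal.antidiagonal n, (hgT (q.1 + 1) (q.2 + 2) : ℂ) * b ^ (q.1 + 1) * δ ^ (q.2 + 2) =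
      c * (2 * b * (∑ q ∈ Finset.HasAntidiagonal.antidiagonal n, (hgT q.1 (q.2 + 2) : ℂ) * b ^ q.1 * δ ^ (q.2 + 2))
      - δ * (∑ q ∈ Finset.HasAntidiagonal.antidiagonal n, (hgT (q.1 + 1) (q.2 + 1) : ℂ) * b ^ (q.1 + 1) * δ ^ (q.2 + 1)))
      - B * δ ^ 2 * ∑ q ∈ Finset.HasAntidiagonal.antidiagonal n, (hgT (q.1 + 1) q.2 : ℂ) * b ^ (q.1 + 1) * δ ^ q.2 := by
    simp only [Finset.mul_sum, ← Finset.sum_sub_distrib]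
    refine Finset.sum_congr rfl fun q hq => ?_
    rw [Finset.HasAntidiagonal.mem_antidiagonal] at hq
    have hq' : (q.1 : ℝ) + q.2 = n := by exact_mod_cast hq
    have h := hgT_gen q.1 q.2
    rw [hq', ← hc, ← hB] at h
    rw [h]
    push_cast
    ring
  have a0 := hgT_j0 (n + 1)
  have a1 := hgT_k1 (n + 1)
  have a2 := hgT_k0 (n + 2)
  push_cast at a0 a1 a2
  rw [show (2 * ((n : ℝ) + 1 + 1) + 1) / (n + 1 + 2) = c by rw [hc]; ring_nf, show ((((n : ℝ) + 1 + 1) ^ 2 - 1 / 9) / ((n + 1 + 1) * (n + 1 + 2))) = B by rw [hB]; ring_nf] at a0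
  rw [show (2 * ((n : ℝ) + 1 + 1) + 1) / (n + 1 + 2) = c by rw [hc]; ring_nf] at a1
  rw [show (2 * ((n : ℝ) + 2) + 1) / (n + 2 + 1) = c by rw [hc]; ring_nf] at a2
  have e6 : (c : ℂ) * (2 * b - δ) * hgp b δ (n + 2) = c * (2 * b * hgp b δ (n + 2)) - c * (δ * hgp b δ (n + 2)) := by ring
  rw [e6, e1]
  nth_rewrite 1 [e2]
  rw [e3, e4, e5, show n + 3 = n + 1 + 2 by ring, a0, show n + 2 = n + 1 + 1 by ring, a1, show n + 1 + 2 = n + 2 + 1 by ring, a2]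
  push_cast
  ring
end

section
/-- primitive cube root of unity -/
noncomputable def wOm : ℂ := ⟨-1 / 2, √3 / 2⟩

theorem wOm_sq : wOm ^ 2 = -1 - wOm := by
  have h3 : √3 * √3 = 3 := Real.mul_self_sqrt (by norm_num)
  apply Complex.ext
  · simp [wOm, pow_two, Complex.mul_re]; nlinarith
  · simp [wOm, pow_two, Complex.mul_im]; ring

/-- Eisenstein integers -/
def ZW (z : ℂ) : Prop := ∃ x y : ℤ, z = x + y * wOm

theorem ZW.int (n : ℤ) : ZW n := ⟨n, 0, by simp⟩
theorem ZW.nat (n : ℕ) : ZW n := ⟨n, 0, by simp⟩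
theorem ZW.om : ZW wOm := ⟨0, 1, by simp⟩
theorem ZW.add {a b : ℂ} (ha : ZW a) (hb : ZW b) : ZW (a + b) := by
  obtain ⟨x, y, rfl⟩ := ha
  obtain ⟨z, w, rfl⟩ := hb
  exact ⟨x + z, y + w, by push_cast; ring⟩
theorem ZW.mul {a b : ℂ} (ha : ZW a) (hb : ZW b) : ZW (a * b) := by
  obtain ⟨x, y, rfl⟩ := ha
  obtain ⟨z, w, rfl⟩ := hb
  exact ⟨x * z - y * w, x * w + y * z - y * w, by push_cast; linear_combination (y * w : ℂ) * wOm_sq⟩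
theorem ZW.pow {a : ℂ} (ha : ZW a) (n : ℕ) : ZW (a ^ n) := by
  induction n with
  | zero => simpa using ZW.int 1
  | succ n ih => rw [pow_succ]; exact ih.mul ha
theorem ZW.sum {ι : Type} (s : Finset ι) (f : ι → ℂ) (h : ∀ i ∈ s, ZW (f i)) : ZW (∑ i ∈ s, f i) := by
  classical
  induction s using Finset.induction_on with
  | empty => simpa using ZW.int 0
  | insert a s ha ih =>
    rw [Finset.sum_insert ha]
    exact (h a (Finset.mem_insert_self _ _)).add (ih fun i hi => h i (Finset.mem_insert_of_mem hi))

theorem fact_dvd (j k : ℕ) : k.factorial ∣ 3 ^ (k / 2) * ∏ i ∈ Finset.range k, (3 * (j + i) + 2) := by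
  obtain ⟨v, M, hM, hk⟩ := Nat.exists_eq_pow_mul_and_not_dvd (Nat.factorial_ne_zero k) 3 (by norm_num)
  have hv : v = padicValNat 3 k.factorial := by
    have : Fact (Nat.Prime 3) := ⟨Nat.prime_three⟩
    rw [hk, padicValNat.mul (by positivity) (by rintro rfl; simp at hM), padicValNat.prime_pow, padicValNat.eq_zero_of_not_dvd hM, add_zero]
  have hv2 : v ≤ k / 2 := by
    have : Fact (Nat.Prime 3) := ⟨Nat.prime_three⟩
    have := sub_one_mul_padicValNat_factorial (p := 3) k
    rw [← hv] at this
    omega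
  rw [hk]
  refine mul_dvd_mul (pow_dvd_pow 3 hv2) ?_
  have hcop : Nat.Coprime 3 M := (Nat.Prime.coprime_iff_not_dvd Nat.prime_three).mpr hM
  obtain ⟨c, hc⟩ : ∃ c : ℕ, 3 * c ≡ 1 [MOD M] := by
    rcases Nat.lt_or_ge 1 M with h | h
    · obtain ⟨c, _, hc⟩ := Nat.exists_mul_mod_eq_one_of_coprime hcop h
      exact ⟨c, by rw [Nat.ModEq, hc, Nat.mod_eq_of_lt h]⟩
    · have : M = 1 := by
        have : M ≠ 0 := by rintro rfl; simp at hM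
        omega
      exact ⟨0, by rw [this]; exact Nat.modEq_one⟩
  have h1 : (∏ i ∈ Finset.range k, (3 * (j + i) + 2)) ≡ ∏ i ∈ Finset.range k, (3 * (j + 2 * c + i)) [MOD M] := by
    have : ∀ n, (∏ i ∈ Finset.range n, (3 * (j + i) + 2)) ≡ ∏ i ∈ Finset.range n, (3 * (j + 2 * c + i)) [MOD M] := by
      intro n
      induction n with
      | zero => simp [Nat.ModEq]
      | succ n ih =>
        rw [Finset.prod_range_succ, Finset.prod_range_succ]
        refine ih.mul ?_
        have h2 : 3 * (j + n) + 2 * 1 ≡ 3 * (j + n) + 2 * (3 * c) [MOD M] := Nat.ModEq.add_left _ (hc.symm.mul_left 2)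
        rw [show 3 * (j + 2 * c + n) = 3 * (j + n) + 2 * (3 * c) by ring]
        simpa using h2
    exact this k
  refine (Nat.modEq_zero_iff_dvd.mp (h1.trans (Nat.modEq_zero_iff_dvd.mpr ?_)))
  rw [Finset.prod_mul_distrib]
  refine Dvd.dvd.mul_left ?_ _
  have h3 : (∏ i ∈ Finset.range k, (j + 2 * c + i)) = (j + 2 * c).ascFactorial k := by
    rw [Nat.ascFactorial_eq_prod_range]
  rw [h3]
  have : M ∣ k.factorial := by rw [hk]; exact Dvd.intro_left _ rfl
  exact this.trans (Nat.factorial_dvd_ascFactorial _ _)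

theorem hgP_prod (j k : ℕ) : hgP (j + k) * 3 ^ k = hgP j * ((∏ i ∈ Finset.range k, (3 * (j + i) + 2) : ℕ) : ℝ) := by
  induction k with
  | zero => simp
  | succ k ih =>
    rw [← add_assoc, hgP_succ, Finset.prod_range_succ, pow_succ]
    push_cast at ih ⊢
    linear_combination (3 * (j + k) + 2 : ℝ) * ih

theorem hgT_int (j k : ℕ) : ∃ N : ℤ, hgT j k * (-3) ^ k * 3 ^ (k / 2) = N := by
  obtain ⟨d, hd⟩ := fact_dvd j k
  refine ⟨(2 * j + k).choose j * d, ?_⟩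
  have hdr : (3 : ℝ) ^ (k / 2) * ((∏ i ∈ Finset.range k, (3 * (j + i) + 2) : ℕ) : ℝ) = k.factorial * d := by exact_mod_cast hd
  have hp := hgP_prod j k
  have hch : ((2 * j + k).choose j : ℝ) * (j.factorial * (j + k).factorial) = (2 * j + k).factorial := by
    have := Nat.choose_mul_factorial_mul_factorial (n := 2 * j + k) (k := j) (by omega)
    rw [show 2 * j + k - j = j + k by omega] at this
    rw [← mul_assoc]
    exact_mod_cast this
  unfold hgT
  have h1 := hgP_pos j
  have h4 : (0 : ℝ) < ((j + k).factorial : ℝ) := by positivity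
  have h5 : (0 : ℝ) < (j.factorial : ℝ) := by positivity
  have h6 : (0 : ℝ) < (k.factorial : ℝ) := by positivity
  push_cast
  rw [← hch, div_mul_eq_mul_div, div_mul_eq_mul_div, div_eq_iff (by positivity)]
  have h7 : (-1 : ℝ) ^ k * (-3) ^ k = 3 ^ k := by rw [← mul_pow]; norm_num
  calc _ = ((2 * j + k).choose j : ℝ) * (j.factorial * (j + k).factorial) * ((-1 : ℝ) ^ k * (-3) ^ k) * hgP (j + k) * 3 ^ (k / 2) := by ring
    _ = ((2 * j + k).choose j : ℝ) * (j.factorial * (j + k).factorial) * (hgP (j + k) * 3 ^ k) * 3 ^ (k / 2) := by rw [h7]; ring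
    _ = ((2 * j + k).choose j : ℝ) * (j.factorial * (j + k).factorial) * hgP j * (3 ^ (k / 2) * ((∏ i ∈ Finset.range k, (3 * (j + i) + 2) : ℕ) : ℝ)) := by rw [hp]; ring
    _ = _ := by rw [hdr]; ring

theorem hgp_int (m : ℤ) (r : ℕ) : ZW (hgp (m - 3 * wOm) (-3 * (2 * wOm + 1)) r) := by
  unfold hgp
  refine ZW.sum _ _ fun q _ => ?_
  obtain ⟨j, k⟩ := q
  have hb : ZW (m - 3 * wOm) := ⟨m, -3, by push_cast; ring⟩
  have hs : ZW (2 * wOm + 1) := ⟨1, 2, by push_cast; ring⟩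
  have hs2 : (2 * wOm + 1) ^ 2 = -1 * 3 := by linear_combination 4 * wOm_sq
  obtain ⟨N, hN⟩ := hgT_int j k
  have e : (hgT j k : ℂ) * (m - 3 * wOm) ^ j * (-3 * (2 * wOm + 1)) ^ k =
      ((N : ℂ) * ((-1 : ℤ) : ℂ) ^ (k / 2)) * (m - 3 * wOm) ^ j * (2 * wOm + 1) ^ (k % 2) := by
    have : (2 * wOm + 1) ^ k = (-1) ^ (k / 2) * 3 ^ (k / 2) * (2 * wOm + 1) ^ (k % 2) := by
      conv_lhs => rw [← Nat.div_add_mod k 2, pow_add, pow_mul, hs2, mul_pow]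
    rw [mul_pow, this, show (N : ℂ) = ((hgT j k * (-3) ^ k * 3 ^ (k / 2) : ℝ) : ℂ) by rw [hN]; simp]
    push_cast
    ring
  show ZW ((hgT j k : ℂ) * (m - 3 * wOm) ^ j * (-3 * (2 * wOm + 1)) ^ k)
  rw [e]
  exact (((ZW.int N).mul ((ZW.int (-1)).pow _)).mul (hb.pow j)).mul (hs.pow _)

theorem hgp_int2 (m : ℤ) : ∃ z, ZW z ∧ hgp (m - 3 * wOm) (-3 * (2 * wOm + 1)) 2 = 3 * z := by
  refine ⟨(2 * m ^ 2 + 5 * m + 7 : ℤ) + (-(2 * m + 3) : ℤ) * wOm, ⟨_, _, rfl⟩, ?_⟩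
  rw [hgp_two]
  push_cast
  have h2 := wOm_sq
  linear_combination (-16 : ℂ) * wOm_sq

theorem hgp_int4 (m : ℤ) : ∃ z, ZW z ∧ hgp (m - 3 * wOm) (-3 * (2 * wOm + 1)) 4 = 5 * z := by
  refine ⟨(14 * m ^ 4 + 77 * m ^ 3 + 234 * m ^ 2 + 347 * m + 231 : ℤ) + (-(14 * m ^ 3 + 63 * m ^ 2 + 143 * m + 120) : ℤ) * wOm, ⟨_, _, rfl⟩, ?_⟩
  rw [hgp_four]
  push_cast
  have h2 := wOm_sq
  have h3 : wOm ^ 3 = 1 := by linear_combination (wOm - 1) * wOm_sq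
  have h4 : wOm ^ 4 = wOm := by linear_combination wOm * h3
  ring_nf
  rw [h2, h3, h4]
  ring
end

section
noncomputable def sgL (μ h τ : ℝ) : ℂ := (μ:ℂ) + (h*τ:ℝ) * Complex.I
noncomputable def qF (σ π s : ℂ) : ℂ := s - σ + π / s
noncomputable def pF (π s : ℂ) : ℂ := s - π / s
noncomputable def c13 (s : ℂ) : ℂ := s ^ (((-(1/3):ℝ)):ℂ)
noncomputable def c43 (s : ℂ) : ℂ := s ^ (((-(4/3):ℝ)):ℂ)

lemma c13_c43 (s : ℂ) (hs : s ≠ 0) : c13 s = s * c43 s := by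
  unfold c13 c43
  rw [show (((-(1/3):ℝ)):ℂ) = 1 + (((-(4/3):ℝ)):ℂ) by push_cast; ring, Complex.cpow_add _ _ hs, Complex.cpow_one]

lemma c13_deriv (s : ℂ) (hs : s ∈ Complex.slitPlane) : HasDerivAt c13 (-(1/3) * c43 s) s := by
  have := (hasDerivAt_id s).cpow_const (c := (((-(1/3):ℝ)):ℂ)) hs
  refine HasDerivAt.congr_deriv (f := c13) this ?_
  unfold c43
  simp only [id, mul_one]
  congr 1
  · push_cast; ring
  · congr 1; push_cast; ring

lemma qF_deriv (σ π s : ℂ) (hs : s ≠ 0) : HasDerivAt (qF σ π) (pF π s / s) s := by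
  have h1 := ((hasDerivAt_id s).sub_const σ).add ((hasDerivAt_inv hs).const_mul π)
  refine HasDerivAt.congr_deriv (f := qF σ π) h1 ?_
  unfold pF; field_simp; ring

lemma pF_deriv (σ π s : ℂ) (hs : s ≠ 0) : HasDerivAt (pF π) ((qF σ π s + σ) / s) s := by
  have h1 := ((hasDerivAt_id s)).sub ((hasDerivAt_inv hs).const_mul π)
  refine HasDerivAt.congr_deriv (f := pF π) h1 ?_
  unfold qF; field_simp; ring

lemma pF_sq (σ π s : ℂ) (hs : s ≠ 0) : pF π s ^ 2 = (qF σ π s + σ)^2 - 4 * π := by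
  unfold pF qF; field_simp; ring

noncomputable def GF (σ π : ℂ) (r : ℕ) (s : ℂ) : ℂ :=
  (qF σ π s ^ r * pF π s + (1/(3*((r:ℂ)+1))) * qF σ π s ^ (r+1)) * c13 s

lemma GF_deriv0 (σ π s : ℂ) (hs : s ∈ Complex.slitPlane) :
    HasDerivAt (GF σ π 0) (c43 s * ((8/9) * qF σ π s + σ)) s := by
  have hs0 : s ≠ 0 := Complex.slitPlane_ne_zero hs
  have hq := qF_deriv σ π s hs0
  have hp := pF_deriv σ π s hs0
  have hc := c13_deriv s hs
  have h1 := (((hq.pow 0).mul hp).add ((hq.pow 1).const_mul (1/(3*(((0:ℕ):ℂ)+1))))).mul hc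
  refine HasDerivAt.congr_deriv (f := GF σ π 0) h1 ?_
  rw [c13_c43 s hs0]
  simp
  field_simp
  ring

lemma GF_deriv (σ π s : ℂ) (n : ℕ) (hs : s ∈ Complex.slitPlane) :
    HasDerivAt (GF σ π (n+1)) (c43 s * (((n:ℂ)+2 - 1/(9*((n:ℂ)+2))) * qF σ π s ^ (n+2)
      + (2*n+3) * σ * qF σ π s ^ (n+1) + (n+1) * (σ^2 - 4 * π) * qF σ π s ^ n)) s := by
  have hs0 : s ≠ 0 := Complex.slitPlane_ne_zero hs
  have hq := qF_deriv σ π s hs0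
  have hp := pF_deriv σ π s hs0
  have hc := c13_deriv s hs
  have h1 := (((hq.pow (n+1)).mul hp).add ((hq.pow (n+2)).const_mul (1/(3*(((n+1:ℕ):ℂ)+1))))).mul hc
  refine HasDerivAt.congr_deriv (f := GF σ π (n+1)) h1 ?_
  rw [c13_c43 s hs0]
  have h2 := pF_sq σ π s hs0
  have hn : (n:ℂ) + 2 ≠ 0 := by exact_mod_cast (by omega : n + 2 ≠ 0)
  have hn' : (n:ℂ) + 1 + 1 ≠ 0 := by exact_mod_cast (by omega : n + 1 + 1 ≠ 0)
  simp only [Nat.add_sub_cancel, Pi.pow_apply, Pi.mul_apply, Pi.add_apply, show n + 2 - 1 = n + 1 by omega]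
  push_cast
  generalize qF σ π s = q at *
  generalize pF π s = p at *
  have e1 : s * c43 s * ((q + σ)/s) = c43 s * (q + σ) := by field_simp
  have e2 : s * c43 s * (p/s) = c43 s * p := by field_simp
  have h3 : ((n:ℂ) + 1) * q ^ n * (p / s) * p * (s * c43 s) = (n+1) * q^n * c43 s * ((q + σ)^2 - 4 * π) := by
    rw [← h2]; field_simp
  have h4 : q ^ (n+1) * ((q + σ)/s) * (s * c43 s) = q^(n+1) * c43 s * (q + σ) := by field_simp
  have h5 : 1 / (3 * ((n:ℂ) + 1 + 1)) * (((n:ℂ) + 2) * q ^ (n + 1) * (p / s)) * (s * c43 s) = (1/3) * q^(n+1) * p * c43 s := by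
    rw [show (n:ℂ)+1+1 = n+2 by ring]; field_simp
  have h6 : 1 / (3 * ((n:ℂ) + 1 + 1)) * q ^ (n+2) = 3 * (1/(9*((n:ℂ)+2))) * q^(n+2) := by
    rw [show (n:ℂ)+1+1 = n+2 by ring]; field_simp; ring
  linear_combination h3 + h4 + h5 - (1/3) * c43 s * h6

lemma sgL_re (μ h τ : ℝ) : (sgL μ h τ).re = μ := by simp [sgL]
lemma sgL_im (μ h τ : ℝ) : (sgL μ h τ).im = h * τ := by simp [sgL]
lemma sgL_slit (μ h τ : ℝ) (hμ : 0 < μ) : sgL μ h τ ∈ Complex.slitPlane := by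
  left; rw [sgL_re]; exact hμ
lemma sgL_norm (μ h τ : ℝ) (hμ : 0 < μ) : μ ≤ ‖sgL μ h τ‖ := by
  have := Complex.abs_re_le_norm (sgL μ h τ)
  rw [sgL_re, abs_of_pos hμ] at this; exact this
lemma sgL_deriv (μ h τ : ℝ) : HasDerivAt (sgL μ h) ((h:ℂ) * Complex.I) τ := by
  have h1 : HasDerivAt (fun τ : ℝ => ((h*τ:ℝ):ℂ)) ((h*1:ℝ):ℂ) τ := ((hasDerivAt_id τ).const_mul h).ofReal_comp
  have h2 := (h1.mul_const Complex.I).const_add (μ:ℂ)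
  exact HasDerivAt.congr_deriv (f := sgL μ h) h2 (by simp)

lemma sgL_q (μ h τ : ℝ) (hμ : 0 < μ) : qF (2*μ) (μ^2+h^2) (sgL μ h τ) * sgL μ h τ = ((h^2*(1-τ^2):ℝ):ℂ) := by
  have : sgL μ h τ ≠ 0 := Complex.slitPlane_ne_zero (sgL_slit μ h τ hμ)
  have e : qF (2*μ) (μ^2+h^2) (sgL μ h τ) * sgL μ h τ = sgL μ h τ ^2 - 2*μ*sgL μ h τ + (μ^2+h^2) := by
    unfold qF; field_simp
  rw [e]; unfold sgL; push_cast
  linear_combination (h:ℂ)^2*τ^2*Complex.I_sq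

noncomputable def JF (μ h : ℝ) (r : ℕ) : ℂ :=
  ∫ τ in (-1:ℝ)..1, c43 (sgL μ h τ) * qF (2*μ) (μ^2+h^2) (sgL μ h τ) ^ r * (h * Complex.I)

lemma JF_cont (μ h : ℝ) (hμ : 0 < μ) (r : ℕ) : Continuous fun τ : ℝ => c43 (sgL μ h τ) * qF (2*μ) (μ^2+h^2) (sgL μ h τ) ^ r * (h * Complex.I) := by
  have hs : Continuous (sgL μ h) := by
    unfold sgL; fun_prop
  have h0 : ∀ τ, sgL μ h τ ≠ 0 := fun τ => Complex.slitPlane_ne_zero (sgL_slit μ h τ hμ)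
  have h1 : Continuous fun τ : ℝ => c43 (sgL μ h τ) := by
    unfold c43
    exact hs.cpow continuous_const (fun τ => sgL_slit μ h τ hμ)
  have h2 : Continuous fun τ : ℝ => qF (2*μ) (μ^2+h^2) (sgL μ h τ) := by
    unfold qF
    exact (hs.sub continuous_const).add (continuous_const.div hs h0)
  exact (h1.mul (h2.pow r)).mul continuous_const

lemma JF_int (μ h : ℝ) (hμ : 0 < μ) (r : ℕ) : IntervalIntegrable (fun τ : ℝ => c43 (sgL μ h τ) * qF (2*μ) (μ^2+h^2) (sgL μ h τ) ^ r * (h * Complex.I)) MeasureTheory.volume (-1) 1 :=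
  (JF_cont μ h hμ r).intervalIntegrable _ _

lemma JF_zero (μ h : ℝ) (hμ : 0 < μ) : JF μ h 0 = -3 * (c13 (sgL μ h 1) - c13 (sgL μ h (-1))) := by
  unfold JF
  rw [intervalIntegral.integral_eq_sub_of_hasDerivAt (f := fun τ => -3 * c13 (sgL μ h τ))]
  · ring
  · intro τ _
    have := ((c13_deriv _ (sgL_slit μ h τ hμ)).comp τ (sgL_deriv μ h τ)).const_mul (-3)
    refine HasDerivAt.congr_deriv this ?_
    ring
  · exact JF_int μ h hμ 0

lemma qF_end (μ h τ : ℝ) (hμ : 0 < μ) (hτ : τ^2 = 1) : qF (2*μ) (μ^2+h^2) (sgL μ h τ) = 0 := by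
  have h1 := sgL_q μ h τ hμ
  have : sgL μ h τ ≠ 0 := Complex.slitPlane_ne_zero (sgL_slit μ h τ hμ)
  rw [hτ] at h1
  simpa [this] using h1

lemma pF_end (μ h τ : ℝ) (hμ : 0 < μ) (hτ : τ^2 = 1) : pF (μ^2+h^2) (sgL μ h τ) = 2 * (h * τ) * Complex.I := by
  have h1 := qF_end μ h τ hμ hτ
  have : pF (μ^2+h^2) (sgL μ h τ) = 2 * sgL μ h τ - 2 * μ - qF (2*μ) (μ^2+h^2) (sgL μ h τ) := by
    unfold pF qF; ring
  rw [this, h1]; unfold sgL; push_cast; ring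

lemma JF_one (μ h : ℝ) (hμ : 0 < μ) : (8/9) * JF μ h 1 + 2 * μ * JF μ h 0 =
    2 * h * Complex.I * (c13 (sgL μ h 1) + c13 (sgL μ h (-1))) := by
  have key : ∫ τ in (-1:ℝ)..1, ((8/9) * (c43 (sgL μ h τ) * qF (2*μ) (μ^2+h^2) (sgL μ h τ) ^ 1 * (h * Complex.I))
    + 2 * μ * (c43 (sgL μ h τ) * qF (2*μ) (μ^2+h^2) (sgL μ h τ) ^ 0 * (h * Complex.I))) =
     GF (2*μ) (μ^2+h^2) 0 (sgL μ h 1) - GF (2*μ) (μ^2+h^2) 0 (sgL μ h (-1)) := by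
    apply intervalIntegral.integral_eq_sub_of_hasDerivAt (f := fun τ => GF (2*μ) (μ^2+h^2) 0 (sgL μ h τ))
    · intro τ _
      have := ((GF_deriv0 (2*μ) (μ^2+h^2) _ (sgL_slit μ h τ hμ)).comp τ (sgL_deriv μ h τ))
      refine HasDerivAt.congr_deriv this ?_
      ring
    · exact ((JF_int μ h hμ 1).const_mul _).add ((JF_int μ h hμ 0).const_mul _)
  rw [intervalIntegral.integral_add ((JF_int μ h hμ 1).const_mul _) ((JF_int μ h hμ 0).const_mul _),
    intervalIntegral.integral_const_mul, intervalIntegral.integral_const_mul] at key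
  unfold JF
  rw [key]
  unfold GF
  rw [qF_end μ h 1 hμ (by norm_num), qF_end μ h (-1) hμ (by norm_num), pF_end μ h 1 hμ (by norm_num), pF_end μ h (-1) hμ (by norm_num)]
  push_cast
  ring

lemma JF_rec (μ h : ℝ) (hμ : 0 < μ) (n : ℕ) : ((n:ℂ)+2 - 1/(9*((n:ℂ)+2))) * JF μ h (n+2) + (2*n+3) * (2 * μ) * JF μ h (n+1)
   + (n+1) * (-4*h^2) * JF μ h n = 0 := by
  have key : ∫ τ in (-1:ℝ)..1, (((n:ℂ)+2 - 1/(9*((n:ℂ)+2))) * (c43 (sgL μ h τ) * qF (2*μ) (μ^2+h^2) (sgL μ h τ) ^ (n+2) * (h * Complex.I))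
    + (2*n+3) * (2 * μ) * (c43 (sgL μ h τ) * qF (2*μ) (μ^2+h^2) (sgL μ h τ) ^ (n+1) * (h * Complex.I))
    + (n+1) * (-4*h^2) * (c43 (sgL μ h τ) * qF (2*μ) (μ^2+h^2) (sgL μ h τ) ^ n * (h * Complex.I))) =
     GF (2*μ) (μ^2+h^2) (n+1) (sgL μ h 1) - GF (2*μ) (μ^2+h^2) (n+1) (sgL μ h (-1)) := by
    apply intervalIntegral.integral_eq_sub_of_hasDerivAt (f := fun τ => GF (2*μ) (μ^2+h^2) (n+1) (sgL μ h τ))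
    · intro τ _
      have := ((GF_deriv (2*μ) (μ^2+h^2) _ n (sgL_slit μ h τ hμ)).comp τ (sgL_deriv μ h τ))
      refine HasDerivAt.congr_deriv this ?_
      ring
    · exact (((JF_int μ h hμ (n+2)).const_mul _).add ((JF_int μ h hμ (n+1)).const_mul _)).add ((JF_int μ h hμ n).const_mul _)
  rw [intervalIntegral.integral_add (((JF_int μ h hμ (n+2)).const_mul _).add ((JF_int μ h hμ (n+1)).const_mul _)) ((JF_int μ h hμ n).const_mul _),
    intervalIntegral.integral_add ((JF_int μ h hμ (n+2)).const_mul _) ((JF_int μ h hμ (n+1)).const_mul _),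
    intervalIntegral.integral_const_mul, intervalIntegral.integral_const_mul, intervalIntegral.integral_const_mul] at key
  unfold JF
  rw [key]
  unfold GF
  rw [qF_end μ h 1 hμ (by norm_num), qF_end μ h (-1) hμ (by norm_num)]
  simp

lemma JF_norm (μ h : ℝ) (hμ : 0 < μ) (hh : 0 < h) (r : ℕ) : ‖JF μ h r‖ ≤ 2 * h * (h^2/μ)^r * μ ^ (-(4/3):ℝ) := by
  have := intervalIntegral.norm_integral_le_of_norm_le_const (a := (-1:ℝ)) (b := 1)
    (f := fun τ : ℝ => c43 (sgL μ h τ) * qF (2*μ) (μ^2+h^2) (sgL μ h τ) ^ r * (h * Complex.I))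
    (C := μ ^ (-(4/3):ℝ) * (h^2/μ)^r * h) ?_
  · unfold JF
    refine this.trans (le_of_eq ?_)
    rw [show |(1:ℝ) - (-1)| = 2 by norm_num]; ring
  · intro τ hτ
    rw [Set.uIoc_of_le (by norm_num)] at hτ
    have hn := sgL_norm μ h τ hμ
    have hn0 : 0 < ‖sgL μ h τ‖ := hμ.trans_le hn
    have h1 : ‖c43 (sgL μ h τ)‖ ≤ μ ^ (-(4/3):ℝ) := by
      unfold c43
      rw [Complex.norm_cpow_real]
      exact Real.rpow_le_rpow_of_nonpos hμ hn (by norm_num)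
    have h2 : ‖qF (2*μ) (μ^2+h^2) (sgL μ h τ)‖ ≤ h^2/μ := by
      have e := congrArg norm (sgL_q μ h τ hμ)
      rw [norm_mul, Complex.norm_real, Real.norm_eq_abs, abs_of_nonneg (mul_nonneg (sq_nonneg h) (by nlinarith [hτ.1, hτ.2]))] at e
      rw [le_div_iff₀ hμ]
      calc _ ≤ ‖qF (2*μ) (μ^2+h^2) (sgL μ h τ)‖ * ‖sgL μ h τ‖ := by gcongr
        _ = _ := e
        _ ≤ h^2 := by nlinarith [sq_nonneg (h*τ)]
    have h3 : ‖(h:ℂ) * Complex.I‖ = h := by simp [abs_of_pos hh]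
    rw [norm_mul, norm_mul, h3, norm_pow]
    gcongr
end

section
noncomputable def cR : ℕ → ℝ
  | 0 => 1
  | n+1 => cR n * ((n+1)^2 / ((n+1)^2 - 1/9))

lemma cR_ge (n : ℕ) : 9/8 ≤ cR (n+1) := by
  induction n with
  | zero => simp [cR]; norm_num
  | succ n ih =>
    rw [cR]
    have : (1:ℝ) ≤ (((n+1:ℕ):ℝ)+1)^2 / ((((n+1:ℕ):ℝ)+1)^2 - 1/9) := by
      rw [le_div_iff₀ (by push_cast; nlinarith [(Nat.cast_nonneg n : (0:ℝ) ≤ n)])]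
      linarith
    nlinarith

lemma hgp_rec (b δ : ℂ) (n : ℕ) :
   hgp b δ (n+2) = ((((2*n+3)/(n+2):ℝ)):ℂ) * (2*b-δ) * hgp b δ (n+1) - (((((n+1)^2-1/9)/((n+1)*(n+2)):ℝ)):ℂ)*δ^2*hgp b δ n := by
  rcases n with _ | n
  · rw [zero_add, hgp_rec0 b δ]; push_cast; norm_num
  · have e1 : ((2*((n+1:ℕ):ℝ)+3)/(((n+1:ℕ):ℝ)+2)) = (2 * ((n:ℝ) + 2) + 1) / (n + 3) := by push_cast; congr 1 <;> ring
    have e2 : ((((n+1:ℕ):ℝ)+1)^2-1/9)/((((n+1:ℕ):ℝ)+1)*(((n+1:ℕ):ℝ)+2)) = (((n:ℝ)+2)^2-1/9)/((n+2)*(n+3)) := by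
      push_cast; congr 1 <;> ring
    rw [e1, e2]
    exact hgp_rec1 b δ n

lemma JF_hgp (μ h : ℝ) (hμ : 0 < μ) (r : ℕ) :
    JF μ h r = (-1)^(r+1) * 3 * (cR r) * (hgp (sgL μ h 1) (2*h*Complex.I) r * c13 (sgL μ h 1) - hgp (sgL μ h (-1)) (-(2*h*Complex.I)) r * c13 (sgL μ h (-1))) := by
  have ea : 2 * sgL μ h 1 - 2*h*Complex.I = 2*μ := by unfold sgL; push_cast; ring
  have eb : 2 * sgL μ h (-1) - -(2*h*Complex.I) = 2*μ := by unfold sgL; push_cast; ring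
  have ed : (2*h*Complex.I)^2 = -4*h^2 := by linear_combination 4*(h:ℂ)^2*Complex.I_sq
  have ed' : (-(2*h*Complex.I))^2 = -4*h^2 := by linear_combination 4*(h:ℂ)^2*Complex.I_sq
  have h0 := JF_zero μ h hμ
  have h1 := JF_one μ h hμ
  have J0 : JF μ h 0 = (-1)^(0+1) * 3 * (cR 0) * (hgp (sgL μ h 1) (2*h*Complex.I) 0 * c13 (sgL μ h 1) - hgp (sgL μ h (-1)) (-(2*h*Complex.I)) 0 * c13 (sgL μ h (-1))) := by
    rw [h0, hgp_zero, hgp_zero]; simp [cR]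
  have J1 : JF μ h 1 = (-1)^(1+1) * 3 * (cR 1) * (hgp (sgL μ h 1) (2*h*Complex.I) 1 * c13 (sgL μ h 1) - hgp (sgL μ h (-1)) (-(2*h*Complex.I)) 1 * c13 (sgL μ h (-1))) := by
    rw [hgp_one, hgp_one]
    have : ((cR 1 : ℝ):ℂ) = 9/8 := by
      have : cR 1 = 9/8 := by simp [cR]; norm_num
      rw [this]; norm_num
    rw [this]
    linear_combination (9/8) * h1 - (9/8) * 2 * μ * h0 - (27/8) * c13 (sgL μ h 1) * ea + (27/8) * c13 (sgL μ h (-1)) * eb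
  induction r using Nat.strong_induction_on with
  | _ r ih =>
    match r, ih with
    | 0, _ => exact J0
    | 1, _ => exact J1
    | n+2, ih =>
      have i1 := ih (n+1) (by omega)
      have i0 := ih n (by omega)
      have hr := JF_rec μ h hμ n
      have hU : hgp (sgL μ h 1) (2*h*Complex.I) (n+2) * c13 (sgL μ h 1) - hgp (sgL μ h (-1)) (-(2*h*Complex.I)) (n+2) * c13 (sgL μ h (-1))
        = ((((2*n+3)/(n+2):ℝ)):ℂ) * (2*μ) * (hgp (sgL μ h 1) (2*h*Complex.I) (n+1) * c13 (sgL μ h 1) - hgp (sgL μ h (-1)) (-(2*h*Complex.I)) (n+1) * c13 (sgL μ h (-1)))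
         - (((((n+1)^2-1/9)/((n+1)*(n+2)):ℝ)):ℂ)*(-4*h^2) * (hgp (sgL μ h 1) (2*h*Complex.I) n * c13 (sgL μ h 1) - hgp (sgL μ h (-1)) (-(2*h*Complex.I)) n * c13 (sgL μ h (-1))) := by
        rw [hgp_rec (sgL μ h 1), hgp_rec (sgL μ h (-1)), ea, ed, eb, ed']
        ring
      rw [i1, i0] at hr
      rw [hU]
      generalize hgp (sgL μ h 1) (2*h*Complex.I) (n+1) * c13 (sgL μ h 1) - hgp (sgL μ h (-1)) (-(2*h*Complex.I)) (n+1) * c13 (sgL μ h (-1)) = U1 at *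
      generalize hgp (sgL μ h 1) (2*h*Complex.I) n * c13 (sgL μ h 1) - hgp (sgL μ h (-1)) (-(2*h*Complex.I)) n * c13 (sgL μ h (-1)) = U0 at *
      have hn : (n:ℂ)+2 ≠ 0 := by exact_mod_cast (by omega : n + 2 ≠ 0)
      have hn1 : (n:ℂ)+1 ≠ 0 := by exact_mod_cast (by omega : n + 1 ≠ 0)
      have hn2 : 9*((n:ℂ)+2)^2-1 ≠ 0 := by
        have : (0:ℝ) < 9*((n:ℝ)+2)^2-1 := by nlinarith [(Nat.cast_nonneg n : (0:ℝ) ≤ n)]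
        exact_mod_cast this.ne'
      have hn3 : 9*((n:ℂ)+1)^2-1 ≠ 0 := by
        have : (0:ℝ) < 9*((n:ℝ)+1)^2-1 := by nlinarith [(Nat.cast_nonneg n : (0:ℝ) ≤ n)]
        exact_mod_cast this.ne'
      have c1 : ((cR (n+1):ℝ):ℂ) = cR n * (9*(n+1)^2/(9*(n+1)^2-1)) := by
        rw [cR]; push_cast
        congr 1
        rw [div_eq_div_iff (by intro hh; apply hn3; linear_combination 9*hh) hn3]; ring
      have c2 : ((cR (n+2):ℝ):ℂ) = cR n * (9*(n+1)^2/(9*(n+1)^2-1)) * (9*(n+2)^2/(9*(n+2)^2-1)) := by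
        rw [cR, ← c1]; push_cast
        congr 1
        rw [div_eq_div_iff (by intro hh; apply hn2; linear_combination 9*hh) hn2]; ring
      rw [c1] at hr
      rw [c2]
      have hk : ((n:ℂ)+2 - 1/(9*((n:ℂ)+2))) = (9*((n:ℂ)+2)^2-1)/(9*((n:ℂ)+2)) := by
        field_simp
      rw [hk] at hr
      have hk0 : (9*((n:ℂ)+2)^2-1)/(9*((n:ℂ)+2)) ≠ 0 := div_ne_zero hn2 (mul_ne_zero (by norm_num) hn)
      apply mul_left_cancel₀ hk0
      rw [← sub_eq_zero, ← hr]
      push_cast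
      have e9 : ((n:ℂ)+1)^2 - 1/9 = (9*((n:ℂ)+1)^2-1)/9 := by ring
      rw [e9]
      simp only [pow_succ (-1:ℂ)]
      generalize ((cR n:ℝ):ℂ) = K at *
      generalize ((-1:ℂ))^n = L at *
      have hq2 : (9*((n:ℂ)+2)^2-1)/(9*((n:ℂ)+2)) * (9*(n+2)^2/(9*(n+2)^2-1)) = n+2 := by
        field_simp
      have hq1 : (9*((n:ℂ)+1)^2/(9*(n+1)^2-1)) * (((9*((n:ℂ)+1)^2-1)/9)/((n+1)*(n+2))) = (n+1)/(n+2) := by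
        field_simp
      have hq3 : ((n:ℂ)+2) * ((2*n+3)/(n+2)) = 2*n+3 := by field_simp
      have hq4 : ((n:ℂ)+2) * ((n+1)/(n+2)) = n+1 := by field_simp
      generalize (9*((n:ℂ)+1)^2/(9*(n+1)^2-1)) = A1 at *
      generalize (9*((n:ℂ)+2)^2/(9*(n+2)^2-1)) = A2 at *
      generalize (9*((n:ℂ)+2)^2-1)/(9*((n:ℂ)+2)) = A3 at *
      generalize (((9*((n:ℂ)+1)^2-1)/9)/((n+1)*(n+2))) = B1 at *
      generalize (2*(n:ℂ)+3)/(n+2) = B2 at *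
      generalize ((n:ℂ)+1)/(n+2) = B3 at *
      linear_combination (L*3*K*A1*(B2*(2*μ)*U1 - B1*(-4*h^2)*U0)) * hq2 + (L*3*K*A1*2*μ*U1) * hq3 - (L*3*K*(n+2)*(-4*h^2)*U0)*hq1 - L*3*K*(-4*h^2)*U0 * hq4
end

section
lemma sgL_conj (μ h : ℝ) : (starRingEnd ℂ) (sgL μ h (-1)) = sgL μ h 1 := by
  unfold sgL; simp

lemma c13_conj (μ h : ℝ) (hμ : 0 < μ) : (starRingEnd ℂ) (c13 (sgL μ h (-1))) = c13 (sgL μ h 1) := by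
  unfold c13
  have := Complex.conj_cpow (sgL μ h (-1)) (((-(1/3):ℝ)):ℂ) (Complex.slitPlane_arg_ne_pi (sgL_slit μ h (-1) hμ))
  rw [sgL_conj, Complex.conj_ofReal] at this
  rw [this]

lemma hgp_conj (b δ : ℂ) (r : ℕ) : (starRingEnd ℂ) (hgp b δ r) = hgp ((starRingEnd ℂ) b) ((starRingEnd ℂ) δ) r := by
  unfold hgp
  rw [map_sum]
  refine Finset.sum_congr rfl fun q _ => ?_
  simp

lemma im_bound (μ h : ℝ) (hμ : 0 < μ) (hh : 0 < h) (r : ℕ) (hr : 1 ≤ r) :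
   |(hgp (sgL μ h (-1)) (-(2*h*Complex.I)) r * c13 (sgL μ h (-1))).im| ≤ (8/9) * (h/3) * (h^2/μ)^r * μ ^ (-(4/3):ℝ) := by
  have h1 := JF_hgp μ h hμ r
  have h2 := JF_norm μ h hμ hh r
  set w := hgp (sgL μ h (-1)) (-(2*h*Complex.I)) r * c13 (sgL μ h (-1)) with hw
  have h3 : hgp (sgL μ h 1) (2*h*Complex.I) r * c13 (sgL μ h 1) = (starRingEnd ℂ) w := by
    rw [hw, map_mul, c13_conj μ h hμ, hgp_conj, sgL_conj]
    have : (starRingEnd ℂ) (-(2*h*Complex.I)) = 2*h*Complex.I := by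
      apply Complex.ext <;> simp
    rw [this]
  rw [h3] at h1
  have h4 : ‖(starRingEnd ℂ) w - w‖ = 2 * |w.im| := by
    have : (starRingEnd ℂ) w - w = ((-(2 * w.im) : ℝ):ℂ) * Complex.I := by
      apply Complex.ext <;> simp; ring
    rw [this]; simp
  have h5 : ‖JF μ h r‖ = 3 * cR r * (2 * |w.im|) := by
    obtain ⟨n, rfl⟩ : ∃ n, r = n + 1 := ⟨r - 1, by omega⟩
    have := cR_ge n
    rw [h1, norm_mul, h4, norm_mul, norm_mul, Complex.norm_real, Real.norm_eq_abs, abs_of_nonneg (by linarith : 0 ≤ cR (n+1))]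
    simp
  have h6 : 9/8 ≤ cR r := by
    obtain ⟨n, rfl⟩ : ∃ n, r = n + 1 := ⟨r - 1, by omega⟩
    exact cR_ge n
  have h7 : 9/8 * (6 * |w.im|) ≤ cR r * (6 * |w.im|) := by gcongr
  linarith

lemma hgT_abs (j k : ℕ) : |hgT j k| * 2^k ≤ (Nat.centralBinom (j+k)) * ((j+k).choose k) := by
  induction k with
  | zero =>
    have : hgT j 0 = Nat.centralBinom j := by
      have := hgP_pos j
      unfold hgT
      have h1 := Nat.centralBinom_eq_two_mul_choose j
      rw [h1, Nat.choose_eq_factorial_div_factorial (by omega), Nat.cast_div (Nat.factorial_mul_factorial_dvd_factorial (by omega)) (by positivity)]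
      simp [show 2 * j - j = j by omega]
      field_simp
    rw [this]; simp
  | succ k ih =>
    have e1 : |hgT j (k+1)| = |hgT j k| * ((2*j+k+1)*(j+k+2/3)/((j+k+1)*(k+1))) := by
      have hh : hgT j (k+1) = - (hgT j k * ((2*j+k+1)*(j+k+2/3)/((j+k+1)*(k+1)))) := by
        have := hgP_pos j
        unfold hgT
        rw [show 2*j+(k+1) = 2*j+k+1 by ring, show j+(k+1)=j+k+1 by ring, hgP_succ]
        simp only [Nat.factorial_succ, pow_succ]
        push_cast
        have : (j:ℝ)+k+1 ≠ 0 := by positivity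
        have : (k:ℝ)+1 ≠ 0 := by positivity
        field_simp
      rw [hh, abs_neg, abs_mul]
      congr 1
      exact abs_of_nonneg (by positivity)
    have e2 : (Nat.centralBinom (j+(k+1)) : ℝ) * (j+k+1) = 2*(2*(j+k)+1) * Nat.centralBinom (j+k) := by
      have := Nat.succ_mul_centralBinom_succ (j+k)
      have h2 : ((j+k+1) * Nat.centralBinom (j+k+1) : ℝ) = 2*(2*(j+k)+1)*Nat.centralBinom (j+k) := by exact_mod_cast this
      rw [show j+(k+1)=j+k+1 by ring]; linarith
    have e3 : ((j+(k+1)).choose (k+1) : ℝ) * (k+1) = (j+k+1) * (j+k).choose k := by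
      have := Nat.add_one_mul_choose_eq (j+k) k
      rw [show j+(k+1)=j+k+1 by ring]; exact_mod_cast this.symm
    set A : ℝ := (Nat.centralBinom (j+(k+1)) : ℝ)
    set B : ℝ := ((j+(k+1)).choose (k+1) : ℝ)
    have hp1 : (0:ℝ) < (j+k+1) := by positivity
    have hp2 : (0:ℝ) < (k+1) := by positivity
    rw [e1]
    have e4 : A * B = 2*(2*(j+k)+1) / (k+1) * (Nat.centralBinom (j+k) * ((j+k).choose k)) := by
      have : A * B * ((j+k+1)*(k+1)) = 2*(2*(j+k)+1) * Nat.centralBinom (j+k) * ((j+k+1) * (j+k).choose k) := by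
        rw [← e2, ← e3]; ring
      rw [div_mul_eq_mul_div, eq_div_iff hp2.ne']
      apply mul_right_cancel₀ hp1.ne'
      linarith
    rw [e4]
    have e5 : |hgT j k| * ((2*j+k+1)*(j+k+2/3)/((j+k+1)*(k+1))) * 2^(k+1) = 2 * ((2*j+k+1)*(j+k+2/3)/((j+k+1)*(k+1))) * (|hgT j k| * 2^k) := by ring
    rw [e5]
    apply mul_le_mul _ ih (by positivity) (by positivity)
    rw [← mul_div_assoc, div_le_div_iff₀ (by positivity) (by positivity)]
    have hj : (0:ℝ) ≤ j := by positivity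
    have hk : (0:ℝ) ≤ k := by positivity
    have : (2*(j:ℝ)+k+1)*(j+k+2/3) ≤ (2*(j+k)+1) * (j+k+1) := by nlinarith
    nlinarith

lemma hgp_norm (b δ : ℂ) (r : ℕ) : ‖hgp b δ r‖ ≤ Nat.centralBinom r * (‖b‖ + ‖δ‖/2)^r := by
  unfold hgp
  refine (norm_sum_le _ _).trans ?_
  rw [Commute.add_pow' (Commute.all _ _), Finset.mul_sum]
  refine Finset.sum_le_sum fun q hq => ?_
  rw [Finset.HasAntidiagonal.mem_antidiagonal] at hq
  obtain ⟨j, k⟩ := q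
  simp only at hq ⊢
  subst hq
  have := hgT_abs j k
  rw [norm_mul, norm_mul, norm_pow, norm_pow, Complex.norm_real, Real.norm_eq_abs, nsmul_eq_mul, Nat.choose_symm_add]
  calc |hgT j k| * ‖b‖^j * ‖δ‖^k = (|hgT j k| * 2^k) * (‖b‖^j * (‖δ‖/2)^k) := by
        rw [div_pow]; field_simp
    _ ≤ ((Nat.centralBinom (j+k)) * ((j+k).choose k)) * (‖b‖^j * (‖δ‖/2)^k) := by gcongr
    _ = _ := by ring
end

section
lemma c13_re (b : ℂ) (hb : 0 < b.re) : √3/2 * ‖c13 b‖ ≤ (c13 b).re := by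
  have hb0 : b ≠ 0 := by rintro rfl; simp at hb
  unfold c13
  rw [Complex.cpow_def_of_ne_zero hb0, Complex.norm_exp, Complex.exp_re, mul_comm]
  have him : (Complex.log b * (((-(1/3):ℝ)):ℂ)).im = -(b.arg/3) := by
    rw [Complex.im_mul_ofReal, Complex.log_im]; ring
  rw [him, Real.cos_neg, ← Real.cos_abs, ← Real.cos_pi_div_six]
  gcongr
  have h1 := Complex.abs_arg_le_pi_div_two_iff.2 hb.le
  have hpi := Real.pi_pos
  apply Real.cos_le_cos_of_nonneg_of_le_pi (abs_nonneg _) (by linarith)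
  rw [abs_div, abs_of_pos (by norm_num : (0:ℝ)<3)]; linarith

lemma c13_cube (b : ℂ) (hb : b ≠ 0) : c13 b ^ 3 * b = 1 := by
  unfold c13
  rw [← Complex.cpow_nat_mul]
  have : ((3:ℕ):ℂ) * (((-(1/3):ℝ)):ℂ) = -1 := by push_cast; ring
  rw [this, Complex.cpow_neg_one, inv_mul_cancel₀ hb]

lemma v_small (u v α β A B : ℝ) (hα : 0 ≤ α) (hβ : |β| ≤ 4/10000 * α) (hB : |B| ≤ |A|/1000)
   (hu : u = A*α - B*β) (hv : v = B*α + A*β) : |v| ≤ |u|/500 := by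
  have h1 : |v| ≤ |A| *α*(14/10000) := by
    rw [hv]
    calc |B*α+A*β| ≤ |B| *α + |A| *|β| := by
          refine (abs_add_le _ _).trans ?_
          rw [abs_mul, abs_mul, abs_of_nonneg hα]
      _ ≤ (|A|/1000)*α + |A| *(4/10000*α) := by gcongr
      _ = _ := by ring
  have h2 : |A| *α*(99/100) ≤ |u| := by
    have h3 : |A*α| ≤ |u| + |B*β| := by
      rw [show A*α = u + B*β by rw [hu]; ring]; exact abs_add_le _ _
    rw [abs_mul, abs_mul, abs_of_nonneg hα] at h3
    have : |B| *|β| ≤ (|A|/1000)*(4/10000*α) := by gcongr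
    have : 0 ≤ |A| *α := by positivity
    linarith
  have : 0 ≤ |A| *α := by positivity
  linarith

lemma v_bound (u v h Z : ℝ) (hh : 0 < h) (hvu : |v| ≤ |u|/500) (hZ : u^2+v^2 = Z) (hz : v*(3*u^2-v^2) = h) : |v| * Z ≤ h/3*(1001/1000) := by
  have h1 : v^2 ≤ u^2/250000 := by
    have := mul_le_mul hvu hvu (abs_nonneg _) (by positivity)
    rw [abs_mul_abs_self] at this
    have e : |u|/500*(|u|/500) = u^2/250000 := by rw [← sq_abs u]; ring
    nlinarith
  have h2 : |v| * (3*u^2-v^2) = h := by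
    have h3 : 0 ≤ 3*u^2-v^2 := by nlinarith [sq_nonneg u]
    rw [← abs_of_nonneg h3, ← abs_mul, hz, abs_of_pos hh]
  have h4 : Z * 3 ≤ (3*u^2-v^2)*(1001/1000) := by rw [← hZ]; nlinarith [sq_nonneg u]
  have := mul_le_mul_of_nonneg_left h4 (abs_nonneg v)
  have e : |v| * ((3*u^2-v^2)*(1001/1000)) = h * (1001/1000) := by rw [← h2]; ring
  linarith

lemma est1 (μ h : ℝ) (hμ : 5000 ≤ μ) (hh : 0 < h) (hh2 : h ≤ 26/10) (ξ : ℂ) (b : ℂ) (hb : b = sgL μ h (-1))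
    (hξ : ξ ≠ 0) (him : |ξ.im| ≤ |ξ.re|/1000) (hF : (ξ^3 * (starRingEnd ℂ) b).im = h * ‖b‖^2) (r : ℕ) (hr : 1 ≤ r) :
    |(hgp b (-(2*h*Complex.I)) r * (starRingEnd ℂ) ξ).im| ≤ h/3 * ((8/9) * (h^2/μ)^r * (‖b‖/μ^2) * ‖ξ‖ +
      (1001/1000) * ‖hgp b (-(2*h*Complex.I)) r‖ * ‖b‖ / ‖ξ‖^2) := by
  have hμ0 : 0 < μ := by linarith
  have hbre : 0 < b.re := by rw [hb, sgL_re]; exact hμ0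
  have hb0 : b ≠ 0 := by rintro rfl; simp at hbre
  have hbμ : μ ≤ ‖b‖ := by rw [hb]; exact sgL_norm μ h _ hμ0
  have hbn : 0 < ‖b‖ := by linarith
  set φ := c13 b with hφ
  set p := hgp b (-(2*h*Complex.I)) r with hp
  have hφ3 := c13_cube b hb0
  rw [← hφ] at hφ3
  have hφ0 : φ ≠ 0 := by intro h0; rw [h0] at hφ3; simp at hφ3
  have hf : 0 < ‖φ‖ := norm_pos_iff.2 hφ0
  have hf3 : ‖φ‖^3 * ‖b‖ = 1 := by rw [← norm_pow, ← norm_mul, hφ3, norm_one]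
  have hN : 0 < ‖ξ‖ := norm_pos_iff.2 hξ
  have hw2 : |(p*φ).im| ≤ (8/9) * (h/3) * (h^2/μ)^r * μ ^ (-(4/3):ℝ) := by
    rw [hp, hφ, hb]; exact im_bound μ h hμ0 hh r hr
  -- comparison of mu^(-4/3)
  have hmu : μ ^ (-(4/3):ℝ) ≤ ‖b‖/μ^2 * ‖φ‖ := by
    have e1 : ‖φ‖ = ‖b‖ ^ (-(1/3):ℝ) := by rw [hφ]; unfold c13; rw [Complex.norm_cpow_real]
    rw [e1, div_mul_eq_mul_div, le_div_iff₀ (by positivity)]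
    have e2 : μ ^ (-(4/3):ℝ) * μ^2 = μ ^ (2/3:ℝ) := by
      rw [← Real.rpow_natCast μ 2, ← Real.rpow_add hμ0]; norm_num
    have e3 : ‖b‖ * ‖b‖ ^ (-(1/3):ℝ) = ‖b‖ ^ (2/3:ℝ) := by
      nth_rewrite 1 [← Real.rpow_one ‖b‖]
      rw [← Real.rpow_add hbn]; norm_num
    rw [e2, e3]
    exact Real.rpow_le_rpow hμ0.le hbμ (by norm_num)
  -- real and imaginary parts of φ
  have hre := c13_re b hbre
  rw [← hφ] at hre
  have hs3 : (√3)^2 = 3 := Real.sq_sqrt (by norm_num)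
  have hs3p : 0 < √3 := by positivity
  have hnsq : ‖φ‖^2 = φ.re^2 + φ.im^2 := by
    rw [Complex.sq_norm, Complex.normSq_apply]; ring
  have hα0 : 0 ≤ φ.re := le_trans (by positivity) hre
  have hα2 : 3/4 * ‖φ‖^2 ≤ φ.re^2 := by
    have := mul_le_mul hre hre (by positivity) hα0
    nlinarith
  have hβeq : φ.im * (3*φ.re^2 - φ.im^2) * ‖b‖^2 = h := by
    have e : φ^3 * ‖b‖^2 = (starRingEnd ℂ) b := by
      have := Complex.mul_conj' b
      calc φ^3 * ‖b‖^2 = (φ^3 * b) * (starRingEnd ℂ) b := by rw [← this]; ring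
        _ = _ := by rw [hφ3, one_mul]
    have e2 := congrArg Complex.im e
    rw [hb, sgL_conj, sgL_im, ← hb] at e2
    have e3 : (φ^3 * (‖b‖:ℂ)^2).im = φ.im * (3*φ.re^2 - φ.im^2) * ‖b‖^2 := by
      rw [show (φ^3 * (‖b‖:ℂ)^2) = φ^3 * ((‖b‖^2:ℝ):ℂ) by push_cast; ring, Complex.im_mul_ofReal]
      congr 1
      simp [pow_succ, Complex.mul_im, Complex.mul_re]; ring
    rw [e3] at e2; linarith
  have hβ : |φ.im| ≤ 4/10000 * φ.re := by
    have k1 : 2 * ‖φ‖^2 ≤ 3*φ.re^2 - φ.im^2 := by nlinarith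
    have k2 : |φ.im| * (2*‖φ‖^2) * ‖b‖^2 ≤ h := by
      have : |φ.im| * (3*φ.re^2 - φ.im^2) * ‖b‖^2 = h := by
        have q1 : 0 ≤ 3*φ.re^2 - φ.im^2 := le_trans (by positivity) k1
        rw [← abs_of_pos hh, ← hβeq, abs_mul, abs_mul, abs_of_nonneg q1, abs_of_nonneg (sq_nonneg ‖b‖)]
      rw [← this]; gcongr
    have k3 : |φ.im| * (2*‖b‖) ≤ h * ‖φ‖ := by
      have : |φ.im| * (2*‖φ‖^2) * ‖b‖^2 * ‖φ‖ ≤ h * ‖φ‖ := by gcongr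
      calc |φ.im| * (2*‖b‖) = |φ.im| * (2*‖b‖) * (‖φ‖^3 * ‖b‖) := by rw [hf3, mul_one]
        _ = |φ.im| * (2*‖φ‖^2) * ‖b‖^2 * ‖φ‖ := by ring
        _ ≤ _ := this
    have k4 : |φ.im| * 10000 ≤ |φ.im| * (2*‖b‖) := by gcongr; linarith
    have k5 : ‖φ‖ * (17/20) ≤ φ.re := by
      refine le_trans ?_ hre
      have : (17:ℝ)/10 ≤ √3 := by apply Real.le_sqrt_of_sq_le; norm_num
      nlinarith
    have k6 : h * ‖φ‖ ≤ 26/10 * ‖φ‖ := by gcongr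
    linarith
  set z := ξ * φ with hz
  have hu : z.re = ξ.re*φ.re - ξ.im*φ.im := by rw [hz, Complex.mul_re]
  have hv : z.im = ξ.im*φ.re + ξ.re*φ.im := by rw [hz, Complex.mul_im]; ring
  have hvu := v_small z.re z.im φ.re φ.im ξ.re ξ.im hα0 hβ him hu hv
  have hzn : z.re^2 + z.im^2 = (‖ξ‖*‖φ‖)^2 := by
    rw [← norm_mul, ← hz, Complex.sq_norm, Complex.normSq_apply]; ring
  have hz3 : z.im * (3*z.re^2 - z.im^2) = h := by
    have e1 : (z^3).im = z.im * (3*z.re^2 - z.im^2) := by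
      simp [pow_succ, Complex.mul_im, Complex.mul_re]; ring
    have e2 : z^3 * ((‖b‖^2:ℝ):ℂ) = ξ^3 * (starRingEnd ℂ) b := by
      have := Complex.mul_conj' b
      push_cast
      calc z^3 * ‖b‖^2 = ξ^3 * ((φ^3 * b) * (starRingEnd ℂ) b) := by rw [← this, hz]; ring
        _ = _ := by rw [hφ3, one_mul]
    have e3 := congrArg Complex.im e2
    rw [Complex.im_mul_ofReal, hF, e1] at e3
    exact mul_right_cancel₀ (by positivity) e3
  have hvb := v_bound z.re z.im h _ hh hvu hzn hz3
  -- combine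
  have key : (p * (starRingEnd ℂ) ξ).im * ‖φ‖^2 = (p*φ).im * z.re - (p*φ).re * z.im := by
    have e : p * (starRingEnd ℂ) ξ * ((‖φ‖^2:ℝ):ℂ) = (p*φ) * (starRingEnd ℂ) z := by
      have := Complex.mul_conj' φ
      push_cast
      rw [← this, hz, map_mul]; ring
    have e2 := congrArg Complex.im e
    rw [Complex.im_mul_ofReal, Complex.mul_im (p*φ), Complex.conj_re, Complex.conj_im] at e2
    rw [e2]; ring
  have key2 : |(p * (starRingEnd ℂ) ξ).im| * ‖φ‖^2 ≤ |(p*φ).im| * (‖ξ‖*‖φ‖) + (‖p‖*‖φ‖) * |z.im| := by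
    rw [← abs_of_nonneg (sq_nonneg ‖φ‖), ← abs_mul, key]
    refine (abs_sub _ _).trans ?_
    rw [abs_mul, abs_mul]
    have a1 : |z.re| ≤ ‖ξ‖*‖φ‖ := by rw [← norm_mul]; exact Complex.abs_re_le_norm z
    have a2 : |(p*φ).re| ≤ ‖p‖*‖φ‖ := by rw [← norm_mul]; exact Complex.abs_re_le_norm _
    gcongr
  have key3 : |(p * (starRingEnd ℂ) ξ).im| * ‖φ‖ ≤ |(p*φ).im| * ‖ξ‖ + ‖p‖ * |z.im| := by
    apply le_of_mul_le_mul_right _ hf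
    linarith [key2]
  have t1 : |(p*φ).im| ≤ (8/9) * (h/3) * (h^2/μ)^r * (‖b‖/μ^2) * ‖φ‖ := by
    refine hw2.trans ?_
    have := mul_le_mul_of_nonneg_left hmu (show 0 ≤ (8/9) * (h/3) * (h^2/μ)^r by positivity)
    linarith
  have t2 : |z.im| ≤ (h/3*(1001/1000)) * (‖b‖ / ‖ξ‖^2) * ‖φ‖ := by
    have : |z.im| * (‖ξ‖*‖φ‖)^2 * (‖b‖ * ‖φ‖) ≤ h/3*(1001/1000) * (‖b‖*‖φ‖) := by gcongr
    have e : |z.im| * (‖ξ‖*‖φ‖)^2 * (‖b‖ * ‖φ‖) = |z.im| * ‖ξ‖^2 := by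
      calc _ = |z.im| * ‖ξ‖^2 * (‖φ‖^3 * ‖b‖) := by ring
        _ = _ := by rw [hf3, mul_one]
    rw [e] at this
    rw [mul_div_assoc', div_mul_eq_mul_div, le_div_iff₀ (by positivity)]
    linarith
  apply le_of_mul_le_mul_right _ hf
  have t3 : |(p*φ).im| * ‖ξ‖ ≤ (8/9) * (h/3) * (h^2/μ)^r * (‖b‖/μ^2) * ‖φ‖ * ‖ξ‖ := by gcongr
  have t4 : ‖p‖ * |z.im| ≤ ‖p‖ * ((h/3*(1001/1000)) * (‖b‖ / ‖ξ‖^2) * ‖φ‖) := by gcongr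
  calc _ ≤ _ := key3
    _ ≤ _ := add_le_add t3 t4
    _ = _ := by ring
end

section
lemma cB_le (n : ℕ) (hn : 5 ≤ n) : (Nat.centralBinom n : ℝ) ≤ 4^(n-1) := by
  have : Nat.centralBinom n ≤ 4^(n-1) := by
    induction n, hn using Nat.le_induction with
    | base => decide
    | succ n hn ih =>
      have h := Nat.succ_mul_centralBinom_succ n
      obtain ⟨k, rfl⟩ : ∃ k, n = k + 1 := ⟨n - 1, by omega⟩
      simp only [Nat.add_sub_cancel] at ih ⊢
      have : (k+1+1) * Nat.centralBinom (k+1+1) ≤ (k+1+1) * 4^(k+1) := by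
        rw [h, pow_succ]; nlinarith
      exact Nat.le_of_mul_le_mul_left this (by omega)
  exact_mod_cast this

lemma cov_aux (e : ℕ → ℝ) (M N : ℝ) (hM : 0 < M) (hN : 0 < N) (r : ℕ)
  (est : |e r| ≤ 9/10*(169/25/M)^r*(N/M) + 1001/1000*(Nat.centralBinom r)*(M^(r+1)/N^2))
  (c c' : ℝ) (h1 : N ≤ c * M^(r+1)) (h2 : M^(r+1) ≤ c' * N^2) :
  |e r| ≤ 9/10*(169/25)^r*c + 1001/1000*(Nat.centralBinom r)*c' := by
  refine est.trans ?_
  have a1 : (169/25/M)^r*(N/M) ≤ (169/25)^r*c := by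
    have : (169/25/M)^r*(N/M) = (169/25)^r * (N/M^(r+1)) := by
      rw [div_pow, pow_succ]; field_simp
    rw [this]; gcongr
    rw [div_le_iff₀ (by positivity)]; exact h1
  have a2 : M^(r+1)/N^2 ≤ c' := by rw [div_le_iff₀ (by positivity)]; exact h2
  have a3 := mul_le_mul_of_nonneg_left a2 (show 0 ≤ 1001/1000*(Nat.centralBinom r : ℝ) by positivity)
  linarith

lemma int_zero (x : ℝ) (h : ∃ n : ℤ, x = n) (hx : |x| < 1) : x = 0 := by
  obtain ⟨n, rfl⟩ := h
  have : |n| < 1 := by exact_mod_cast hx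
  rw [Int.abs_lt_one_iff.1 this]; simp

lemma generic_pair (e : ℕ → ℝ) (M N : ℝ) (hM : 5004 ≤ M) (hN : 0 < N)
  (est : ∀ r, 1 ≤ r → |e r| ≤ 9/10*(169/25/M)^r*(N/M) + 1001/1000*(Nat.centralBinom r)*(M^(r+1)/N^2))
  (r : ℕ) (hr : 5 ≤ r) (h1 : M^r ≤ N * (2*7^(r-1))) (h2 : N * (2*7^r) ≤ M^(r+1)) : |e r| < 1 ∧ |e (r+1)| < 1 := by
  have hM0 : 0 < M := by linarith
  have hq : (196/M) ≤ 1/25 := by rw [div_le_div_iff₀ hM0 (by norm_num)]; linarith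
  have hq0 : 0 < 196/M := by positivity
  obtain ⟨k, rfl⟩ : ∃ k, r = k + 5 := ⟨r - 5, by omega⟩
  have hsq : M^(2*k+10) ≤ N^2 * (4*49^(k+4)) := by
    have := mul_le_mul h1 h1 (by positivity) (by positivity)
    calc M^(2*k+10) = M^(k+5) * M^(k+5) := by ring
      _ ≤ _ := this
      _ = N^2*(4*(7^(k+4)*7^(k+4))) := by rw [show k+5-1 = k+4 by omega]; ring
      _ = _ := by rw [← mul_pow]; norm_num
  have hNl : N ≤ 1/(2*7^(k+5)) * M^(k+5+1) := by
    rw [div_mul_eq_mul_div, one_mul, le_div_iff₀ (by positivity)]; exact h2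
  have hpk : (M/196)^(k+4) * (196/M)^(k+4) = 1 := by rw [← mul_pow]; field_simp; simp
  constructor
  · have hc' : M^(k+5+1) ≤ (4*49^(k+4)/M^(k+4)) * N^2 := by
      rw [div_mul_eq_mul_div, le_div_iff₀ (by positivity)]
      calc _ = M^(2*k+10) := by ring
        _ ≤ _ := hsq
        _ = _ := by ring
    have := cov_aux e M N hM0 hN (k+5) (est _ (by omega)) _ _ hNl hc'
    have b1 : 9/10*(169/25:ℝ)^(k+5)*(1/(2*7^(k+5))) ≤ 9/20 := by
      have : (169/25:ℝ)^(k+5) ≤ 7^(k+5) := by gcongr; norm_num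
      rw [mul_one_div, div_le_iff₀ (by positivity)]; linarith
    have b2 : 1001/1000*(Nat.centralBinom (k+5):ℝ)*(4*49^(k+4)/M^(k+4)) ≤ 1/4 := by
      have hcb := cB_le (k+5) (by omega)
      rw [show k+5-1=k+4 by omega] at hcb
      calc _ ≤ 1001/1000*(4^(k+4):ℝ)*(4*49^(k+4)/M^(k+4)) := by gcongr
        _ = 1001/250*(196/M)^(k+4) := by
          rw [div_pow, show (196:ℝ)=4*49 by norm_num, mul_pow]; ring
        _ ≤ 1001/250*(1/25)^(k+4) := by gcongr
        _ ≤ 1001/250*(1/25)^4 := by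
          gcongr 1001/250 * ?_
          exact pow_le_pow_of_le_one (by norm_num) (by norm_num) (by omega)
        _ ≤ 1/4 := by norm_num
    linarith
  · have hNl2 : N ≤ 1/(2*7^(k+5)*M) * M^(k+5+1+1) := by
      refine hNl.trans (le_of_eq ?_)
      rw [pow_succ _ (k+5+1)]; field_simp
    have hc' : M^(k+5+1+1) ≤ (4*49^(k+4)/M^(k+3)) * N^2 := by
      rw [div_mul_eq_mul_div, le_div_iff₀ (by positivity)]
      calc _ = M^(2*k+10) := by ring
        _ ≤ _ := hsq
        _ = _ := by ring
    have := cov_aux e M N hM0 hN (k+5+1) (est _ (by omega)) _ _ hNl2 hc'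
    have b1 : 9/10*(169/25:ℝ)^(k+5+1)*(1/(2*7^(k+5)*M)) ≤ 1/10 := by
      have : (169/25:ℝ)^(k+5) ≤ 7^(k+5) := by gcongr; norm_num
      rw [mul_one_div, div_le_iff₀ (by positivity), pow_succ]
      have p7 : (0:ℝ) < 7^(k+5) := by positivity
      nlinarith
    have b2 : 1001/1000*(Nat.centralBinom (k+5+1):ℝ)*(4*49^(k+4)/M^(k+3)) ≤ 1/4 := by
      have hcb := cB_le (k+5+1) (by omega)
      rw [show k+5+1-1=k+5 by omega] at hcb
      have hq1 : 196/M ≤ 196/5004 := by gcongr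
      calc _ ≤ 1001/1000*(4^(k+5):ℝ)*(4*49^(k+4)/M^(k+3)) := by gcongr
        _ = 1001/1000*16*196*(196/M)^(k+3) := by
          rw [div_pow, show (196:ℝ)=4*49 by norm_num, mul_pow, pow_succ, pow_succ, pow_succ (49:ℝ) (k+3)]; ring
        _ ≤ 1001/1000*16*196*(196/5004)^(k+3) := by gcongr
        _ ≤ 1001/1000*16*196*(196/5004)^3 := by
          gcongr 1001/1000*16*196 * ?_
          exact pow_le_pow_of_le_one (by norm_num) (by norm_num) (by omega)
        _ ≤ 1/4 := by norm_num
    linarith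

lemma coverage (e : ℕ → ℝ) (M N : ℝ) (hM : 5004 ≤ M) (hN : 199/100*M ≤ N)
  (est : ∀ r, 1 ≤ r → |e r| ≤ 9/10*(169/25/M)^r*(N/M) + 1001/1000*(Nat.centralBinom r)*(M^(r+1)/N^2))
  (hinte : ∀ r, ∃ n : ℤ, e r = n) (h2 : ∃ n : ℤ, e 2 = 3 * n) (h4 : ∃ n : ℤ, e 4 = 5 * n)
  (hz : ∀ r, e r = 0 → e (r+1) = 0 → False) (hz1 : e 1 ≠ 0) (hz2 : e 2 ≠ 0) : False := by
  have hM0 : 0 < M := by linarith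
  have hN0 : 0 < N := by nlinarith
  have M2 : 5004*M ≤ M^2 := by nlinarith
  have M3 : 5004*M^2 ≤ M^3 := by
    have := mul_le_mul_of_nonneg_left hM (sq_nonneg M); nlinarith
  have M4 : 5004*M^3 ≤ M^4 := by
    have := mul_le_mul_of_nonneg_left hM (show 0 ≤ M^3 by positivity); nlinarith
  have M5 : 5004*M^4 ≤ M^5 := by
    have := mul_le_mul_of_nonneg_left hM (show 0 ≤ M^4 by positivity); nlinarith
  have M6 : 5004*M^5 ≤ M^6 := by
    have := mul_le_mul_of_nonneg_left hM (show 0 ≤ M^5 by positivity); nlinarith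
  have c1 : Nat.centralBinom 1 = 2 := by decide
  have c2 : Nat.centralBinom 2 = 6 := by decide
  have c3 : Nat.centralBinom 3 = 20 := by decide
  have c4 : Nat.centralBinom 4 = 70 := by decide
  have c5 : Nat.centralBinom 5 = 252 := by decide
  have h3z : |e 2| < 3 → False := by
    intro h
    obtain ⟨n, hn⟩ := h2
    apply hz2
    have := int_zero (e 2/3) ⟨n, by rw [hn]; ring⟩ (by rw [abs_div, abs_of_pos (by norm_num : (0:ℝ)<3)]; linarith)
    linarith
  have sqN : ∀ c : ℝ, 0 ≤ c → c ≤ N → c^2 ≤ N^2 := fun c h0 h => by gcongr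
  by_cases a1 : N ≤ 1/14*M^2
  · have hs := sqN _ (by positivity) hN
    have := cov_aux e M N hM0 hN0 1 (est 1 le_rfl) (1/14) (1/(199/100)^2) a1 (by norm_num at hs ⊢; linarith)
    rw [c1] at this
    exact hz1 (int_zero _ (hinte 1) (by norm_num at this; linarith))
  push Not at a1
  have hs1 := sqN _ (by positivity) a1.le
  by_cases a2 : N ≤ 1/16*M^3
  · by_cases a3 : N ≤ M^2
    · have := cov_aux e M N hM0 hN0 2 (est 2 (by norm_num)) (1/5004) (1/4) (by linarith) (by nlinarith)
      rw [c2] at this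
      exact h3z (by norm_num at this; linarith)
    · push Not at a3
      have hs := sqN _ (by positivity) a3.le
      have := cov_aux e M N hM0 hN0 2 (est 2 (by norm_num)) (1/16) (1/5004) a2 (by nlinarith)
      rw [c2] at this
      exact h3z (by norm_num at this; linarith)
  push Not at a2
  have hs2 := sqN _ (by positivity) a2.le
  by_cases a3 : N ≤ 17*M^3
  · have k1 := cov_aux e M N hM0 hN0 3 (est 3 (by norm_num)) (17/5004) (1/10000) (by linarith) (by
      norm_num; nlinarith)
    have k2 := cov_aux e M N hM0 hN0 4 (est 4 (by norm_num)) (17/5004^2) (1/16) (by norm_num; linarith) (by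
      norm_num; nlinarith)
    rw [c3] at k1
    rw [c4] at k2
    have z3 := int_zero _ (hinte 3) (by norm_num at k1; linarith)
    obtain ⟨n, hn⟩ := h4
    have z4 := int_zero (e 4/5) ⟨n, by rw [hn]; ring⟩ (by
      rw [abs_div, abs_of_pos (by norm_num : (0:ℝ)<5)]; norm_num at k2; linarith)
    exact hz 3 z3 (by linarith)
  push Not at a3
  have hs3 := sqN _ (by positivity) a3.le
  by_cases a4 : N ≤ 1/4200*M^5
  · have k1 := cov_aux e M N hM0 hN0 4 (est 4 (by norm_num)) (1/4200) (1/1000000) (by linarith) (by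
      norm_num; nlinarith)
    have k2 := cov_aux e M N hM0 hN0 5 (est 5 (by norm_num)) (1/4200/5004) (1/289) (by norm_num; linarith) (by
      norm_num; nlinarith)
    rw [c4] at k1
    rw [c5] at k2
    exact hz 4 (int_zero _ (hinte 4) (by norm_num at k1; linarith)) (int_zero _ (hinte 5) (by norm_num at k2; linarith))
  push Not at a4
  -- generic
  have hex : ∃ r : ℕ, N * (2*7^r) ≤ M^(r+1) := by
    have : Filter.Tendsto (fun r : ℕ => (M/7)^r) Filter.atTop Filter.atTop := tendsto_pow_atTop_atTop_of_one_lt (by linarith)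
    obtain ⟨r, hr⟩ := (this.eventually_ge_atTop (2*N)).exists
    refine ⟨r, ?_⟩
    rw [div_pow, le_div_iff₀ (by positivity)] at hr
    have : M^r ≤ M^(r+1) := pow_le_pow_right₀ (by linarith) (by omega)
    linarith
  classical
  have hr := Nat.find_spec hex
  have hr' := fun k => Nat.find_min hex (m := k)
  set r := Nat.find hex
  have lower : ∀ k : ℕ, k ≤ 4 → ¬ (N * (2*7^k) ≤ M^(k+1)) := by
    intro k hk
    have M1 : (0:ℝ) < M^5 := by positivity
    interval_cases k <;> norm_num <;> nlinarith
  have hr5 : 5 ≤ r := by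
    by_contra hlt
    exact lower r (by omega) hr
  have hm1 := hr' (r-1) (by omega)
  push Not at hm1
  rw [show r - 1 + 1 = r by omega] at hm1
  obtain ⟨g1, g2⟩ := generic_pair e M N hM hN0 est r hr5 hm1.le hr
  exact hz r (int_zero _ (hinte r) g1) (int_zero _ (hinte (r+1)) g2)
end

section
noncomputable def pR (m : ℤ) (r : ℕ) : ℂ := hgp (m - 3 * wOm) (-3 * (2 * wOm + 1)) r
noncomputable def xiC (x y : ℤ) : ℂ := x - y * wOm
noncomputable def eR (m x y : ℤ) (r : ℕ) : ℝ := 2/√3 * (pR m r * (starRingEnd ℂ) (xiC x y)).im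

lemma wOm_re : wOm.re = -1/2 := rfl
lemma wOm_im : wOm.im = √3/2 := rfl

lemma eR_val (m x y : ℤ) (r : ℕ) (X Y : ℤ) (h : pR m r = X + Y * wOm) : eR m x y r = ((X * y + Y * x : ℤ) : ℝ) := by
  unfold eR
  rw [h]
  have : ((((X:ℂ) + Y * wOm)) * (starRingEnd ℂ) (xiC x y)).im = √3/2 * (X*y+Y*x) := by
    unfold xiC
    simp [Complex.mul_im, Complex.mul_re, wOm_re, wOm_im]; ring
  rw [this]
  have : √3 ≠ 0 := by positivity
  push_cast
  field_simp

lemma eR_int (m x y : ℤ) (r : ℕ) : ∃ n : ℤ, eR m x y r = n := by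
  obtain ⟨X, Y, h⟩ := hgp_int m r
  exact ⟨_, eR_val m x y r X Y h⟩

lemma eR_int4 (m x y : ℤ) : ∃ n : ℤ, eR m x y 4 = 5 * n := by
  obtain ⟨z, ⟨X, Y, hz⟩, h⟩ := hgp_int4 m
  refine ⟨X*y+Y*x, ?_⟩
  rw [eR_val m x y 4 (5*X) (5*Y) (by unfold pR; rw [h, hz]; push_cast; ring)]
  push_cast; ring

lemma eR_zero (m x y : ℤ) : eR m x y 0 = y := by
  rw [eR_val m x y 0 1 0 (by unfold pR; rw [hgp_zero]; simp)]; simp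

lemma eR_one (m x y : ℤ) : eR m x y 1 = ((2*((m+1)*y-x) : ℤ):ℝ) := by
  rw [eR_val m x y 1 (2*m+2) (-2) (by unfold pR; rw [hgp_one]; push_cast; ring)]
  congr 1; ring

lemma eR_two (m x y : ℤ) : eR m x y 2 = 3 * (((2*m^2+5*m+7)*y - (2*m+3)*x : ℤ):ℝ) := by
  rw [eR_val m x y 2 (3*(2*m^2+5*m+7)) (-(3*(2*m+3))) (by
    unfold pR; rw [hgp_two]; push_cast; linear_combination (-16 : ℂ) * wOm_sq)]
  push_cast; ring

noncomputable abbrev hh0 : ℝ := 3*√3/2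

lemma b_sgL (m : ℤ) : (m:ℂ) - 3 * wOm = sgL (m+3/2) hh0 (-1) := by
  apply Complex.ext
  · rw [sgL_re]; simp [wOm_re]; ring
  · rw [sgL_im]; simp [wOm_im]; ring
lemma d_sgL : (-3:ℂ) * (2 * wOm + 1) = -(2*(hh0:ℂ)*Complex.I) := by
  apply Complex.ext <;> simp [wOm_re, wOm_im]
  all_goals ring
lemma hh0_sq : hh0^2 = 27/4 := by
  have : (√3)^2 = 3 := Real.sq_sqrt (by norm_num)
  unfold hh0; nlinarith

lemma eR_rec (m x y : ℤ) (n : ℕ) : ∃ A B : ℝ, 0 < B ∧ eR m x y (n+2) = A * eR m x y (n+1) + B * eR m x y n := by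
  have h := hgp_rec ((m:ℂ) - 3 * wOm) ((-3:ℂ) * (2 * wOm + 1)) n
  have e1 : 2 * ((m:ℂ) - 3 * wOm) - (-3:ℂ) * (2 * wOm + 1) = ((2*m+3:ℝ):ℂ) := by push_cast; ring
  have e2 : ((-3:ℂ) * (2 * wOm + 1))^2 = ((-27:ℝ):ℂ) := by push_cast; linear_combination 36 * wOm_sq
  rw [e1, e2] at h
  have hp : (0:ℝ) < (((n+1)^2-1/9)/((n+1)*(n+2)):ℝ) := by
    have : (0:ℝ) ≤ n := by positivity
    apply div_pos
    · nlinarith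
    · positivity
  refine ⟨((2*n+3)/(n+2):ℝ) * (2*m+3), (((n+1)^2-1/9)/((n+1)*(n+2)):ℝ) * 27, by positivity, ?_⟩
  unfold eR
  have h' : pR m (n+2) * (starRingEnd ℂ) (xiC x y) = ((((2*n+3)/(n+2):ℝ) * (2*m+3) : ℝ):ℂ) * (pR m (n+1) * (starRingEnd ℂ) (xiC x y))
    + (((((n+1)^2-1/9)/((n+1)*(n+2)):ℝ) * 27 : ℝ):ℂ) * (pR m n * (starRingEnd ℂ) (xiC x y)) := by
    unfold pR
    rw [h, Complex.ofReal_mul, Complex.ofReal_mul, Complex.ofReal_neg]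
    push_cast
    ring
  rw [h', Complex.add_im, Complex.im_ofReal_mul, Complex.im_ofReal_mul]
  ring

lemma eR_nonzero (m x y : ℤ) (hy : y ≠ 0) (r : ℕ) : eR m x y r = 0 → eR m x y (r+1) = 0 → False := by
  induction r with
  | zero =>
    intro h _
    rw [eR_zero] at h
    exact hy (by exact_mod_cast h)
  | succ n ih =>
    intro h1 h2
    obtain ⟨A, B, hB, h⟩ := eR_rec m x y n
    rw [h2, h1] at h
    apply ih _ h1
    have : B * eR m x y n = 0 := by linarith
    rcases mul_eq_zero.1 this with h | h
    · linarith
    · exact h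

lemma eR_one_ne (m x y : ℤ) (hm : 5000 ≤ m) (hF : x^3-m*x^2*y-(m+3)*x*y^2-y^3 = m^2+3*m+9) : eR m x y 1 ≠ 0 := by
  rw [eR_one]
  intro h
  have h0 : (2*((m+1)*y-x) : ℤ) = 0 := by exact_mod_cast h
  have hx : x = (m+1)*y := by linarith
  subst hx
  have h1 : (2*m+3) * (-4*y^3-(2*m+3)) = 27 := by linear_combination 4*hF
  have h2 : (2*m+3) ∣ 27 := ⟨_, h1.symm⟩
  have := Int.le_of_dvd (by norm_num) h2
  linarith

lemma eR_two_ne (m x y : ℤ) (hm : 5000 ≤ m) (hF : x^3-m*x^2*y-(m+3)*x*y^2-y^3 = m^2+3*m+9) : eR m x y 2 ≠ 0 := by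
  rw [eR_two]
  intro h
  have h0 : (2*m^2+5*m+7)*y - (2*m+3)*x = 0 := by
    have : (((2*m^2+5*m+7)*y - (2*m+3)*x : ℤ):ℝ) = 0 := by linarith
    exact_mod_cast this
  obtain ⟨s, hs⟩ : ∃ s, s = x - (m+1)*y := ⟨_, rfl⟩
  have h4y : 4*y = (2*m+3)*s := by rw [hs]; linarith
  have h4x : 4*x = (2*m^2+5*m+7)*s := by linear_combination 4*hs.symm + (m+1)*h4y
  have h5 : (4*x)^3-m*(4*x)^2*(4*y)-(m+3)*(4*x)*(4*y)^2-(4*y)^3 = 64*(m^2+3*m+9) := by linear_combination 64*hF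
  rw [h4x, h4y] at h5
  have h6 : s^3*(28*m^2+84*m+127) = 64*(m^2+3*m+9) := by linear_combination h5
  have hm2 : 5000*m ≤ m^2 := by nlinarith
  rcases le_or_gt s 1 with h | h
  · have : s^3 ≤ 1 := by
      rcases le_or_gt s 0 with h0 | h0
      · nlinarith [sq_nonneg s]
      · have : s = 1 := by omega
        subst this; norm_num
    nlinarith
  · have : 8 ≤ s^3 := by
      have : (2:ℤ)^3 ≤ s^3 := by gcongr; omega
      linarith
    nlinarith

lemma xi_re (x y : ℤ) : (xiC x y).re = x + y/2 := by unfold xiC; simp [wOm_re]; ring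
lemma xi_im (x y : ℤ) : (xiC x y).im = -(y*(√3/2)) := by unfold xiC; simp [wOm_im]

lemma est2 (m x y : ℤ) (hm : 5000 ≤ m) (hF : x^3-m*x^2*y-(m+3)*x*y^2-y^3 = m^2+3*m+9)
   (hbig : 4000 * |(y:ℝ)| ≤ |(x:ℝ)+y/2|) (hx : (x:ℝ)+y/2 ≠ 0) (r : ℕ) (hr : 1 ≤ r) :
   |eR m x y r| ≤ 9/10*(169/25/((m:ℝ)+9/2))^r*(‖xiC x y‖/((m:ℝ)+9/2)) + 1001/1000*(Nat.centralBinom r)*(((m:ℝ)+9/2)^(r+1)/‖xiC x y‖^2) := by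
  have hmR : (5000:ℝ) ≤ m := by exact_mod_cast hm
  have hs3 : (√3)^2 = 3 := Real.sq_sqrt (by norm_num)
  have hs3p : 0 < √3 := by positivity
  have hs3u : √3 ≤ 1733/1000 := by rw [Real.sqrt_le_left (by norm_num)]; norm_num
  have hξ : xiC x y ≠ 0 := by
    intro h; apply hx; rw [← xi_re, h]; simp
  have hnb : ‖(m:ℂ) - 3 * wOm‖^2 = (m:ℝ)^2+3*m+9 := by
    rw [Complex.sq_norm, Complex.normSq_apply]; simp [wOm_re, wOm_im]; nlinarith
  have hnb1 : ‖(m:ℂ) - 3 * wOm‖ ≤ m + 8/5 := by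
    apply abs_le_of_sq_le_sq' _ (by linarith) |>.2
    rw [hnb]; nlinarith
  have h1 := est1 (m+3/2) hh0 (by linarith) (by unfold hh0; positivity) (by unfold hh0; linarith) (xiC x y) ((m:ℂ) - 3 * wOm) (b_sgL m) hξ
    (by
      rw [xi_re, xi_im, abs_neg, abs_mul, abs_of_pos (by positivity : 0 < √3/2)]
      have := abs_nonneg (y:ℝ)
      nlinarith) (by
      rw [hnb]
      have hF' : (x:ℝ)^3-m*x^2*y-(m+3)*x*y^2-y^3 = m^2+3*m+9 := by exact_mod_cast hF
      rw [← hF']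
      unfold xiC hh0
      simp [pow_succ, Complex.mul_im, Complex.mul_re, wOm_re, wOm_im]
      have e3 : √3*√3 = 3 := by nlinarith
      have e33 : √3*√3*√3 = 3*√3 := by rw [e3]
      ring_nf
      have q3 : √3^3 = 3*√3 := by rw [pow_succ, hs3]
      have q4 : √3^4 = 9 := by rw [show √3^4 = (√3^2)^2 by ring, hs3]; norm_num
      rw [q3]
      try rw [hs3]
      try rw [q4]
      ring) r hr
  rw [← d_sgL] at h1
  have hp := hgp_norm ((m:ℂ) - 3 * wOm) (-3 * (2 * wOm + 1)) r
  have hd : ‖(-3:ℂ) * (2 * wOm + 1)‖ = 2*hh0 := by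
    rw [d_sgL]; simp [abs_of_pos hs3p]
  rw [hd] at hp
  change |(pR m r * _).im| ≤ _ at h1
  change ‖pR m r‖ ≤ _ at hp
  set M : ℝ := (m:ℝ)+9/2 with hM
  have hM0 : 0 < M := by linarith
  have hμ : (0:ℝ) < m+3/2 := by linarith
  have hp2 : ‖pR m r‖ ≤ Nat.centralBinom r * M^r := by
    refine hp.trans ?_
    gcongr
    unfold hh0; linarith
  have hN : 0 < ‖xiC x y‖ := norm_pos_iff.2 hξ
  have he : |eR m x y r| = 2/√3 * |(pR m r * (starRingEnd ℂ) (xiC x y)).im| := by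
    unfold eR; rw [abs_mul, abs_of_pos (by positivity)]
  have hc : 2/√3 * (hh0/3) = 1 := by unfold hh0; field_simp
  have h2 : |eR m x y r| ≤ (8/9) * (hh0^2/(m+3/2))^r * (‖(m:ℂ) - 3 * wOm‖/(m+3/2)^2) * ‖xiC x y‖ +
      (1001/1000) * ‖hgp ((m:ℂ) - 3 * wOm) (-3 * (2 * wOm + 1)) r‖ * ‖(m:ℂ) - 3 * wOm‖ / ‖xiC x y‖^2 := by
    rw [he]
    have := mul_le_mul_of_nonneg_left h1 (show 0 ≤ 2/√3 by positivity)
    rw [← mul_assoc, hc, one_mul] at this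
    exact this
  change _ ≤ _ + (1001/1000) * ‖pR m r‖ * _ / _ at h2
  rw [hh0_sq] at h2
  have k1 : 27/4/((m:ℝ)+3/2) ≤ 169/25/M := by
    rw [div_le_div_iff₀ hμ hM0]; rw [hM]; linarith
  have k2 : (8/9) * (‖(m:ℂ) - 3 * wOm‖/((m:ℝ)+3/2)^2) ≤ 9/10*(1/M) := by
    rw [mul_div_assoc', mul_one_div, div_le_div_iff₀ (by positivity) hM0]
    calc 8/9*‖(m:ℂ) - 3 * wOm‖*M ≤ 8/9*(m+8/5)*M := by gcongr
      _ ≤ 9/10*((m:ℝ)+3/2)^2 := by rw [hM]; nlinarith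
  have t1 : (8/9) * (27/4/((m:ℝ)+3/2))^r * (‖(m:ℂ) - 3 * wOm‖/(m+3/2)^2) * ‖xiC x y‖ ≤ 9/10*(169/25/M)^r*(‖xiC x y‖/M) := by
    calc _ = (27/4/((m:ℝ)+3/2))^r * ((8/9) * (‖(m:ℂ) - 3 * wOm‖/((m:ℝ)+3/2)^2)) * ‖xiC x y‖ := by ring
      _ ≤ (169/25/M)^r * (9/10*(1/M)) * ‖xiC x y‖ := by gcongr
      _ = _ := by ring
  have t2 : (1001/1000) * ‖pR m r‖ * ‖(m:ℂ) - 3 * wOm‖ / ‖xiC x y‖^2 ≤ 1001/1000*(Nat.centralBinom r)*(M^(r+1)/‖xiC x y‖^2) := by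
    calc _ ≤ (1001/1000) * (Nat.centralBinom r * M^r) * M / ‖xiC x y‖^2 := by
          gcongr
          linarith
      _ = _ := by rw [pow_succ]; ring
  linarith

lemma part1_y1 (m c : ℤ) (hm : 5000 ≤ m) (h1 : -30 ≤ c) (h2 : c ≤ 30) (h : m*(c-2)*(m+2*c+3) = -c^3+3*c+10) : False := by
  have hm2 : 5000*m ≤ m^2 := by nlinarith
  have hc3 : -100000 ≤ -c^3+3*c+10 ∧ -c^3+3*c+10 ≤ 100000 := by
    have := sq_nonneg c
    have : c^2 ≤ 900 := by nlinarith
    constructor <;> nlinarith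
  have hp : 100001 ≤ m*(m+2*c+3) := by nlinarith
  rcases lt_trichotomy c 2 with h' | h' | h'
  · nlinarith
  · subst h'; norm_num at h
  · nlinarith

lemma part1_y2 (m c : ℤ) (hm : 5000 ≤ m) (h1 : -30 ≤ c) (h2 : c ≤ 30) (h : m*c*(m+2*c-1) = -c^3+3*c-8) : False := by
  have hm2 : 5000*m ≤ m^2 := by nlinarith
  have hc3 : -100000 ≤ -c^3+3*c-8 ∧ -c^3+3*c-8 ≤ 100000 := by
    have := sq_nonneg c
    have : c^2 ≤ 900 := by nlinarith
    constructor <;> nlinarith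
  have hp : 100001 ≤ m*(m+2*c-1) := by nlinarith
  rcases lt_trichotomy c 0 with h' | h' | h'
  · nlinarith
  · subst h'; norm_num at h
  · nlinarith

theorem part1 (m x y : ℤ) (hm : 5000 ≤ m) (ρ0 : ℝ) (hgt : (m:ℝ) + 1 < ρ0) (hlt : ρ0 < (m:ℝ) + 3) (hy : y ≠ 0)
    (hF : x^3-m*x^2*y-(m+3)*x*y^2-y^3 = m^2+3*m+9) (hη : |(x:ℝ) - y*ρ0| * (y:ℝ)^2 ≤ 18) : False := by
  have hmR : (5000:ℝ) ≤ m := by exact_mod_cast hm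
  by_cases hy1 : |y| = 1
  · rcases (abs_eq (by norm_num)).1 hy1 with h | h
    · subst h
      norm_num at hη
      rw [abs_le] at hη
      have c1 : (-30:ℝ) ≤ ((x - m : ℤ):ℝ) := by push_cast; linarith
      have c2 : ((x - m : ℤ):ℝ) ≤ 30 := by push_cast; linarith
      exact part1_y1 m (x-m) hm (by exact_mod_cast c1) (by exact_mod_cast c2) (by linear_combination hF)
    · subst h
      norm_num at hη
      rw [abs_le] at hη
      have c1 : (-30:ℝ) ≤ ((-x - m : ℤ):ℝ) := by push_cast; linarith
      have c2 : ((-x - m : ℤ):ℝ) ≤ 30 := by push_cast; linarith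
      exact part1_y2 m (-x-m) hm (by exact_mod_cast c1) (by exact_mod_cast c2) (by linear_combination -hF)
  · have hy2 : 2 ≤ |y| := by
      have := abs_pos.2 hy
      omega
    have hy2R : (2:ℝ) ≤ |(y:ℝ)| := by exact_mod_cast hy2
    have hη2 : |(x:ℝ) - y*ρ0| ≤ 9/2 := by
      have : (4:ℝ) ≤ (y:ℝ)^2 := by rw [← sq_abs]; nlinarith
      have h0 := abs_nonneg ((x:ℝ) - y*ρ0)
      nlinarith
    have hlow : |(y:ℝ)| * ((m:ℝ)+3/2) - 9/2 ≤ |(x:ℝ)+(y:ℝ)/2| := by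
      have e : |(y:ℝ)*(ρ0+1/2)| ≤ |(x:ℝ)+y/2| + |(x:ℝ) - y*ρ0| := by
        rw [show (y:ℝ)*(ρ0+1/2) = ((x:ℝ)+y/2) - ((x:ℝ) - y*ρ0) by ring]
        exact abs_sub _ _
      rw [abs_mul, abs_of_pos (by linarith : 0 < ρ0+1/2)] at e
      have : |(y:ℝ)| * (m+3/2) ≤ |(y:ℝ)| * (ρ0+1/2) := mul_le_mul_of_nonneg_left (by linarith) (abs_nonneg _)
      linarith
    have hbig : 4000 * |(y:ℝ)| ≤ |(x:ℝ)+y/2| := by nlinarith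
    have hx0 : (x:ℝ)+y/2 ≠ 0 := by
      intro h; rw [h, abs_zero] at hbig; linarith
    have hN : 199/100*((m:ℝ)+9/2) ≤ ‖xiC x y‖ := by
      have := Complex.abs_re_le_norm (xiC x y)
      rw [xi_re] at this
      nlinarith
    exact coverage (eR m x y) ((m:ℝ)+9/2) ‖xiC x y‖ (by linarith) hN (fun r hr => est2 m x y hm hF hbig hx0 r hr)
      (eR_int m x y) ⟨_, eR_two m x y⟩ (eR_int4 m x y) (eR_nonzero m x y hy) (eR_one_ne m x y hm hF) (eR_two_ne m x y hm hF)
end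

section
lemma cube_case (m x : ℤ) (hm : -1 ≤ m) (h : x^3 = m^2+3*m+9) : m = 3 ∧ x = 3 := by
  have key : (m+6)^3 + (3-m)^3 = (3*x)^3 := by linear_combination (-27)*h
  have fl := fermatLastTheoremFor_iff_int.1 fermatLastTheoremThree
  have hx : x ≠ 0 := by
    rintro rfl
    nlinarith
  have h3 : 3 - m = 0 := by
    by_contra h3
    exact fl (m+6) (3-m) (3*x) (by omega) h3 (by omega) key
  have hm3 : m = 3 := by omega
  refine ⟨hm3, ?_⟩
  subst hm3
  norm_num at h
  have h0 : (x-3)*(x^2+3*x+9) = 0 := by linear_combination h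
  rcases mul_eq_zero.1 h0 with h1 | h1
  · omega
  · nlinarith [sq_nonneg (2*x+3)]

lemma neg_case1 (m X Y : ℤ) (hm : -1 ≤ m) (hY : 0 < Y) (hX : 2*Y ≤ X) : 0 < X^3+m*X^2*Y-(m+3)*X*Y^2+Y^3 := by
  obtain ⟨k, rfl⟩ : ∃ k, X = 2*Y+k := ⟨X-2*Y, by ring⟩
  have hk : 0 ≤ k := by omega
  have e : (2*Y+k)^3+m*(2*Y+k)^2*Y-(m+3)*(2*Y+k)*Y^2+Y^3 = Y^3*(2*m+3) + k*Y^2*(9+3*m) + k^2*Y*(6+m)+k^3 := by ring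
  rw [e]
  have h1 : 0 < 2*m+3 := by omega
  have h2 : 0 < 9+3*m := by omega
  have h3 : 0 < 6+m := by omega
  positivity

lemma neg_case2 (m X Y : ℤ) (hm : -1 ≤ m) (hY : 0 < Y) (hX : 2*Y ≤ X) (hP : 2*m+3 ≤ X*Y*(X-Y))
   (h : X^3+m*X^2*Y-(m+3)*X*Y^2+Y^3 = m^2+3*m+9) : False := by
  rcases le_or_gt 3 m with h3 | h3
  · have e : m*(X*Y*(X-Y)) + (X^3-3*X*Y^2+Y^3) = m^2+3*m+9 := by linear_combination h
    have h1 : m*(2*m+3) ≤ m*(X*Y*(X-Y)) := mul_le_mul_of_nonneg_left hP (by omega)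
    have h2 : 0 < X^3-3*X*Y^2+Y^3 := by
      have := neg_case1 0 X Y (by norm_num) hY hX
      linarith
    nlinarith
  · obtain ⟨k, rfl⟩ : ∃ k, X = 2*Y+k := ⟨X-2*Y, by ring⟩
    have hk : 0 ≤ k := by omega
    have e : Y^3*(2*m+3) + k*Y^2*(9+3*m) + k^2*Y*(6+m)+k^3 = m^2+3*m+9 := by linear_combination h
    have p1 : 0 < 2*m+3 := by omega
    have p2 : 0 < 9+3*m := by omega
    have p3 : 0 < 6+m := by omega
    rcases le_or_gt 2 Y with hY2 | hY2
    · have : 8 ≤ Y^3 := by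
        have : (2:ℤ)^3 ≤ Y^3 := by gcongr
        linarith
      have q1 : 8*(2*m+3) ≤ Y^3*(2*m+3) := mul_le_mul_of_nonneg_right this p1.le
      have q2 : 0 ≤ k*Y^2*(9+3*m) + k^2*Y*(6+m)+k^3 := by positivity
      interval_cases m <;> linarith
    · have hY1 : Y = 1 := by omega
      subst hY1
      rcases le_or_gt 1 k with hk1 | hk1
      · have : 1 ≤ k^2 := by nlinarith
        have : 1 ≤ k^3 := by nlinarith
        interval_cases m <;> nlinarith
      · have : k = 0 := by omega
        subst this
        interval_cases m <;> norm_num at e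

lemma core_bound (m x y ρ : ℝ) (hm : -1 ≤ m) (hm3 : 3 ≤ m ∨ m ≤ 2) (hroot : ρ^3 - m*ρ^2-(m+3)*ρ-1 = 0)
   (hgt : m + 1 < ρ) (hlo : 123/100 < ρ)
   (hxy : 0 < x*y) (hle : |y| ≤ |x|) (hF : x^3-m*x^2*y-(m+3)*x*y^2-y^3 = m^2+3*m+9)
   (hneg : y < 0 → 2*m+3 ≤ -(x*y*(x+y))) : |x-y*ρ| * y^2 ≤ 18 := by
  have hρ : 0 < ρ := by linarith
  have hfac : (x-y*ρ) * ((x + y/(1+ρ))*(x+y+y/ρ)) = m^2+3*m+9 := by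
    rw [← hF]
    have e : (x-y*ρ) * ((x + y/(1+ρ))*(x+y+y/ρ)) = (x-y*ρ)*(((1+ρ)*x+y)*(ρ*(x+y)+y))/((1+ρ)*ρ) := by
      field_simp
    rw [e, div_eq_iff (by positivity)]
    linear_combination -(x^2*y+x*y^2)*hroot
  have hD : 0 < m^2+3*m+9 := by nlinarith [sq_nonneg (2*m+3)]
  have hG : x*(x+y) ≤ (x + y/(1+ρ))*(x+y+y/ρ) := by
    have e : (x + y/(1+ρ))*(x+y+y/ρ) = x*(x+y) + (x*y/ρ + x*y/(1+ρ) + y^2/(1+ρ) + y^2/((1+ρ)*ρ)) := by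
      field_simp; ring
    rw [e]
    have : 0 ≤ (x*y/ρ + x*y/(1+ρ) + y^2/(1+ρ) + y^2/((1+ρ)*ρ)) := by positivity
    linarith
  have hxx : 0 < x*(x+y) := by nlinarith [sq_nonneg x]
  set G := (x + y/(1+ρ))*(x+y+y/ρ)
  have hG0 : 0 < G := by linarith
  have hpos : 0 < x-y*ρ := by
    by_contra hc
    push Not at hc
    nlinarith
  have hle2 : (x-y*ρ)*(x*(x+y)) ≤ m^2+3*m+9 := by
    rw [← hfac]; gcongr
  rw [abs_of_pos hpos]
  have hDρ : m^2+3*m+9 ≤ 18*(ρ*(ρ+1)) := by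
    rcases hm3 with h | h
    · nlinarith
    · nlinarith
  rcases lt_or_gt_of_ne (show y ≠ 0 by rintro rfl; simp at hxy) with hy | hy
  · have hx : x < 0 := by nlinarith
    rw [abs_of_neg hy, abs_of_neg hx] at hle
    rcases hm3 with h3 | h3
    · have hP := hneg hy
      obtain ⟨X, rfl⟩ : ∃ X, x = -X := ⟨-x, by ring⟩
      obtain ⟨Y, rfl⟩ : ∃ Y, y = -Y := ⟨-y, by ring⟩
      have hX : 0 < X := by linarith
      have hY : 0 < Y := by linarith
      set d := -X - -Y*ρ with hd
      have k1 : d*(2*m+3) ≤ (m^2+3*m+9)*Y := by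
        calc d*(2*m+3) ≤ d*(X*Y*(X+Y)) := mul_le_mul_of_nonneg_left (by linarith) hpos.le
          _ = d*(-X*(-X + -Y))*Y := by ring
          _ ≤ _ := by gcongr
      have k2 : d ≤ 3/4*(m+1)*Y := by
        have : (m^2+3*m+9)*Y ≤ (3/4*(m+1)*Y)*(2*m+3) := by
          have : m^2+3*m+9 ≤ (3/4*(m+1))*(2*m+3) := by nlinarith
          calc _ ≤ (3/4*(m+1))*(2*m+3)*Y := by gcongr
            _ = _ := by ring
        exact le_of_mul_le_mul_right (k1.trans this) (by linarith)
      have k3 : ρ*Y/4 ≤ X := by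
        have : 3/4*(m+1)*Y ≤ 3/4*ρ*Y := by gcongr
        linarith
      have k4 : d*(ρ*Y/4*(ρ*Y/4+Y)) ≤ m^2+3*m+9 := by
        refine le_trans ?_ hle2
        rw [show -X*(-X + -Y) = X*(X+Y) by ring]
        gcongr
      have k5 : 16*(m^2+3*m+9) ≤ 18*(ρ*(ρ+4)) := by nlinarith
      have k6 : (d*Y^2)*(ρ*(ρ+4)) ≤ 18*(ρ*(ρ+4)) := by nlinarith
      have k7 := le_of_mul_le_mul_right k6 (by positivity)
      rw [neg_sq]; exact k7
    · have : y^2*2 ≤ x*(x+y) := by nlinarith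
      have k : (x-y*ρ)*(y^2*2) ≤ (x-y*ρ)*(x*(x+y)) := by gcongr
      nlinarith
  · have hx : 0 < x := by nlinarith
    have hxρ : ρ*y ≤ x := by linarith
    have k1 : (x-y*ρ)*(ρ*y*(ρ*y+y)) ≤ m^2+3*m+9 := by
      refine le_trans ?_ hle2
      gcongr
    have k2 : ((x-y*ρ)*y^2)*(ρ*(ρ+1)) ≤ 18*(ρ*(ρ+1)) := by linarith
    exact le_of_mul_le_mul_right k2 (by positivity)
end

section
lemma core_small (m x y : ℤ) (hm : -1 ≤ m) (h : x^3-m*x^2*y-(m+3)*x*y^2-y^3 = m^2+3*m+9)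
    (h1 : |y| ≤ |x|) (h2 : |y| ≤ |x+y|) (hP : 0 ≤ x*y*(x+y) ∨ x*y*(x+y) ≤ -(2*m+3)) :
    (m = 3 ∧ x = 3 ∧ y = 0) ∨ (m=-1∧x=2∧y=1) ∨ (m=5∧x=19∧y=3) ∨ (m=1∧x=-5∧y=-2) ∨ (m=5∧x=-4∧y=-1) ∨ (m=12∧x=-4∧y=-1) := by
  rcases eq_or_ne y 0 with hy0 | hy0
  · subst hy0
    left
    have := cube_case m x hm (by linear_combination h)
    exact ⟨this.1, this.2, rfl⟩
  right
  have hD : 0 < m^2+3*m+9 := by nlinarith [sq_nonneg (2*m+3)]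
  have hx0 : x ≠ 0 := by
    rintro rfl
    rw [abs_zero] at h1
    exact hy0 (abs_nonpos_iff.1 h1)
  rcases lt_or_gt_of_ne (mul_ne_zero hx0 hy0) with hxy | hxy
  · exfalso
    rcases lt_or_gt_of_ne hy0 with hy | hy
    · have hx : 0 < x := by by_contra hx; nlinarith
      have h2x : 2 * (-y) ≤ x := by
        rw [abs_of_neg hy] at h1 h2
        rw [abs_of_pos hx] at h1
        rw [abs_of_nonneg (by omega)] at h2
        omega
      refine neg_case2 m x (-y) hm (by omega) h2x ?_ (by linear_combination h)
      rcases hP with hP | hP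
      · exfalso
        have : 0 < x + y := by omega
        nlinarith
      · nlinarith
    · have hx : x < 0 := by by_contra hx; nlinarith
      have h2x : 2 * y ≤ -x := by
        rw [abs_of_pos hy] at h1 h2
        rw [abs_of_neg hx] at h1
        rw [abs_of_nonpos (by omega)] at h2
        omega
      have := neg_case1 m (-x) y hm hy h2x
      nlinarith
  · obtain ⟨ρ, hR, hgt, hlo, hlt, e1, e2⟩ := exists_roots m hm
    have hη : |(x:ℝ) - y * ρ 0| * (y:ℝ)^2 ≤ 18 := by
      refine core_bound m x y (ρ 0) (by exact_mod_cast hm) ?_ (hR.root 0) hgt hlo (by exact_mod_cast hxy) (by exact_mod_cast h1) (by exact_mod_cast h) ?_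
      · rcases le_or_gt 3 m with h3 | h3
        · left; exact_mod_cast h3
        · right
          have : m ≤ 2 := by omega
          exact_mod_cast this
      · intro hy
        have hy' : y < 0 := by exact_mod_cast hy
        have hx' : x < 0 := by by_contra hx; nlinarith
        have : 2*m+3 ≤ -(x*y*(x+y)) := by
          rcases hP with hP | hP
          · exfalso; have : x + y < 0 := by omega
            nlinarith
          · omega
        exact_mod_cast this
    rcases lt_or_ge m 5000 with h5 | h5
    · exact part2 m x y hm h5 ρ hR hgt hlo hlt e1 e2 hxy h hη
    · exact (part1 m x y h5 (ρ 0) hgt hlt hy0 h hη).elim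

/-- rotations of the basic solutions -/
def L1 (m x y : ℤ) : Prop :=
  (m = 3 ∧ x = 3 ∧ y = 0) ∨ (m=-1∧x=2∧y=1) ∨ (m=5∧x=19∧y=3) ∨ (m=1∧x=-5∧y=-2) ∨ (m=5∧x=-4∧y=-1) ∨ (m=12∧x=-4∧y=-1)

lemma stepA (m x y : ℤ) (hm : -1 ≤ m) (h : x^3-m*x^2*y-(m+3)*x*y^2-y^3 = m^2+3*m+9)
    (hP : 0 ≤ x*y*(x+y) ∨ x*y*(x+y) ≤ -(2*m+3)) :
    L1 m x y ∨ L1 m y (-x-y) ∨ L1 m (-x-y) x := by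
  have r1 := core_small m x y hm h
  have r2 := core_small m y (-x-y) hm (by linear_combination h)
  have r3 := core_small m (-x-y) x hm (by linear_combination h)
  have e2 : y * (-x-y) * (y + (-x-y)) = x*y*(x+y) := by ring
  have e3 : (-x-y) * x * ((-x-y)+x) = x*y*(x+y) := by ring
  rw [e2] at r2
  rw [e3] at r3
  have a1 : |-x-y| = |x+y| := by rw [← abs_neg]; congr 1; ring
  have a2 : |y+(-x-y)| = |x| := by rw [← abs_neg]; congr 1; ring
  have a3 : |(-x-y)+x| = |y| := by rw [← abs_neg]; congr 1; ring
  rw [a1, a2] at r2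
  rw [a1, a3] at r3
  rcases le_total |y| |x| with h1 | h1
  · rcases le_total |y| |x+y| with h2 | h2
    · exact Or.inl (r1 h1 h2 hP)
    · exact Or.inr (Or.inl (r2 h2 (h2.trans h1) hP))
  · rcases le_total |x| |x+y| with h2 | h2
    · exact Or.inr (Or.inr (r3 h2 h1 hP))
    · exact Or.inr (Or.inl (r2 (h2.trans h1) h2 hP))

def L2 (m x y : ℤ) : Prop := (m, x, y) ∈ ({((-1 : ℤ), (2 : ℤ), (1 : ℤ)), (-1, 1, -3), (-1, -3, 2), (1,-5,-2),(1,-2,7),(1,7,-5),(3,3,0),(3,0,-3),(3,-3,3),(5,-1,-2),(5,-2,3),(5,3,-1),(5,-4,-1),(5,-1,5),(5,5,-4),(5,19,3),(5,3,-22),(5,-22,19),(12,-4,-1),(12,-1,5),(12,5,-4),(66,-5,-2),(66,-2,7),(66,7,-5),(1259,-3,-19),(1259,-19,22),(1259,22,-3)} : Set (ℤ × ℤ × ℤ))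

lemma L1_fin (m x y : ℤ) (h : L1 m x y) : L2 m x y ∧ L2 m (-x-y) x ∧ L2 m y (-x-y) := by
  unfold L1 at h
  rcases h with ⟨rfl, rfl, rfl⟩ | ⟨rfl, rfl, rfl⟩ | ⟨rfl, rfl, rfl⟩ | ⟨rfl, rfl, rfl⟩ | ⟨rfl, rfl, rfl⟩ | ⟨rfl, rfl, rfl⟩ <;> simp [L2]

lemma stepA' (m x y : ℤ) (hm : -1 ≤ m) (h : x^3-m*x^2*y-(m+3)*x*y^2-y^3 = m^2+3*m+9)
    (hP : 0 ≤ x*y*(x+y) ∨ x*y*(x+y) ≤ -(2*m+3)) : L2 m x y := by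
  rcases stepA m x y hm h hP with h1 | h1 | h1
  · exact (L1_fin _ _ _ h1).1
  · have := (L1_fin _ _ _ h1).2.1
    rwa [show -y - (-x-y) = x by ring] at this
  · have := (L1_fin _ _ _ h1).2.2
    rwa [show -(-x-y) - x = y by ring] at this

lemma stepB1 (n x y m : ℤ) (h : L2 n x y) (h1 : m = -3 - x*y*(x+y) - n) (h2 : x*y*(x+y) < 0) (h3 : -(2*m+3) < x*y*(x+y)) : L2 m x y := by
  unfold L2 at h
  simp only [Set.mem_insert_iff, Set.mem_singleton_iff, Prod.mk.injEq] at h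
  rcases h with ⟨rfl, rfl, rfl⟩ | ⟨rfl, rfl, rfl⟩ | ⟨rfl, rfl, rfl⟩ | ⟨rfl, rfl, rfl⟩ | ⟨rfl, rfl, rfl⟩ | ⟨rfl, rfl, rfl⟩ | ⟨rfl, rfl, rfl⟩ | ⟨rfl, rfl, rfl⟩ | ⟨rfl, rfl, rfl⟩ | ⟨rfl, rfl, rfl⟩ | ⟨rfl, rfl, rfl⟩ | ⟨rfl, rfl, rfl⟩ | ⟨rfl, rfl, rfl⟩ | ⟨rfl, rfl, rfl⟩ | ⟨rfl, rfl, rfl⟩ | ⟨rfl, rfl, rfl⟩ | ⟨rfl, rfl, rfl⟩ | ⟨rfl, rfl, rfl⟩ | ⟨rfl, rfl, rfl⟩ | ⟨rfl, rfl, rfl⟩ | ⟨rfl, rfl, rfl⟩ | ⟨rfl, rfl, rfl⟩ | ⟨rfl, rfl, rfl⟩ | ⟨rfl, rfl, rfl⟩ | ⟨rfl, rfl, rfl⟩ | ⟨rfl, rfl, rfl⟩ | ⟨rfl, rfl, rfl⟩ <;>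
    first
    | (exfalso; omega)
    | (subst h1; norm_num [L2]; done)

lemma stepB2 (n x y m : ℤ) (h : L2 n (-y) (-x)) (h1 : m = -x*y*(x+y) + n) (h2 : x*y*(x+y) < 0) (h3 : -(2*m+3) < x*y*(x+y)) : L2 m x y := by
  obtain ⟨X, rfl⟩ : ∃ X, y = -X := ⟨-y, by ring⟩
  obtain ⟨Y, rfl⟩ : ∃ Y, x = -Y := ⟨-x, by ring⟩
  rw [neg_neg, neg_neg] at h
  unfold L2 at h
  simp only [Set.mem_insert_iff, Set.mem_singleton_iff, Prod.mk.injEq] at h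
  rcases h with ⟨rfl, rfl, rfl⟩ | ⟨rfl, rfl, rfl⟩ | ⟨rfl, rfl, rfl⟩ | ⟨rfl, rfl, rfl⟩ | ⟨rfl, rfl, rfl⟩ | ⟨rfl, rfl, rfl⟩ | ⟨rfl, rfl, rfl⟩ | ⟨rfl, rfl, rfl⟩ | ⟨rfl, rfl, rfl⟩ | ⟨rfl, rfl, rfl⟩ | ⟨rfl, rfl, rfl⟩ | ⟨rfl, rfl, rfl⟩ | ⟨rfl, rfl, rfl⟩ | ⟨rfl, rfl, rfl⟩ | ⟨rfl, rfl, rfl⟩ | ⟨rfl, rfl, rfl⟩ | ⟨rfl, rfl, rfl⟩ | ⟨rfl, rfl, rfl⟩ | ⟨rfl, rfl, rfl⟩ | ⟨rfl, rfl, rfl⟩ | ⟨rfl, rfl, rfl⟩ | ⟨rfl, rfl, rfl⟩ | ⟨rfl, rfl, rfl⟩ | ⟨rfl, rfl, rfl⟩ | ⟨rfl, rfl, rfl⟩ | ⟨rfl, rfl, rfl⟩ | ⟨rfl, rfl, rfl⟩ <;>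
    first
    | (exfalso; omega)
    | (subst h1; norm_num [L2]; done)

lemma main_fwd (m x y : ℤ) (hm : -1 ≤ m) (h : x^3-m*x^2*y-(m+3)*x*y^2-y^3 = m^2+3*m+9) : L2 m x y := by
  by_cases hP : 0 ≤ x*y*(x+y) ∨ x*y*(x+y) ≤ -(2*m+3)
  · exact stepA' m x y hm h hP
  rw [not_or, not_le, not_le] at hP
  obtain ⟨hP1, hP2⟩ := hP
  obtain ⟨n, hn⟩ : ∃ n, n = -3 - x*y*(x+y) - m := ⟨_, rfl⟩
  have hFn : x^3-n*x^2*y-(n+3)*x*y^2-y^3 = n^2+3*n+9 := by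
    rw [hn]; linear_combination h
  rcases le_or_gt (-1) n with h1 | h1
  · exact stepB1 n x y m (stepA' n x y h1 hFn (by right; omega)) (by omega) hP1 hP2
  · refine stepB2 (-n-3) x y m (stepA' (-n-3) (-y) (-x) (by omega) (by linear_combination hFn) ?_) (by rw [hn]; ring) hP1 hP2
    left
    have : (-y)*(-x)*(-y+-x) = -(x*y*(x+y)) := by ring
    rw [this]; omega
end

theorem stmt5 (m x y : ℤ) (hm : -1 ≤ m) :
    F m x y = m ^ 2 + 3 * m + 9 ↔
      (m, x, y) ∈ ({((-1 : ℤ), (2 : ℤ), (1 : ℤ)), (-1, 1, -3), (-1, -3, 2),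
        (1, -5, -2), (1, -2, 7), (1, 7, -5),
        (3, 3, 0), (3, 0, -3), (3, -3, 3),
        (5, -1, -2), (5, -2, 3), (5, 3, -1),
        (5, -4, -1), (5, -1, 5), (5, 5, -4),
        (5, 19, 3), (5, 3, -22), (5, -22, 19),
        (12, -4, -1), (12, -1, 5), (12, 5, -4),
        (66, -5, -2), (66, -2, 7), (66, 7, -5),
        (1259, -3, -19), (1259, -19, 22), (1259, 22, -3)} : Set (ℤ × ℤ × ℤ)) := by
  constructor
  · intro h
    exact main_fwd m x y hm h
  · intro h
    simp only [Set.mem_insert_iff, Set.mem_singleton_iff, Prod.mk.injEq] at h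
    unfold F
    rcases h with ⟨rfl, rfl, rfl⟩ | ⟨rfl, rfl, rfl⟩ | ⟨rfl, rfl, rfl⟩ | ⟨rfl, rfl, rfl⟩ | ⟨rfl, rfl, rfl⟩ | ⟨rfl, rfl, rfl⟩ | ⟨rfl, rfl, rfl⟩ | ⟨rfl, rfl, rfl⟩ | ⟨rfl, rfl, rfl⟩ | ⟨rfl, rfl, rfl⟩ | ⟨rfl, rfl, rfl⟩ | ⟨rfl, rfl, rfl⟩ | ⟨rfl, rfl, rfl⟩ | ⟨rfl, rfl, rfl⟩ | ⟨rfl, rfl, rfl⟩ | ⟨rfl, rfl, rfl⟩ | ⟨rfl, rfl, rfl⟩ | ⟨rfl, rfl, rfl⟩ | ⟨rfl, rfl, rfl⟩ | ⟨rfl, rfl, rfl⟩ | ⟨rfl, rfl, rfl⟩ | ⟨rfl, rfl, rfl⟩ | ⟨rfl, rfl, rfl⟩ | ⟨rfl, rfl, rfl⟩ | ⟨rfl, rfl, rfl⟩ | ⟨rfl, rfl, rfl⟩ | ⟨rfl, rfl, rfl⟩ <;> norm_num
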